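/- arXiv:2008.02019 — 2 statements merged into one kernel-verified Lean document; each statement's English description precedes it below -/
import Mathlib

section
/- Let k ≥ 2 be an integer and let ℓ = (l_1, …, l_m) with m ≥ 3 be the segment sequence of some tree. Then there exists a tree T with segment sequence ℓ that maximizes the Steiner k-Wiener index SW_k among all trees with segment sequence ℓ and that is a quasi-caterpillar with the following property: if r_1, r_2, …, r_c are the lengths of the segments lying on the backbone, listed in the order in which these segments occur along the backbone from one end to the other, then the sequence is unimodal, i.e., there is an index j ∈ {1, …, c} with r_1 ≤ r_2 ≤ ⋯ ≤ r_j ≥ r_{j+1} ≥ ⋯ ≥ r_c. -/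
open SimpleGraph Finset


noncomputable def steinerDist {V : Type*} (G : SimpleGraph V) (S : Finset V) : ℕ :=
  sInf {n | ∃ H : G.Subgraph, H.Connected ∧ ↑S ⊆ H.verts ∧ H.edgeSet.ncard = n}

noncomputable def steinerWiener {V : Type*} [Fintype V] (G : SimpleGraph V) (k : ℕ) : ℕ :=
  ∑ S ∈ Finset.powersetCard k (Finset.univ : Finset V), steinerDist G S

noncomputable def degN {V : Type*} (G : SimpleGraph V) (v : V) : ℕ := (G.neighborSet v).ncard

def IsLeafV {V : Type*} (G : SimpleGraph V) (v : V) : Prop := degN G v = 1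

def IsBranchV {V : Type*} (G : SimpleGraph V) (v : V) : Prop := 3 ≤ degN G v

def IsSegment {V : Type*} (G : SimpleGraph V) (u v : V) : Prop :=
  u ≠ v ∧ (IsLeafV G u ∨ IsBranchV G u) ∧ (IsLeafV G v ∨ IsBranchV G v) ∧
    ∃ w : G.Walk u v, w.IsPath ∧ ∀ x ∈ w.support, x ≠ u → x ≠ v → degN G x = 2

noncomputable def segmentMultiset {V : Type*} [Fintype V] (G : SimpleGraph V) : Multiset ℕ :=
  ((Set.toFinite {e : Sym2 V | ∃ u v, e = s(u, v) ∧ IsSegment G u v}).toFinset).val.map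
    (Sym2.lift ⟨fun u v => G.dist u v, fun _ _ => SimpleGraph.dist_comm⟩)

/-- A graph is a path graph if it has a Hamiltonian path. -/
def IsPathGraph {V : Type*} (G : SimpleGraph V) : Prop :=
  ∃ (u v : V) (w : G.Walk u v), w.IsPath ∧ ∀ x, x ∈ w.support

/-- The set of vertices lying on pendant segments, other than branch-vertex endpoints. -/
def pendantSegmentVertices {V : Type*} (G : SimpleGraph V) : Set V :=
  {x | ∃ (u v : V) (w : G.Walk u v), IsSegment G u v ∧ IsLeafV G u ∧ w.IsPath ∧
      (∀ y ∈ w.support, y ≠ u → y ≠ v → degN G y = 2) ∧ x ∈ w.support ∧ ¬ IsBranchV G x}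

/-- A quasi-caterpillar: a tree such that deleting all vertices of its pendant segments other
than their branch-vertex endpoints results in a path. -/
def IsQuasiCaterpillar {V : Type*} [Fintype V] (G : SimpleGraph V) : Prop :=
  G.IsTree ∧ IsPathGraph (G.induce (pendantSegmentVertices G)ᶜ)

/-- A backbone: a longest path containing all branch vertices. -/
def IsBackbone {V : Type*} (G : SimpleGraph V) {u v : V} (w : G.Walk u v) : Prop :=
  w.IsPath ∧ (∀ x, IsBranchV G x → x ∈ w.support) ∧
    ∀ (a b : V) (w' : G.Walk a b), w'.IsPath →
      (∀ x, IsBranchV G x → x ∈ w'.support) → w'.length ≤ w.length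

namespace SimpleGraph

section Cut

variable {V : Type*} {T : SimpleGraph V} {a b : V} {C D : Set V}

/-- `C` contains `a` but not `b`, and `ab` is the only edge of `T` leaving `C`. -/
structure IsCut (T : SimpleGraph V) (a b : V) (C : Set V) : Prop where
  left_mem : a ∈ C
  right_notMem : b ∉ C
  eq_of_adj : ∀ x y, T.Adj x y → x ∈ C → y ∉ C → x = a ∧ y = b

theorem Connected.mem_of_forall_adj (hT : T.Connected) {x : V} (hx : x ∈ C)
    (hC : ∀ y z, T.Adj y z → y ∈ C → z ∈ C) (z : V) : z ∈ C := by
  obtain ⟨w⟩ := hT x z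
  induction w with
  | nil => exact hx
  | cons h _ ih => exact ih (hC _ _ h hx)

theorem IsCut.compl (h : IsCut T a b C) : IsCut T b a Cᶜ where
  left_mem := h.right_notMem
  right_notMem := fun h' => h' h.left_mem
  eq_of_adj := fun x y hxy hx hy => (h.eq_of_adj y x hxy.symm (not_not.1 hy) hx).symm

theorem IsCut.subset (hT : T.Connected) (hC : IsCut T a b C) (hD : IsCut T a b D) : C ⊆ D := by
  intro x hxC
  by_contra hxD
  have := hT.mem_of_forall_adj (C := C \ D) ⟨hxC, hxD⟩ (fun y z hyz hy => by
    refine ⟨?_, fun hz => ?_⟩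
    · by_contra hz
      exact hy.2 ((hC.eq_of_adj y z hyz hy.1 hz).1 ▸ hD.left_mem)
    · exact hC.right_notMem ((hD.eq_of_adj z y hyz.symm hz hy.2).2 ▸ hy.1)) a
  exact this.2 hD.left_mem

theorem IsCut.unique (hT : T.Connected) (hC : IsCut T a b C) (hD : IsCut T a b D) : C = D :=
  (hC.subset hT hD).antisymm (hD.subset hT hC)

/-- The vertices on the `a`-side of the edge `ab`. -/
def side (T : SimpleGraph V) (a b : V) : Set V :=
  {x | (T.deleteEdges {s(a, b)}).Reachable a x}

theorem IsTree.isCut_side (hT : T.IsTree) (h : T.Adj a b) : IsCut T a b (T.side a b) where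
  left_mem := Reachable.refl _
  right_notMem := isBridge_iff.1 (isAcyclic_iff_forall_adj_isBridge.1 hT.2 h)
  eq_of_adj := by
    have hb : b ∉ T.side a b := isBridge_iff.1 (isAcyclic_iff_forall_adj_isBridge.1 hT.2 h)
    intro x y hxy hx hy
    by_cases he : s(x, y) = s(a, b)
    · rcases Sym2.eq_iff.1 he with h' | h'
      · exact h'
      · exact absurd (h'.1 ▸ hx) hb
    · refine absurd ?_ hy
      refine Reachable.trans hx (Adj.reachable ?_)
      rw [deleteEdges_adj]
      exact ⟨hxy, he⟩

theorem IsTree.isCut_iff (hT : T.IsTree) (h : T.Adj a b) : IsCut T a b C ↔ C = T.side a b :=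
  ⟨fun hC => hC.unique hT.1 (hT.isCut_side h), fun hC => hC ▸ hT.isCut_side h⟩

theorem IsTree.side_swap (hT : T.IsTree) (h : T.Adj a b) : T.side b a = (T.side a b)ᶜ :=
  ((hT.isCut_iff h.symm).1 (hT.isCut_side h).compl).symm

theorem isAcyclic_of_forall_isCut (h : ∀ a b, T.Adj a b → ∃ C, IsCut T a b C) : T.IsAcyclic := by
  rw [isAcyclic_iff_forall_adj_isBridge]
  intro a b hab
  rw [isBridge_iff]
  intro hr
  obtain ⟨C, hC⟩ := h a b hab
  obtain ⟨w⟩ := hr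
  have : ∀ x y, (T.deleteEdges {s(a, b)}).Walk x y → x ∈ C → y ∈ C := by
    intro x y w
    induction w with
    | nil => exact id
    | cons h _ ih =>
      intro hx
      refine ih ?_
      by_contra hy
      rw [deleteEdges_adj] at h
      obtain ⟨rfl, rfl⟩ := hC.eq_of_adj _ _ h.1 hx hy
      exact h.2 rfl
  exact hC.right_notMem (this _ _ w hC.left_mem)

end Cut
end SimpleGraph

namespace SimpleGraph

section Exchange

open scoped Classical

variable {V : Type*} {T : SimpleGraph V} {v u a b x y : V} {A B C K S : Set V}

/-- The endpoint replacing the endpoint `x` of an edge `xy` when the branches with vertex set `K`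
attached to `v` and `u` trade places. -/
noncomputable def exchangeEnd (v u : V) (K : Set V) (x y : V) : V :=
  if y ∈ K then Equiv.swap v u x else x

/-- The graph obtained from `T` by exchanging those branches at `v` and `u` whose vertices lie
in `K`. -/
noncomputable def exchange (T : SimpleGraph V) (v u : V) (K : Set V) : SimpleGraph V where
  Adj x y := T.Adj (exchangeEnd v u K x y) (exchangeEnd v u K y x)
  symm := ⟨fun _ _ h => h.symm⟩
  loopless := ⟨fun _ h => T.loopless.irrefl _ h⟩

theorem exchange_adj : (T.exchange v u K).Adj x y ↔
    T.Adj (exchangeEnd v u K x y) (exchangeEnd v u K y x) := Iff.rfl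

theorem exchangeEnd_comm : exchangeEnd v u K x y = exchangeEnd u v K x y := by
  unfold exchangeEnd; rw [Equiv.swap_comm]

theorem exchange_comm : T.exchange v u K = T.exchange u v K := by
  ext x y
  rw [exchange_adj, exchange_adj, exchangeEnd_comm, exchangeEnd_comm (x := y)]

theorem exchangeEnd_cases (v u : V) (K : Set V) (x y : V) : exchangeEnd v u K x y = x ∨
    (x = v ∧ exchangeEnd v u K x y = u) ∨ (x = u ∧ exchangeEnd v u K x y = v) := by
  unfold exchangeEnd
  split_ifs with h
  · by_cases hv : x = v
    · subst hv; simp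
    by_cases hu : x = u
    · subst hu; simp
    · simp [Equiv.swap_apply_of_ne_of_ne hv hu]
  · simp

theorem exchangeEnd_mem_iff (h : v ∈ S ↔ u ∈ S) : exchangeEnd v u K x y ∈ S ↔ x ∈ S := by
  rcases exchangeEnd_cases v u K x y with h' | ⟨rfl, h'⟩ | ⟨rfl, h'⟩ <;> rw [h']
  · exact h.symm
  · exact h

theorem exchangeEnd_of_ne (hv : x ≠ v) (hu : x ≠ u) : exchangeEnd v u K x y = x := by
  rcases exchangeEnd_cases v u K x y with h' | ⟨rfl, h'⟩ | ⟨rfl, h'⟩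
  · exact h'
  · exact absurd rfl hv
  · exact absurd rfl hu

theorem exchangeEnd_of_notMem (hy : y ∉ K) : exchangeEnd v u K x y = x := by
  simp [exchangeEnd, hy]

theorem exchangeEnd_exchangeEnd (hv : v ∉ K) (hu : u ∉ K) :
    exchangeEnd v u K (exchangeEnd v u K x y) (exchangeEnd v u K y x) = x := by
  have : exchangeEnd v u K y x ∈ K ↔ y ∈ K := exchangeEnd_mem_iff (by simp [hv, hu])
  unfold exchangeEnd at *
  by_cases hy : y ∈ K <;> simp_all

/-- The permutation of ordered pairs carrying the edges of `T` to those of `T.exchange v u K`. -/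
noncomputable def exchangePerm (hv : v ∉ K) (hu : u ∉ K) : Equiv.Perm (V × V) :=
  Function.Involutive.toPerm
    (fun p => (exchangeEnd v u K p.1 p.2, exchangeEnd v u K p.2 p.1))
    (fun _ => Prod.ext (exchangeEnd_exchangeEnd hv hu) (exchangeEnd_exchangeEnd hv hu))

/-- `A` and `B` are disjoint unions of branches of `T` hanging at `v` and `u` respectively. -/
structure IsExchange (T : SimpleGraph V) (v u : V) (A B : Set V) : Prop where
  ne : v ≠ u
  left_notMem_left : v ∉ A
  left_notMem_right : v ∉ B
  right_notMem_left : u ∉ A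
  right_notMem_right : u ∉ B
  disjoint : Disjoint A B
  eq_left : ∀ x y, T.Adj x y → x ∈ A → y ∉ A → y = v
  eq_right : ∀ x y, T.Adj x y → x ∈ B → y ∉ B → y = u

namespace IsExchange

theorem symm (h : IsExchange T v u A B) : IsExchange T u v B A where
  ne := h.ne.symm
  left_notMem_left := h.right_notMem_right
  left_notMem_right := h.right_notMem_left
  right_notMem_left := h.left_notMem_right
  right_notMem_right := h.left_notMem_left
  disjoint := h.disjoint.symm
  eq_left := h.eq_right
  eq_right := h.eq_left

theorem left_notMem (h : IsExchange T v u A B) : v ∉ A ∪ B := by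
  simp [h.left_notMem_left, h.left_notMem_right]

theorem right_notMem (h : IsExchange T v u A B) : u ∉ A ∪ B := by
  simp [h.right_notMem_left, h.right_notMem_right]

theorem exchange_symm : T.exchange u v (B ∪ A) = T.exchange v u (A ∪ B) := by
  rw [exchange_comm, Set.union_comm]

theorem exchange_adj_exchangeEnd (h : IsExchange T v u A B) :
    (T.exchange v u (A ∪ B)).Adj (exchangeEnd v u (A ∪ B) x y) (exchangeEnd v u (A ∪ B) y x) ↔
      T.Adj x y := by
  rw [exchange_adj, exchangeEnd_exchangeEnd h.left_notMem h.right_notMem,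
    exchangeEnd_exchangeEnd h.left_notMem h.right_notMem]

theorem connected (h : IsExchange T v u A B) (hT : T.Connected) :
    (T.exchange v u (A ∪ B)).Connected := by
  set K := A ∪ B with hK
  set T' := T.exchange v u K with hT'
  have hu : T'.Reachable v u := by
    by_contra hu
    have hu' : u ∈ ({x | T'.Reachable v x} \ K) ∪ A := by
      refine hT.mem_of_forall_adj (x := v) (Or.inl ⟨Reachable.refl _, h.left_notMem⟩) ?_ u
      rintro x y hxy (⟨hx, hxK⟩ | hxA)
      · by_cases hyK : y ∈ K
        · rcases hyK with hyA | hyB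
          · exact Or.inr hyA
          · have := h.eq_right y x hxy.symm hyB (fun h' => hxK (Or.inr h'))
            exact absurd (this ▸ hx) hu
        · refine Or.inl ⟨Reachable.trans hx (Adj.reachable ?_), hyK⟩
          rw [hT', exchange_adj, exchangeEnd_of_notMem hxK, exchangeEnd_of_notMem hyK]
          exact hxy
      · by_cases hyA : y ∈ A
        · exact Or.inr hyA
        · rw [h.eq_left x y hxy hxA hyA]
          exact Or.inl ⟨Reachable.refl _, h.left_notMem⟩
    rcases hu' with hu' | hu'
    · exact hu hu'.1
    · exact h.right_notMem_left hu'
  have hend : ∀ x y, T'.Reachable x (exchangeEnd v u K x y) := by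
    intro x y
    rcases exchangeEnd_cases v u K x y with h' | ⟨rfl, h'⟩ | ⟨rfl, h'⟩ <;> rw [h']
    · exact hu
    · exact hu.symm
  rw [connected_iff_exists_forall_reachable]
  refine ⟨v, hT.mem_of_forall_adj (C := {x | T'.Reachable v x}) (x := v) (Reachable.refl _) ?_⟩
  intro x y hxy hx
  refine Reachable.trans hx ((hend x y).trans (Reachable.trans ?_ (hend y x).symm))
  exact (h.exchange_adj_exchangeEnd.2 hxy).reachable

theorem isCut_of_iff (h : IsExchange T v u A B) (hC : IsCut T a b C) (hvu : v ∈ C ↔ u ∈ C) :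
    IsCut (T.exchange v u (A ∪ B)) (exchangeEnd v u (A ∪ B) a b) (exchangeEnd v u (A ∪ B) b a)
      C where
  left_mem := (exchangeEnd_mem_iff hvu).2 hC.left_mem
  right_notMem := fun h' => hC.right_notMem ((exchangeEnd_mem_iff hvu).1 h')
  eq_of_adj := by
    intro x y hxy hx hy
    obtain ⟨rfl, rfl⟩ := hC.eq_of_adj _ _ (exchange_adj.1 hxy) ((exchangeEnd_mem_iff hvu).2 hx)
      (fun h' => hy ((exchangeEnd_mem_iff hvu).1 h'))
    rw [exchangeEnd_exchangeEnd h.left_notMem h.right_notMem,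
      exchangeEnd_exchangeEnd h.left_notMem h.right_notMem]
    exact ⟨rfl, rfl⟩

theorem subset_of_mem (h : IsExchange T v u A B) (hT : T.Connected) (hC : IsCut T a b C)
    (hv : v ∈ C) (hu : u ∉ C) : A ⊆ C ∧ a ∉ A ∧ b ∉ A := by
  have hadj : ∀ x y, T.Adj x y → x ∈ C ∪ A → y ∉ C ∪ A → x ∉ A ∧ x = a ∧ y = b := by
    intro x y hxy hx hy
    have hxA : x ∉ A := fun hxA => hy (Or.inl (h.eq_left x y hxy hxA (fun h' => hy (Or.inr h')) ▸ hv))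
    exact ⟨hxA, hC.eq_of_adj x y hxy (hx.resolve_right hxA) (fun h' => hy (Or.inl h'))⟩
  have hab : a ∉ A ∧ b ∉ A := by
    by_contra hcon
    have : u ∈ C ∪ A := by
      refine hT.mem_of_forall_adj (x := v) (Or.inl hv) ?_ u
      intro x y hxy hx
      by_contra hy
      obtain ⟨hxA, rfl, rfl⟩ := hadj x y hxy hx hy
      exact hcon ⟨hxA, fun h' => hy (Or.inr h')⟩
    exact this.elim hu h.right_notMem_left
  have hcut : IsCut T a b (C ∪ A) :=
    ⟨Or.inl hC.left_mem, fun h' => h'.elim hC.right_notMem hab.2,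
      fun x y hxy hx hy => (hadj x y hxy hx hy).2⟩
  refine ⟨?_, hab⟩
  rw [hC.unique hT hcut]
  exact Set.subset_union_right

theorem disjoint_of_mem (h : IsExchange T v u A B) (hT : T.Connected) (hC : IsCut T a b C)
    (hv : v ∈ C) (hu : u ∉ C) : B ⊆ Cᶜ ∧ a ∉ B ∧ b ∉ B := by
  obtain ⟨h1, h2, h3⟩ := h.symm.subset_of_mem hT hC.compl hu (fun h' => h' hv)
  exact ⟨h1, h3, h2⟩

theorem isCut_of_mem (h : IsExchange T v u A B) (hT : T.Connected) (hC : IsCut T a b C)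
    (hv : v ∈ C) (hu : u ∉ C) :
    IsCut (T.exchange v u (A ∪ B)) (exchangeEnd v u (A ∪ B) a b) (exchangeEnd v u (A ∪ B) b a)
      ((C \ A) ∪ B) := by
  obtain ⟨-, haA, hbA⟩ := h.subset_of_mem hT hC hv hu
  obtain ⟨hBC, haB, hbB⟩ := h.disjoint_of_mem hT hC hv hu
  have ha : a ∉ A ∪ B := by simp [haA, haB]
  have hb : b ∉ A ∪ B := by simp [hbA, hbB]
  rw [exchangeEnd_of_notMem ha, exchangeEnd_of_notMem hb]
  refine ⟨Or.inl ⟨hC.left_mem, haA⟩, fun h' => h'.elim (fun h' => hC.right_notMem h'.1) hbB, ?_⟩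
  intro x y hxy hx hy
  rw [exchange_adj] at hxy
  have hyC : y ∉ C ∨ y ∈ A := by
    by_contra! hcon
    exact hy (Or.inl ⟨hcon.1, hcon.2⟩)
  have hyB : y ∉ B := fun h' => hy (Or.inr h')
  by_cases hxB : x ∈ B
  · have h1 := h.eq_right _ _ hxy
      ((exchangeEnd_mem_iff (by simp [h.left_notMem_right, h.right_notMem_right])).2 hxB)
      (fun h' => hyB ((exchangeEnd_mem_iff
        (by simp [h.left_notMem_right, h.right_notMem_right])).1 h'))
    have hyv : y = v := by
      simp only [exchangeEnd, Set.mem_union, hxB, or_true, if_true] at h1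
      rwa [Equiv.swap_apply_eq_iff, Equiv.swap_apply_right] at h1
    subst hyv
    exact (hyC.elim (fun h' => h' hv) h.left_notMem_left).elim
  · have hx' := hx.resolve_right hxB
    have hxK : x ∉ A ∪ B := by simp [hx'.2, hxB]
    rw [exchangeEnd_of_notMem hxK] at hxy
    by_cases hyA : y ∈ A
    · have h1 := h.eq_left _ _ hxy.symm hyA (fun h' => hx'.2 ((exchangeEnd_mem_iff
        (by simp [h.left_notMem_left, h.right_notMem_left])).1 h'))
      have hxu : x = u := by
        simp only [exchangeEnd, Set.mem_union, hyA, true_or, if_true] at h1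
        rwa [Equiv.swap_apply_eq_iff, Equiv.swap_apply_left] at h1
      exact absurd (hxu ▸ hx'.1) hu
    · rw [exchangeEnd_of_notMem (by simp [hyA, hyB])] at hxy
      exact hC.eq_of_adj x y hxy hx'.1 (hyC.resolve_right hyA)

theorem exists_isCut (h : IsExchange T v u A B) (hT : T.IsTree) (hab : T.Adj a b) :
    ∃ D, IsCut (T.exchange v u (A ∪ B)) (exchangeEnd v u (A ∪ B) a b)
      (exchangeEnd v u (A ∪ B) b a) D := by
  have hC := hT.isCut_side hab
  by_cases hv : v ∈ T.side a b <;> by_cases hu : u ∈ T.side a b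
  · exact ⟨_, h.isCut_of_iff hC (by simp [hv, hu])⟩
  · exact ⟨_, h.isCut_of_mem hT.1 hC hv hu⟩
  · have := h.symm.isCut_of_mem hT.1 hC hu hv
    rw [exchange_symm, exchangeEnd_comm, exchangeEnd_comm (x := b), Set.union_comm B A] at this
    exact ⟨_, this⟩
  · exact ⟨_, h.isCut_of_iff hC (by simp [hv, hu])⟩

theorem isTree (h : IsExchange T v u A B) (hT : T.IsTree) : (T.exchange v u (A ∪ B)).IsTree := by
  refine ⟨h.connected hT.1, isAcyclic_of_forall_isCut fun a b hab => ?_⟩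
  obtain ⟨D, hD⟩ := h.exists_isCut hT (exchange_adj.1 hab)
  rw [exchangeEnd_exchangeEnd h.left_notMem h.right_notMem,
      exchangeEnd_exchangeEnd h.left_notMem h.right_notMem] at hD
  exact ⟨D, hD⟩

end IsExchange

end Exchange

end SimpleGraph

namespace SimpleGraph

section SideSum

open scoped Classical

variable {V : Type*} [Fintype V] {T : SimpleGraph V} {v u a b : V} {A B : Set V}

/-- The sum of `g` over the sizes of the two sides of all edges of `T`. -/
noncomputable def sideSum (T : SimpleGraph V) (g : ℕ → ℕ) : ℕ :=
  ∑ p : V × V with T.Adj p.1 p.2, g (T.side p.1 p.2).ncard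

/-- The darts of `T` pointing from `v` towards `u`. -/
noncomputable def dartsBetween (T : SimpleGraph V) (v u : V) : Finset (V × V) :=
  {p | T.Adj p.1 p.2 ∧ v ∈ T.side p.1 p.2 ∧ u ∉ T.side p.1 p.2}

theorem mem_dartsBetween {p : V × V} : p ∈ T.dartsBetween v u ↔
    T.Adj p.1 p.2 ∧ v ∈ T.side p.1 p.2 ∧ u ∉ T.side p.1 p.2 := by
  simp [dartsBetween]

theorem IsTree.ncard_side_swap (hT : T.IsTree) (h : T.Adj a b) :
    (T.side b a).ncard = Fintype.card V - (T.side a b).ncard := by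
  rw [hT.side_swap h, Set.ncard_compl, Nat.card_eq_fintype_card]

theorem IsTree.sum_adj_eq (hT : T.IsTree) (v u : V) (F : V × V → ℕ) :
    ∑ p : V × V with T.Adj p.1 p.2, F p =
      ∑ p : V × V with (T.Adj p.1 p.2 ∧ (v ∈ T.side p.1 p.2 ↔ u ∈ T.side p.1 p.2)), F p +
        ∑ p ∈ T.dartsBetween v u, (F p + F p.swap) := by
  rw [← Finset.sum_filter_add_sum_filter_not _
    (fun p : V × V => (v ∈ T.side p.1 p.2 ↔ u ∈ T.side p.1 p.2)), Finset.filter_filter]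
  congr 1
  rw [Finset.sum_add_distrib, ← Finset.sum_filter_add_sum_filter_not _
    (fun p : V × V => v ∈ T.side p.1 p.2), Finset.filter_filter, Finset.filter_filter,
    Finset.filter_filter]
  congr 1
  · refine Finset.sum_congr ?_ fun _ _ => rfl
    ext p
    simp only [dartsBetween, Finset.mem_filter, Finset.mem_univ, true_and]
    tauto
  · refine Finset.sum_nbij' Prod.swap Prod.swap ?_ ?_ ?_ ?_ ?_
    · rintro ⟨a, b⟩ hp
      simp only [Finset.mem_filter, Finset.mem_univ, true_and, mem_dartsBetween,
        Prod.swap_prod_mk] at hp ⊢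
      rw [hT.side_swap hp.1]
      simp only [Set.mem_compl_iff]
      exact ⟨T.symm.symm _ _ hp.1, by tauto⟩
    · rintro ⟨a, b⟩ hp
      simp only [Finset.mem_filter, Finset.mem_univ, true_and, mem_dartsBetween,
        Prod.swap_prod_mk] at hp ⊢
      rw [hT.side_swap hp.1]
      simp only [Set.mem_compl_iff]
      exact ⟨T.symm.symm _ _ hp.1, by tauto⟩
    · simp
    · simp
    · simp

namespace IsExchange

theorem sideSum_eq (h : IsExchange T v u A B) (g : ℕ → ℕ) :
    sideSum (T.exchange v u (A ∪ B)) g = ∑ p : V × V with T.Adj p.1 p.2,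
      g ((T.exchange v u (A ∪ B)).side (exchangeEnd v u (A ∪ B) p.1 p.2)
        (exchangeEnd v u (A ∪ B) p.2 p.1)).ncard := by
  unfold sideSum
  symm
  refine Finset.sum_equiv (exchangePerm h.left_notMem h.right_notMem) ?_ fun _ _ => rfl
  intro p
  simp only [Finset.mem_filter, Finset.mem_univ, true_and]
  exact h.exchange_adj_exchangeEnd.symm

omit [Fintype V] in
theorem side_eq_of_isCut {C : Set V} (h : IsExchange T v u A B) (hT : T.IsTree) (hab : T.Adj a b)
    (hC : IsCut (T.exchange v u (A ∪ B)) (exchangeEnd v u (A ∪ B) a b)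
      (exchangeEnd v u (A ∪ B) b a) C) :
    (T.exchange v u (A ∪ B)).side (exchangeEnd v u (A ∪ B) a b) (exchangeEnd v u (A ∪ B) b a)
      = C :=
  (((h.isTree hT).isCut_iff (h.exchange_adj_exchangeEnd.2 hab)).1 hC).symm

theorem ncard_side_of_mem (h : IsExchange T v u A B) (hT : T.IsTree) (hab : T.Adj a b)
    (hv : v ∈ T.side a b) (hu : u ∉ T.side a b) :
    A.ncard < (T.side a b).ncard ∧ (T.side a b).ncard + B.ncard < Fintype.card V ∧
    ((T.exchange v u (A ∪ B)).side (exchangeEnd v u (A ∪ B) a b)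
      (exchangeEnd v u (A ∪ B) b a)).ncard = (T.side a b).ncard - A.ncard + B.ncard := by
  have hC := hT.isCut_side hab
  obtain ⟨hA, -⟩ := h.subset_of_mem hT.1 hC hv hu
  obtain ⟨hB, -⟩ := h.disjoint_of_mem hT.1 hC hv hu
  rw [h.side_eq_of_isCut hT hab (h.isCut_of_mem hT.1 hC hv hu), Set.ncard_union_eq,
    Set.ncard_sdiff hA]
  · refine ⟨Set.ncard_lt_ncard ⟨hA, fun h' => h.left_notMem_left (h' hv)⟩, ?_, rfl⟩
    rw [← Set.ncard_union_eq (Set.disjoint_right.2 hB), ← Nat.card_eq_fintype_card,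
      ← Set.ncard_univ]
    refine Set.ncard_lt_ncard ⟨Set.subset_univ _, fun h' => ?_⟩
    exact (h' (Set.mem_univ u)).elim hu h.right_notMem_right
  · exact Set.disjoint_of_subset_left Set.sdiff_subset (Set.disjoint_right.2 hB)

theorem exists_sideSum_eq (h : IsExchange T v u A B) (hT : T.IsTree) (g : ℕ → ℕ) :
    ∃ R, sideSum T g = R + ∑ p ∈ T.dartsBetween v u, (g (T.side p.1 p.2).ncard +
        g (Fintype.card V - (T.side p.1 p.2).ncard)) ∧
      sideSum (T.exchange v u (A ∪ B)) g = R + ∑ p ∈ T.dartsBetween v u,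
        (g ((T.side p.1 p.2).ncard - A.ncard + B.ncard) +
        g (Fintype.card V - ((T.side p.1 p.2).ncard - A.ncard + B.ncard))) := by
  refine ⟨∑ p : V × V with (T.Adj p.1 p.2 ∧ (v ∈ T.side p.1 p.2 ↔ u ∈ T.side p.1 p.2)),
    g (T.side p.1 p.2).ncard, ?_, ?_⟩
  · rw [sideSum, hT.sum_adj_eq v u]
    congr 1
    refine Finset.sum_congr rfl fun p hp => ?_
    rw [Prod.fst_swap, Prod.snd_swap, hT.ncard_side_swap (mem_dartsBetween.1 hp).1]
  · rw [h.sideSum_eq, hT.sum_adj_eq v u]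
    congr 1
    · refine Finset.sum_congr rfl fun p hp => ?_
      simp only [Finset.mem_filter, Finset.mem_univ, true_and] at hp
      rw [h.side_eq_of_isCut hT hp.1 (h.isCut_of_iff (hT.isCut_side hp.1) hp.2)]
    · refine Finset.sum_congr rfl fun p hp => ?_
      obtain ⟨hp, hv, hu⟩ := mem_dartsBetween.1 hp
      rw [Prod.fst_swap, Prod.snd_swap,
        (h.isTree hT).ncard_side_swap (h.exchange_adj_exchangeEnd.2 hp),
        (h.ncard_side_of_mem hT hp hv hu).2.2]

end IsExchange

end SideSum

end SimpleGraph

namespace SimpleGraph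

open scoped Classical

section PathSeq

variable {V : Type*} {T : SimpleGraph V} {N : ℕ} {z : ℕ → V} {i j : ℕ}

/-- `z 0, z 1, …, z N` are the successive vertices of a path in `T`. -/
structure IsPathSeq (T : SimpleGraph V) (N : ℕ) (z : ℕ → V) : Prop where
  adj : ∀ i < N, T.Adj (z i) (z (i + 1))
  inj : ∀ i ≤ N, ∀ j ≤ N, z i = z j → i = j

theorem Walk.IsPath.isPathSeq {x y : V} {w : T.Walk x y} (hw : w.IsPath) :
    IsPathSeq T w.length w.getVert where
  adj _ hi := w.adj_getVert_succ hi
  inj _ hi _ hj h := hw.getVert_injOn hi hj h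

namespace IsPathSeq

theorem mem_side (hz : IsPathSeq T N z) (hT : T.IsTree) (hj : j < N) (hi : i ≤ j) :
    z i ∈ T.side (z j) (z (j + 1)) := by
  have hC := hT.isCut_side (hz.adj j hj)
  induction hi using Nat.decreasingInduction with
  | self => exact hC.left_mem
  | of_succ i hi ih =>
    by_contra hcon
    have := (hC.eq_of_adj _ _ (hz.adj i (by omega)).symm ih hcon).2
    have := hz.inj _ (by omega) _ (by omega) this
    omega

theorem notMem_side (hz : IsPathSeq T N z) (hT : T.IsTree) (hi : i ≤ N) (hji : j < i) :
    z i ∉ T.side (z j) (z (j + 1)) := by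
  have hC := hT.isCut_side (hz.adj j (by omega))
  induction i, Nat.succ_le_of_lt hji using Nat.le_induction with
  | base => exact hC.right_notMem
  | succ i hi' ih =>
    intro hcon
    have := (hC.eq_of_adj _ _ (hz.adj i (by omega)).symm hcon (ih (by omega) (by omega))).1
    have := hz.inj _ (by omega) _ (by omega) this
    omega

theorem reverse (hz : IsPathSeq T N z) : IsPathSeq T N (fun i => z (N - i)) where
  adj i hi := by
    have := (hz.adj (N - (i + 1)) (by omega)).symm
    rwa [show N - (i + 1) + 1 = N - i by omega] at this
  inj i hi j hj h := by
    have := hz.inj _ (by omega) _ (by omega) h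
    omega

theorem mono (hz : IsPathSeq T N z) {M : ℕ} (h : M + i ≤ N) :
    IsPathSeq T M (fun j => z (i + j)) where
  adj j hj := hz.adj (i + j) (by omega)
  inj j hj j' hj' h := by
    have := hz.inj _ (by omega) _ (by omega) h
    omega

theorem dartsBetween_eq [Fintype V] (hz : IsPathSeq T N z) (hT : T.IsTree) :
    T.dartsBetween (z 0) (z N) = (Finset.range N).image (fun j => (z j, z (j + 1))) := by
  ext ⟨a, b⟩
  rw [mem_dartsBetween, Finset.mem_image]
  constructor
  · rintro ⟨hab, h0, hN⟩
    by_contra! hcon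
    have : ∀ j ≤ N, z j ∈ T.side a b := by
      intro j hj
      induction j with
      | zero => exact h0
      | succ j ih =>
        by_contra h'
        obtain ⟨h1, h2⟩ := (hT.isCut_side hab).eq_of_adj _ _ (hz.adj j (by omega))
          (ih (by omega)) h'
        exact hcon j (Finset.mem_range.2 (by omega)) (Prod.ext h1 h2)
    exact hN (this N le_rfl)
  · rintro ⟨j, hj, h⟩
    rw [Finset.mem_range] at hj
    obtain ⟨rfl, rfl⟩ := Prod.ext_iff.1 h
    exact ⟨hz.adj j hj, hz.mem_side hT hj (Nat.zero_le _), hz.notMem_side hT le_rfl hj⟩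

theorem sum_dartsBetween [Fintype V] (hz : IsPathSeq T N z) (hT : T.IsTree) (F : V × V → ℕ) :
    ∑ p ∈ T.dartsBetween (z 0) (z N), F p = ∑ j ∈ Finset.range N, F (z j, z (j + 1)) := by
  rw [hz.dartsBetween_eq hT, Finset.sum_image]
  intro i hi j hj h
  simp only [Finset.coe_range, Set.mem_Iio] at hi hj
  exact hz.inj i (by omega) j (by omega) (Prod.ext_iff.1 h).1

end IsPathSeq

theorem IsTree.exists_isPathSeq (hT : T.IsTree) (x y : V) :
    ∃ N z, IsPathSeq T N z ∧ z 0 = x ∧ z N = y := by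
  obtain ⟨w, hw, -⟩ := hT.existsUnique_path x y
  exact ⟨_, _, hw.isPathSeq, w.getVert_zero, w.getVert_length⟩

end PathSeq

section Steiner

variable {V : Type*} [Fintype V] {T : SimpleGraph V}

/-- The edges of `T` both of whose sides meet `S`. -/
def separatingEdges (T : SimpleGraph V) (S : Finset V) : Set (Sym2 V) :=
  {e | e ∈ T.edgeSet ∧ ∀ a b, e = s(a, b) → ¬ (S : Set V) ⊆ T.side a b}

omit [Fintype V] in
theorem separatingEdges_mono {S S' : Finset V} (h : S ⊆ S') :
    T.separatingEdges S ⊆ T.separatingEdges S' :=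
  fun _ he => ⟨he.1, fun a b hab h' => he.2 a b hab ((Finset.coe_subset.2 h).trans h')⟩

omit [Fintype V] in
theorem IsTree.edge_mem_separatingEdges {x y : V} (hT : T.IsTree) {w : T.Walk x y}
    (hw : w.IsPath) {e : Sym2 V} (he : e ∈ w.edges) {S : Finset V} (hx : x ∈ S) (hy : y ∈ S) :
    e ∈ T.separatingEdges S := by
  refine ⟨w.edges_subset_edgeSet he, ?_⟩
  obtain ⟨i, hi, rfl⟩ := List.mem_iff_getElem.1 he
  rw [w.length_edges] at hi
  have he : w.edges[i]'(by rwa [w.length_edges]) = s(w.getVert i, w.getVert (i + 1)) := by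
    simp [Walk.edges, Walk.darts_getElem_eq_getVert]
  have hadj := w.adj_getVert_succ hi
  have h1 := hw.isPathSeq.mem_side hT hi (Nat.zero_le _)
  have h2 := hw.isPathSeq.notMem_side hT le_rfl hi
  rw [w.getVert_zero] at h1
  rw [w.getVert_length] at h2
  intro a b hab hS
  rw [he] at hab
  rcases Sym2.eq_iff.1 hab with ⟨rfl, rfl⟩ | ⟨rfl, rfl⟩
  · exact h2 (hS hy)
  · have := hS hx
    rw [hT.side_swap hadj] at this
    exact this h1

omit [Fintype V] in
theorem IsTree.exists_subgraph (hT : T.IsTree) (x : V) (S : Finset V) :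
    ∃ H : T.Subgraph, H.Connected ∧ x ∈ H.verts ∧ (S : Set V) ⊆ H.verts ∧
      H.edgeSet ⊆ T.separatingEdges (insert x S) := by
  induction S using Finset.induction_on with
  | empty =>
    exact ⟨T.singletonSubgraph x, Subgraph.singletonSubgraph_connected, by simp, by simp, by simp⟩
  | insert y S _ ih =>
    obtain ⟨H, h1, h2, h3, h4⟩ := ih
    obtain ⟨w, hw, -⟩ := hT.existsUnique_path x y
    refine ⟨H ⊔ w.toSubgraph, Subgraph.connected_sup h1.preconnected
      w.toSubgraph_connected.preconnected ⟨x, h2, by simp⟩, Or.inl h2, ?_, ?_⟩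
    · rw [Finset.coe_insert, Set.insert_subset_iff]
      exact ⟨Or.inr (by simp), fun s hs => Or.inl (h3 hs)⟩
    · rw [Subgraph.edgeSet_sup, Set.union_subset_iff]
      refine ⟨h4.trans (separatingEdges_mono ?_), fun e he => ?_⟩
      · exact Finset.insert_subset_insert _ (Finset.subset_insert _ _)
      · rw [Walk.mem_edges_toSubgraph] at he
        exact hT.edge_mem_separatingEdges hw he (by simp) (by simp)

omit [Fintype V] in
theorem IsTree.separatingEdges_subset (hT : T.IsTree) {S : Finset V} {H : T.Subgraph}
    (hH : H.Connected) (hS : (S : Set V) ⊆ H.verts) : T.separatingEdges S ⊆ H.edgeSet := by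
  intro e
  induction e with | _ a b => ?_
  rintro ⟨hab, h⟩
  rw [mem_edgeSet] at hab
  by_contra he
  rw [Subgraph.mem_edgeSet] at he
  obtain ⟨t, ht, ht'⟩ := Set.not_subset.1 (h a b rfl)
  obtain ⟨s, hs, hs'⟩ := Set.not_subset.1 (h b a Sym2.eq_swap)
  rw [hT.side_swap hab, Set.mem_compl_iff, not_not] at hs'
  refine ht' (hH.coe.mem_of_forall_adj (C := {x : H.verts | x.1 ∈ T.side a b}) (x := ⟨s, hS hs⟩) hs' ?_
    ⟨t, hS ht⟩)
  rintro y z hyz hy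
  by_contra hz
  obtain ⟨h1, h2⟩ := (hT.isCut_side hab).eq_of_adj _ _ hyz.adj_sub hy hz
  rw [Subgraph.coe_adj, h1, h2] at hyz
  exact he hyz

theorem IsTree.steinerDist_eq (hT : T.IsTree) {S : Finset V} (hS : S.Nonempty) :
    steinerDist T S = (T.separatingEdges S).ncard := by
  obtain ⟨x, hx⟩ := hS
  obtain ⟨H, h1, h2, h3, h4⟩ := hT.exists_subgraph x S
  rw [Finset.insert_eq_of_mem hx] at h4
  have hmem : H.edgeSet.ncard ∈ {n | ∃ H : T.Subgraph, H.Connected ∧ ↑S ⊆ H.verts ∧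
    H.edgeSet.ncard = n} := ⟨H, h1, h3, rfl⟩
  refine le_antisymm ((Nat.sInf_le hmem).trans (Set.ncard_le_ncard h4 (Set.toFinite _))) ?_
  obtain ⟨H', h1', h3', h⟩ := Nat.sInf_mem ⟨_, hmem⟩
  rw [steinerDist, ← h]
  exact Set.ncard_le_ncard (hT.separatingEdges_subset h1' h3') (Set.toFinite _)

theorem IsTree.ncard_edgeSet (hT : T.IsTree) : T.edgeSet.ncard = Fintype.card V - 1 := by
  rw [← hT.card_edgeFinset, ← coe_edgeFinset, Set.ncard_coe_finset]
  rfl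

theorem IsTree.steinerDist_add (hT : T.IsTree) {S : Finset V} (hS : S.Nonempty) :
    steinerDist T S + #{p : V × V | T.Adj p.1 p.2 ∧ (S : Set V) ⊆ T.side p.1 p.2} =
      Fintype.card V - 1 := by
  rw [hT.steinerDist_eq hS, ← hT.ncard_edgeSet, ← Set.ncard_sdiff_add_ncard_of_subset
    (show T.separatingEdges S ⊆ T.edgeSet from fun _ he => he.1), add_comm]
  congr 1
  rw [← Set.ncard_coe_finset]
  refine Set.ncard_congr (fun p _ => s(p.1, p.2)) ?_ ?_ ?_
  · rintro ⟨a, b⟩ hp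
    simp only [Finset.coe_filter, Finset.mem_univ, true_and, Set.mem_ofPred_eq] at hp
    exact ⟨hp.1, fun h => h.2 a b rfl hp.2⟩
  · rintro ⟨a, b⟩ ⟨c, d⟩ hp hq h
    simp only [Finset.coe_filter, Finset.mem_univ, true_and, Set.mem_ofPred_eq] at hp hq h
    rcases Sym2.eq_iff.1 h with ⟨rfl, rfl⟩ | ⟨rfl, rfl⟩
    · rfl
    · obtain ⟨x, hx⟩ := hS
      have := hq.2 hx
      rw [hT.side_swap hp.1] at this
      exact absurd (hp.2 hx) this
  · intro e
    induction e with | _ a b => ?_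
    rintro ⟨he, h⟩
    simp only [separatingEdges, Set.mem_ofPred_eq, he, true_and, not_forall, not_not] at h
    obtain ⟨c, d, hcd, h⟩ := h
    refine ⟨(c, d), ?_, hcd.symm⟩
    simp only [Finset.coe_filter, Finset.mem_univ, true_and, Set.mem_ofPred_eq]
    exact ⟨by rwa [hcd] at he, h⟩

theorem IsTree.steinerWiener_add_sideSum (hT : T.IsTree) {k : ℕ} (hk : 1 ≤ k) :
    steinerWiener T k + T.sideSum (fun n => n.choose k) =
      (Fintype.card V - 1) * (Fintype.card V).choose k := by
  have h1 : T.sideSum (fun n => n.choose k) = ∑ S ∈ Finset.powersetCard k (Finset.univ : Finset V),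
      #{p : V × V | T.Adj p.1 p.2 ∧ (S : Set V) ⊆ T.side p.1 p.2} := by
    unfold sideSum
    simp only [Finset.card_filter]
    rw [Finset.sum_comm, Finset.sum_filter]
    refine Finset.sum_congr rfl fun p _ => ?_
    by_cases hp : T.Adj p.1 p.2
    · simp only [hp, if_true, true_and]
      rw [Set.ncard_eq_toFinset_card', ← Finset.card_powersetCard, ← Finset.card_filter]
      congr 1
      ext S
      simp [Finset.mem_powersetCard, ← Finset.coe_subset, and_comm]
    · simp [hp]
  rw [h1, steinerWiener, ← Finset.sum_add_distrib]
  rw [Finset.sum_congr rfl (fun S hS => hT.steinerDist_add (S := S) ?_), Finset.sum_const,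
    Finset.card_powersetCard, Finset.card_univ, smul_eq_mul, mul_comm]
  rw [← Finset.card_pos, (Finset.mem_powersetCard.1 hS).2]
  exact hk

end Steiner

end SimpleGraph

namespace SimpleGraph

open scoped Classical

section PathSeq

variable {V : Type*} {T : SimpleGraph V} {N : ℕ} {z : ℕ → V} {i j : ℕ}

namespace IsPathSeq

theorem exists_walk (hz : IsPathSeq T N z) :
    ∃ w : T.Walk (z 0) (z N), w.IsPath ∧ w.length = N ∧ ∀ x, x ∈ w.support ↔ ∃ i ≤ N, z i = x := by
  have : ∀ n ≤ N, ∃ w : T.Walk (z 0) (z n), w.length = n ∧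
      w.support = (List.range (n + 1)).map z := by
    intro n
    induction n with
    | zero => exact fun _ => ⟨Walk.nil, by simp⟩
    | succ n ih =>
      intro hn
      obtain ⟨w, h1, h2⟩ := ih (by omega)
      refine ⟨w.concat (hz.adj n (by omega)), by simp [h1], ?_⟩
      rw [Walk.support_concat, h2, List.range_succ (n := n + 1)]
      simp
  obtain ⟨w, h1, h2⟩ := this N le_rfl
  refine ⟨w, ?_, h1, fun x => ?_⟩
  · rw [Walk.isPath_def, h2]
    refine List.Nodup.map_on ?_ List.nodup_range
    intro i hi j hj
    rw [List.mem_range] at hi hj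
    exact hz.inj i (by omega) j (by omega)
  · simp [h2]

theorem mem_separatingEdges_iff (hz : IsPathSeq T N z) (hT : T.IsTree) {e : Sym2 V} :
    e ∈ T.separatingEdges {z 0, z N} ↔ ∃ j < N, e = s(z j, z (j + 1)) := by
  constructor
  · induction e with | _ a b => ?_
    rintro ⟨hab, h⟩
    rw [mem_edgeSet] at hab
    by_contra! hcon
    have : ∀ j ≤ N, z j ∈ T.side a b ↔ z 0 ∈ T.side a b := by
      intro j hj
      induction j with
      | zero => rfl
      | succ j ih =>
        rw [← ih (by omega)]
        have hC := hT.isCut_side hab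
        by_contra h'
        by_cases h1 : z j ∈ T.side a b
        · obtain ⟨h1, h2⟩ := hC.eq_of_adj _ _ (hz.adj j (by omega)) h1 (by tauto)
          exact hcon j (by omega) (by rw [h1, h2])
        · obtain ⟨h1, h2⟩ := hC.eq_of_adj _ _ (hz.adj j (by omega)).symm (by tauto) h1
          exact hcon j (by omega) (by rw [h1, h2, Sym2.eq_swap])
    have hN := this N le_rfl
    by_cases h0 : z 0 ∈ T.side a b
    · refine h a b rfl ?_
      simp [Set.insert_subset_iff, h0, hN.2 h0]
    · refine h b a Sym2.eq_swap ?_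
      rw [hT.side_swap hab]
      have : z N ∉ T.side a b := fun h' => h0 (hN.1 h')
      simp [Set.insert_subset_iff, h0, this]
  · rintro ⟨j, hj, rfl⟩
    refine ⟨hz.adj j hj, fun a b hab hS => ?_⟩
    have h1 := hz.mem_side hT hj (Nat.zero_le _)
    have h2 := hz.notMem_side hT le_rfl hj
    rcases Sym2.eq_iff.1 hab with ⟨rfl, rfl⟩ | ⟨rfl, rfl⟩
    · exact h2 (hS (by simp))
    · have := hS (show z 0 ∈ _ by simp)
      rw [hT.side_swap (hz.adj j hj)] at this
      exact this h1

theorem ncard_separatingEdges (hz : IsPathSeq T N z) (hT : T.IsTree) :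
    (T.separatingEdges {z 0, z N}).ncard = N := by
  have : T.separatingEdges {z 0, z N} =
      ((Finset.range N).image (fun j => s(z j, z (j + 1))) : Finset (Sym2 V)) := by
    ext e
    rw [hz.mem_separatingEdges_iff hT]
    simp [eq_comm]
  rw [this, Set.ncard_coe_finset, Finset.card_image_of_injOn, Finset.card_range]
  intro i hi j hj h
  simp only [Finset.coe_range, Set.mem_Iio] at hi hj
  rcases Sym2.eq_iff.1 h with ⟨h1, h2⟩ | ⟨h1, h2⟩
  · exact hz.inj _ (by omega) _ (by omega) h1
  · have := hz.inj _ (by omega) _ (by omega) h1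
    have := hz.inj _ (by omega) _ (by omega) h2
    omega

theorem dist_eq (hz : IsPathSeq T N z) (hT : T.IsTree) : T.dist (z 0) (z N) = N := by
  obtain ⟨w, hw, hlen⟩ := hT.1.exists_path_of_dist (z 0) (z N)
  have := hw.isPathSeq.ncard_separatingEdges hT
  rw [w.getVert_zero, w.getVert_length, hz.ncard_separatingEdges hT] at this
  exact hlen.symm.trans this.symm

theorem dist_eq_sub (hz : IsPathSeq T N z) (hT : T.IsTree) (hij : i ≤ j) (hj : j ≤ N) :
    T.dist (z i) (z j) = j - i := by
  have := (hz.mono (i := i) (M := j - i) (by omega)).dist_eq hT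
  simpa [show i + (j - i) = j by omega] using this

theorem snoc (hz : IsPathSeq T N z) (hT : T.IsTree) {y : V} (hy : T.Adj (z N) y)
    (hne : 0 < N → y ≠ z (N - 1)) : IsPathSeq T (N + 1) (Function.update z (N + 1) y) := by
  have key : ∀ i ≤ N, z i ≠ y := by
    rintro i hi rfl
    rcases hi.lt_or_eq with hi | rfl
    · have h1 := hz.mem_side hT (i := i) (j := N - 1) (by omega) (by omega)
      have h2 := hz.notMem_side hT (i := N) (j := N - 1) le_rfl (by omega)
      have h3 := ((hT.isCut_side (hz.adj (N - 1) (by omega))).eq_of_adj _ _ hy.symm h1 h2).1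
      exact hne (by omega) h3
    · exact hy.ne rfl
  constructor
  · intro i hi
    rw [Function.update_of_ne (by omega)]
    rcases Nat.lt_succ_iff_lt_or_eq.1 hi with hi | rfl
    · rw [Function.update_of_ne (by omega)]
      exact hz.adj i hi
    · rwa [Function.update_self]
  · intro i hi j hj h
    obtain hi | rfl : i ≤ N ∨ i = N + 1 := by omega
    all_goals obtain hj | rfl : j ≤ N ∨ j = N + 1 := by omega
    · rw [Function.update_of_ne (by omega), Function.update_of_ne (by omega)] at h
      exact hz.inj i hi j hj h
    · rw [Function.update_of_ne (by omega), Function.update_self] at h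
      exact absurd h (key i hi)
    · rw [Function.update_self, Function.update_of_ne (by omega)] at h
      exact absurd h.symm (key j hj)
    · rfl

theorem lt_card [Fintype V] (hz : IsPathSeq T N z) : N < Fintype.card V := by
  have : ((Finset.range (N + 1)).image z).card = N + 1 := by
    rw [Finset.card_image_of_injOn, Finset.card_range]
    intro i hi j hj h
    simp only [Finset.coe_range, Set.mem_Iio] at hi hj
    exact hz.inj _ (by omega) _ (by omega) h
  have := Finset.card_le_univ ((Finset.range (N + 1)).image z)
  omega

end IsPathSeq

theorem eq_or_eq_of_degN_eq_two {x p q y : V} (hx : degN T x = 2) (hp : T.Adj x p)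
    (hq : T.Adj x q) (hpq : p ≠ q) (hy : T.Adj x y) : y = p ∨ y = q := by
  have hsub : {p, q} ⊆ T.neighborSet x := by
    rintro _ (rfl | rfl)
    · exact hp
    · exact hq
  have hfin : (T.neighborSet x).Finite := Set.finite_of_ncard_ne_zero (by
    unfold degN at hx; omega)
  have := Set.eq_of_subset_of_ncard_le hsub (by
    rw [Set.ncard_pair hpq]; exact hx.le) hfin
  have hy' : y ∈ ({p, q} : Set V) := this ▸ hy
  simpa using hy'

theorem exists_ne_adj_of_two_le_degN {x : V} (hx : 2 ≤ degN T x) (p : V) :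
    ∃ y, T.Adj x y ∧ y ≠ p := by
  obtain ⟨y, hy, hne⟩ := Set.exists_ne_of_one_lt_ncard (s := T.neighborSet x) hx p
  exact ⟨y, hy, hne⟩

end PathSeq

end SimpleGraph

namespace SimpleGraph

open scoped Classical

section Segments

variable {V : Type*} {T : SimpleGraph V} {N : ℕ} {z : ℕ → V} {i j : ℕ}

/-- `z 0, z 1, …, z N` are the successive vertices of a segment of `T`. -/
structure IsSegSeq (T : SimpleGraph V) (N : ℕ) (z : ℕ → V) : Prop extends IsPathSeq T N z where
  pos : 0 < N
  left : degN T (z 0) ≠ 2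
  right : degN T (z N) ≠ 2
  mid : ∀ i, 0 < i → i < N → degN T (z i) = 2

theorem one_le_degN [Finite V] {x y : V} (h : T.Adj x y) : 1 ≤ degN T x :=
  (Set.ncard_pos (Set.toFinite _)).2 ⟨y, h⟩

theorem isLeafV_or_isBranchV [Finite V] {x y : V} (h : T.Adj x y) :
    IsLeafV T x ∨ IsBranchV T x ↔ degN T x ≠ 2 := by
  have := one_le_degN h
  unfold IsLeafV IsBranchV
  omega

namespace IsSegSeq

theorem reverse (hz : IsSegSeq T N z) : IsSegSeq T N (fun i => z (N - i)) where
  toIsPathSeq := hz.toIsPathSeq.reverse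
  pos := hz.pos
  left := by simpa using hz.right
  right := by simpa using hz.left
  mid i hi hiN := hz.mid _ (by omega) (by omega)

theorem isSegment [Finite V] (hz : IsSegSeq T N z) : IsSegment T (z 0) (z N) := by
  have hpos := hz.pos
  refine ⟨fun h => ?_, ?_, ?_, ?_⟩
  · have := hz.inj 0 (by omega) N le_rfl h
    omega
  · exact (isLeafV_or_isBranchV (hz.adj 0 hz.pos)).2 hz.left
  · have := hz.adj (N - 1) (by omega)
    rw [Nat.sub_add_cancel hz.pos] at this
    exact (isLeafV_or_isBranchV this.symm).2 hz.right
  · obtain ⟨w, hw, -, h⟩ := hz.toIsPathSeq.exists_walk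
    refine ⟨w, hw, fun x hx h0 hN => ?_⟩
    obtain ⟨i, hi, rfl⟩ := (h x).1 hx
    refine hz.mid i (Nat.pos_of_ne_zero ?_) (lt_of_le_of_ne hi ?_)
    · rintro rfl
      exact h0 rfl
    · rintro rfl
      exact hN rfl

theorem eq_of_adj (hz : IsSegSeq T N z) {x y : V} {i : ℕ} (h0 : 0 < i) (hi : i < N)
    (hx : z i = x) (hy : T.Adj x y) : y = z (i - 1) ∨ y = z (i + 1) := by
  subst hx
  have h1 := hz.adj (i - 1) (by omega)
  rw [Nat.sub_add_cancel h0] at h1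
  refine eq_or_eq_of_degN_eq_two (hz.mid i h0 hi) h1.symm (hz.adj i hi) (fun h => ?_) hy
  have := hz.inj _ (by omega) _ (by omega) h
  omega

end IsSegSeq

theorem _root_.IsSegment.exists_isSegSeq [Finite V] {u v : V} (h : IsSegment T u v) :
    ∃ N z, IsSegSeq T N z ∧ z 0 = u ∧ z N = v := by
  obtain ⟨hne, hu, hv, w, hw, hmid⟩ := h
  have hlen : 0 < w.length := by
    rw [Nat.pos_iff_ne_zero]
    exact fun h => hne (Walk.eq_of_length_eq_zero h)
  have key := hw.isPathSeq
  have hdu : degN T u ≠ 2 := by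
    rcases hu with h | h <;> unfold IsLeafV IsBranchV at * <;> omega
  have hdv : degN T v ≠ 2 := by
    rcases hv with h | h <;> unfold IsLeafV IsBranchV at * <;> omega
  refine ⟨w.length, w.getVert, ⟨key, hlen, by simpa, by simpa, fun i hi hiN => ?_⟩, by simp, by simp⟩
  refine hmid _ (w.getVert_mem_support i) ?_ ?_
  · intro h
    have := key.inj i hiN.le 0 (Nat.zero_le _) (by simpa using h)
    omega
  · intro h
    have := key.inj i hiN.le _ le_rfl (by simpa using h)
    omega

theorem IsPathSeq.exists_extension [Fintype V] (hT : T.IsTree) (hz : IsPathSeq T N z) (hN : 0 < N) :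
    ∃ N' z', IsPathSeq T N' z' ∧ N ≤ N' ∧ (∀ i ≤ N, z' i = z i) ∧
      (∀ i, N ≤ i → i < N' → degN T (z' i) = 2) ∧ degN T (z' N') ≠ 2 := by
  induction h : Fintype.card V - N generalizing N z with
  | zero =>
    have := hz.lt_card
    omega
  | succ n ih =>
    by_cases hd : degN T (z N) = 2
    · obtain ⟨y, hy, hne⟩ := exists_ne_adj_of_two_le_degN hd.ge (z (N - 1))
      obtain ⟨N', z', h1, h2, h3, h4, h5⟩ := ih (hz.snoc hT hy fun _ => hne) (by omega) (by omega)
      have h6 : ∀ i ≤ N, z' i = z i := fun i hi => by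
        rw [h3 i (by omega), Function.update_of_ne (by omega)]
      refine ⟨N', z', h1, by omega, h6, fun i hi hi' => ?_, h5⟩
      rcases hi.eq_or_lt with rfl | hi
      · rwa [h6 _ le_rfl]
      · exact h4 i hi hi'
    · exact ⟨N, z, hz, le_rfl, fun _ _ => rfl, fun i h1 h2 => by omega, hd⟩

theorem IsTree.exists_isSegSeq [Fintype V] (hT : T.IsTree) {a b : V} (hab : T.Adj a b) :
    ∃ N z, IsSegSeq T N z ∧ ∃ j < N, z j = a ∧ z (j + 1) = b := by
  have h0 : IsPathSeq T 1 (fun i => if i = 0 then a else b) := by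
    constructor
    · intro i hi
      obtain rfl : i = 0 := by omega
      simpa using hab
    · intro i hi j hj h
      have := hab.ne
      have := hab.ne'
      by_cases hi' : i = 0 <;> by_cases hj' : j = 0 <;> simp_all; omega
  obtain ⟨N₁, z₁, h1, h2, h3, h4, h5⟩ := h0.exists_extension hT Nat.one_pos
  obtain ⟨N₂, z₂, h1', h2', h3', h4', h5'⟩ := h1.reverse.exists_extension hT (by omega)
  have ha : z₁ 0 = a := by simpa using h3 0 (by omega)
  have hb : z₁ 1 = b := by simpa using h3 1 (by omega)
  have hseg : IsSegSeq T N₂ z₂ := by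
    refine ⟨h1', by omega, ?_, h5', fun i hi hi' => ?_⟩
    · rw [h3' 0 (by omega)]
      exact h5
    · rcases lt_or_ge i N₁ with h | h
      · rw [h3' i h.le]
        exact h4 _ (by omega) (by omega)
      · exact h4' i h hi'
  refine ⟨N₂, _, hseg.reverse, N₂ - N₁, by omega, ?_, ?_⟩
  · rw [show N₂ - (N₂ - N₁) = N₁ by omega, h3' _ le_rfl]
    simpa using ha
  · rw [show N₂ - (N₂ - N₁ + 1) = N₁ - 1 by omega, h3' _ (by omega),
      show N₁ - (N₁ - 1) = 1 by omega, hb]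

/-- Two edges are adjacent in the segment graph if they share a vertex of degree two. -/
def segGraph (T : SimpleGraph V) : SimpleGraph T.edgeSet where
  Adj e f := e ≠ f ∧ ∃ x, degN T x = 2 ∧ x ∈ e.1 ∧ x ∈ f.1
  symm := ⟨fun _ _ h => ⟨h.1.symm, h.2.imp fun _ h => ⟨h.1, h.2.2, h.2.1⟩⟩⟩
  loopless := ⟨fun _ h => h.1 rfl⟩

theorem IsSegSeq.reachable_iff (hz : IsSegSeq T N z) (f : T.edgeSet) :
    (segGraph T).Reachable ⟨s(z 0, z (0 + 1)), hz.adj 0 hz.pos⟩ f ↔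
      ∃ j < N, f.1 = s(z j, z (j + 1)) := by
  constructor
  · rintro ⟨w⟩
    generalize he : (⟨s(z 0, z (0 + 1)), hz.adj 0 hz.pos⟩ : T.edgeSet) = e at w
    have he' : ∃ j < N, e.1 = s(z j, z (j + 1)) := ⟨0, hz.pos, by rw [← he]⟩
    clear he
    induction w with
    | nil => exact he'
    | @cons e g f hadj w ih =>
      refine ih ?_
      obtain ⟨j, hj, he⟩ := he'
      obtain ⟨-, x, hx, hxe, hxg⟩ := hadj
      have : ∃ i ≤ N, z i = x := by
        rw [he, Sym2.mem_iff] at hxe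
        rcases hxe with rfl | rfl
        exacts [⟨j, hj.le, rfl⟩, ⟨j + 1, hj, rfl⟩]
      obtain ⟨i, hi, rfl⟩ := this
      obtain ⟨y, hy⟩ := hxg
      have hadj : T.Adj (z i) y := by
        rw [← mem_edgeSet, ← hy]
        exact g.2
      have h0 : 0 < i := by
        rw [Nat.pos_iff_ne_zero]
        rintro rfl
        exact hz.left hx
      have hN : i < N := by
        refine lt_of_le_of_ne hi ?_
        rintro rfl
        exact hz.right hx
      rcases hz.eq_of_adj h0 hN rfl hadj with rfl | rfl
      · refine ⟨i - 1, by omega, ?_⟩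
        rw [hy, Nat.sub_add_cancel h0, Sym2.eq_swap]
      · exact ⟨i, hN, hy⟩
  · rintro ⟨j, hj, hf⟩
    obtain rfl : f = ⟨s(z j, z (j + 1)), hz.adj j hj⟩ := Subtype.ext hf
    clear hf
    induction j with
    | zero => rfl
    | succ j ih =>
      refine (ih (by omega)).trans (Adj.reachable ⟨?_, z (j + 1), hz.mid _ (by omega) hj, ?_, ?_⟩)
      · intro h
        have h := Sym2.eq_iff.1 (congrArg Subtype.val h)
        rcases h with ⟨h, -⟩ | ⟨h, -⟩ <;>
        · have := hz.inj _ (by omega) _ (by omega) h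
          omega
      · simp
      · simp

theorem IsSegSeq.endpoints_eq (hz : IsSegSeq T N z) (x : V) :
    (degN T x ≠ 2 ∧ ∃ j < N, x ∈ s(z j, z (j + 1))) ↔ x ∈ s(z 0, z N) := by
  simp only [Sym2.mem_iff]
  constructor
  · rintro ⟨hx, j, hj, rfl | rfl⟩
    · rcases Nat.eq_zero_or_pos j with rfl | h
      · exact Or.inl rfl
      · exact absurd (hz.mid j h hj) hx
    · rcases (Nat.succ_le_of_lt hj).eq_or_lt with rfl | h
      · exact Or.inr rfl
      · exact absurd (hz.mid _ (by omega) h) hx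
  · rintro (rfl | rfl)
    · exact ⟨hz.left, 0, hz.pos, Or.inl rfl⟩
    · have := hz.pos
      exact ⟨hz.right, N - 1, by omega, Or.inr (by rw [Nat.sub_add_cancel hz.pos])⟩

theorem IsTree.segmentMultiset_eq [Fintype V] (hT : T.IsTree) :
    segmentMultiset T =
      Finset.univ.val.map (fun c : (segGraph T).ConnectedComponent => c.supp.ncard) := by
  let R : Sym2 V → (segGraph T).ConnectedComponent → Prop := fun e c =>
    ∃ N z, IsSegSeq T N z ∧ e = s(z 0, z N) ∧
      ∀ f : T.edgeSet, f ∈ c.supp ↔ ∃ j < N, f.1 = s(z j, z (j + 1))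
  have hseq : ∀ N z, IsSegSeq T N z → ∃ c, R s(z 0, z N) c := by
    intro N z hz
    refine ⟨(segGraph T).connectedComponentMk ⟨s(z 0, z (0 + 1)), hz.adj 0 hz.pos⟩,
      N, z, hz, rfl, fun f => ?_⟩
    rw [← hz.reachable_iff, ConnectedComponent.mem_supp_iff, ConnectedComponent.eq,
      reachable_comm]
  have hex : ∀ e ∈ (Set.toFinite {e : Sym2 V | ∃ u v, e = s(u, v) ∧
      IsSegment T u v}).toFinset.val, ∃ c, R e c := by
    intro e he
    rw [Finset.mem_val, Set.Finite.mem_toFinset] at he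
    obtain ⟨u, v, rfl, huv⟩ := he
    obtain ⟨N, z, hz, rfl, rfl⟩ := huv.exists_isSegSeq
    exact hseq N z hz
  choose F hF using hex
  refine Multiset.map_eq_map_of_bij_of_nodup _ _ (Finset.nodup _) (Finset.nodup _) F
    (fun _ _ => Finset.mem_univ _) ?_ ?_ ?_
  · intro e he e' he' h
    obtain ⟨N, z, hz, rfl, h1⟩ := hF e he
    obtain ⟨N', z', hz', rfl, h1'⟩ := hF e' he'
    have key : ∀ {N : ℕ} {z : ℕ → V} {N' : ℕ} {z' : ℕ → V}, IsSegSeq T N z → (∀ f : T.edgeSet,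
        (∃ j < N, f.1 = s(z j, z (j + 1))) → ∃ j < N', f.1 = s(z' j, z' (j + 1))) →
        ∀ x, (∃ j < N, x ∈ s(z j, z (j + 1))) → ∃ j < N', x ∈ s(z' j, z' (j + 1)) := by
      rintro N z N' z' hz h x ⟨j, hj, hx⟩
      obtain ⟨i, hi, h⟩ := h ⟨_, hz.adj j hj⟩ ⟨j, hj, rfl⟩
      exact ⟨i, hi, h ▸ hx⟩
    refine Sym2.ext fun x => ?_
    rw [← hz.endpoints_eq, ← hz'.endpoints_eq]
    refine and_congr_right fun _ => ⟨?_, ?_⟩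
    · exact key hz (fun f hf => by rwa [← h1', ← h, h1]) x
    · exact key hz' (fun f hf => by rwa [← h1, h, h1']) x
  · rintro c -
    induction c using ConnectedComponent.ind with | _ f => ?_
    obtain ⟨⟨a, b⟩, hab⟩ := f
    obtain ⟨N, z, hz, j, hj, rfl, rfl⟩ := hT.exists_isSegSeq hab
    have hmem : s(z 0, z N) ∈ (Set.toFinite {e : Sym2 V | ∃ u v, e = s(u, v) ∧
        IsSegment T u v}).toFinset.val := by
      rw [Finset.mem_val, Set.Finite.mem_toFinset]
      exact ⟨_, _, rfl, hz.isSegment⟩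
    refine ⟨_, hmem, ?_⟩
    obtain ⟨N', z', hz', he', h1⟩ := hF _ hmem
    have hpair : ({z' 0, z' N'} : Finset V) = {z 0, z N} := by
      rcases Sym2.eq_iff.1 he' with ⟨h, h'⟩ | ⟨h, h'⟩
      · rw [h, h']
      · rw [h, h', Finset.pair_comm]
    symm
    refine (ConnectedComponent.mem_supp_iff _ _).1 ((h1 _).2
      ((hz'.toIsPathSeq.mem_separatingEdges_iff hT).1 ?_))
    rw [hpair]
    exact (hz.toIsPathSeq.mem_separatingEdges_iff hT).2 ⟨j, hj, rfl⟩
  · intro e he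
    generalize hc : F e he = c
    obtain ⟨N, z, hz, rfl, h1⟩ := hc ▸ hF e he
    rw [Sym2.lift_mk]
    simp only
    rw [hz.toIsPathSeq.dist_eq hT]
    refine (hz.toIsPathSeq.ncard_separatingEdges hT).symm.trans ?_
    rw [← Set.ncard_image_of_injective _ Subtype.val_injective]
    congr 1
    ext f
    rw [hz.toIsPathSeq.mem_separatingEdges_iff hT]
    constructor
    · rintro ⟨j, hj, rfl⟩
      exact ⟨⟨_, hz.adj j hj⟩, (h1 _).2 ⟨j, hj, rfl⟩, rfl⟩
    · rintro ⟨f, hf, rfl⟩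
      exact (h1 f).1 hf

end Segments

end SimpleGraph

namespace SimpleGraph

open scoped Classical

section Transfer

variable {V W : Type*} {T : SimpleGraph V} {H : SimpleGraph W}

theorem segmentMultiset_eq_of_equiv [Fintype V] [Fintype W] (hT : T.IsTree) (hH : H.IsTree)
    (φ : T.edgeSet ≃ H.edgeSet) (hφ : ∀ e f, (∃ x, degN H x = 2 ∧ x ∈ (φ e).1 ∧ x ∈ (φ f).1) ↔
      ∃ x, degN T x = 2 ∧ x ∈ e.1 ∧ x ∈ f.1) : segmentMultiset T = segmentMultiset H := by
  rw [hT.segmentMultiset_eq, hH.segmentMultiset_eq]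
  let ψ : segGraph T ≃g segGraph H := ⟨φ, fun {e f} => by simp [segGraph, hφ]⟩
  refine Multiset.map_eq_map_of_bij_of_nodup _ _ (Finset.nodup _) (Finset.nodup _)
    (fun c _ => ψ.connectedComponentEquiv c) (fun _ _ => Finset.mem_univ _)
    (fun _ _ _ _ h => ψ.connectedComponentEquiv.injective h)
    (fun c _ => ⟨ψ.connectedComponentEquiv.symm c, Finset.mem_univ _, by simp⟩) fun c _ => ?_
  exact Nat.card_congr (ConnectedComponent.isoEquivSupp ψ c)

theorem IsTree.sum_segmentMultiset [Fintype V] (hT : T.IsTree) :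
    (segmentMultiset T).sum = Fintype.card V - 1 := by
  rw [hT.segmentMultiset_eq, ← hT.ncard_edgeSet, ← Nat.card_coe_set_eq, Nat.card_eq_fintype_card,
    ← Finset.card_univ, Finset.card_eq_sum_card_fiberwise (f := (segGraph T).connectedComponentMk)
      (t := Finset.univ) (fun _ _ => Finset.mem_univ _)]
  refine Finset.sum_congr rfl fun c _ => ?_
  rw [← Set.ncard_coe_finset]
  congr 1
  ext f
  simp

theorem degN_iso (φ : T ≃g H) (x : V) : degN H (φ x) = degN T x := by
  have : H.neighborSet (φ x) = φ '' T.neighborSet x := by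
    ext y
    obtain ⟨y, rfl⟩ := φ.surjective y
    simp [φ.map_adj_iff]
  rw [degN, this, Set.ncard_image_of_injective _ φ.injective, degN]

theorem segmentMultiset_iso [Fintype V] [Fintype W] (hT : T.IsTree) (φ : T ≃g H) :
    segmentMultiset T = segmentMultiset H := by
  refine segmentMultiset_eq_of_equiv hT (φ.isTree_iff.1 hT) φ.mapEdgeSet fun e f => ?_
  have hmem : ∀ (e : T.edgeSet) x, φ x ∈ (φ.mapEdgeSet e).1 ↔ x ∈ e.1 := by
    rintro ⟨e, he⟩ x
    simp [Iso.mapEdgeSet, Hom.mapEdgeSet, Sym2.mem_map]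
  rw [φ.surjective.exists]
  simp only [hmem, degN_iso]

theorem IsTree.image_side_iso (hT : T.IsTree) (φ : T ≃g H) {a b : V} (h : T.Adj a b) :
    H.side (φ a) (φ b) = φ '' T.side a b := by
  have hC := hT.isCut_side h
  refine ((φ.isTree_iff.1 hT).isCut_side (φ.map_adj_iff.2 h)).unique (φ.isTree_iff.1 hT).1 ?_
  refine ⟨⟨a, hC.left_mem, rfl⟩, ?_, ?_⟩
  · rintro ⟨x, hx, hxb⟩
    exact hC.right_notMem (φ.injective hxb ▸ hx)
  · rintro x y hxy hx hy
    obtain ⟨x, rfl⟩ := φ.surjective x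
    obtain ⟨y, rfl⟩ := φ.surjective y
    rw [φ.injective.mem_set_image] at hx hy
    obtain ⟨rfl, rfl⟩ := hC.eq_of_adj _ _ (φ.map_adj_iff.1 hxy) hx hy
    exact ⟨rfl, rfl⟩

theorem sideSum_iso [Fintype V] [Fintype W] (hT : T.IsTree) (φ : T ≃g H) (g : ℕ → ℕ) :
    sideSum T g = sideSum H g := by
  refine Finset.sum_equiv (Equiv.prodCongr φ.toEquiv φ.toEquiv) ?_ ?_
  · rintro ⟨a, b⟩
    simp [φ.map_adj_iff]
  · rintro ⟨a, b⟩ hab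
    simp only [Finset.mem_filter, Finset.mem_univ, true_and] at hab
    simp only [Equiv.prodCongr_apply, Prod.map]
    erw [hT.image_side_iso φ hab]
    rw [Set.ncard_image_of_injective _ φ.injective]

end Transfer

section ExchangeSegments

variable {V : Type*} {T : SimpleGraph V} {v u : V} {A B : Set V}

theorem degN_exchange_of_ne {K : Set V} {x : V} (hv : x ≠ v) (hu : x ≠ u) :
    degN (T.exchange v u (K)) x = degN T x := by
  by_cases hx : x ∈ K
  · have : (T.exchange v u (K)).neighborSet x = Equiv.swap v u '' T.neighborSet x := by
      ext y
      rw [Equiv.image_eq_preimage_symm]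
      rw [mem_neighborSet, exchange_adj, exchangeEnd_of_ne hv hu]
      simp [exchangeEnd, hx]
    rw [degN, this, Set.ncard_image_of_injective _ (Equiv.injective _), degN]
  · have : (T.exchange v u (K)).neighborSet x = T.neighborSet x := by
      ext y
      simp [exchange_adj, exchangeEnd_of_ne hv hu, exchangeEnd_of_notMem hx]
    rw [degN, this, degN]

namespace IsExchange

theorem degN_exchange_left [Finite V] (h : IsExchange T v u A B) :
    degN (T.exchange v u (A ∪ B)) v + (T.neighborSet v ∩ A).ncard =
      degN T v + (T.neighborSet u ∩ B).ncard := by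
  have h1 : (T.exchange v u (A ∪ B)).neighborSet v =
      T.neighborSet v \ A ∪ T.neighborSet u ∩ B := by
    ext y
    rw [mem_neighborSet, exchange_adj, exchangeEnd_of_notMem h.left_notMem]
    by_cases hA : y ∈ A
    · have hB : y ∉ B := fun hB => h.disjoint.notMem_of_mem_left hA hB
      have : ¬ T.Adj u y := fun hu => h.ne (h.eq_left _ _ hu.symm hA h.right_notMem_left).symm
      simp [exchangeEnd, hA, hB, this]
    · by_cases hB : y ∈ B
      · have : ¬ T.Adj v y := fun hu => h.ne (h.eq_right _ _ hu.symm hB h.left_notMem_right)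
        simp [exchangeEnd, hA, hB, this]
      · simp [exchangeEnd, hA, hB]
  have h2 : Disjoint (T.neighborSet v \ A) (T.neighborSet u ∩ B) := by
    rw [Set.disjoint_left]
    rintro y ⟨hy, -⟩ ⟨-, hB⟩
    exact h.ne (h.eq_right y v (T.symm.symm _ _ hy) hB h.left_notMem_right)
  rw [degN, h1, Set.ncard_union_eq h2, degN,
    ← Set.ncard_inter_add_ncard_sdiff_eq_ncard (T.neighborSet v) A]
  omega

theorem segmentMultiset_exchange [Fintype V] (h : IsExchange T v u A B) (hT : T.IsTree)
    (hv : degN T v ≠ 2) (hu : degN T u ≠ 2) (hv' : degN (T.exchange v u (A ∪ B)) v ≠ 2)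
    (hu' : degN (T.exchange v u (A ∪ B)) u ≠ 2) :
    segmentMultiset (T.exchange v u (A ∪ B)) = segmentMultiset T := by
  let F : Sym2 V → Sym2 V := Sym2.lift ⟨fun x y => s(exchangeEnd v u (A ∪ B) x y,
    exchangeEnd v u (A ∪ B) y x), fun _ _ => Sym2.eq_swap⟩
  have hF : ∀ x y, F s(x, y) = s(exchangeEnd v u (A ∪ B) x y, exchangeEnd v u (A ∪ B) y x) :=
    fun _ _ => rfl
  have hFF : ∀ e, F (F e) = e := by
    intro e
    induction e with | _ x y => ?_
    rw [hF, hF, exchangeEnd_exchangeEnd h.left_notMem h.right_notMem,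
      exchangeEnd_exchangeEnd h.left_notMem h.right_notMem]
  have hmem : ∀ e, e ∈ T.edgeSet ↔ F e ∈ (T.exchange v u (A ∪ B)).edgeSet := by
    intro e
    induction e with | _ x y => ?_
    rw [hF, mem_edgeSet, mem_edgeSet, h.exchange_adj_exchangeEnd]
  have hx : ∀ x, x ≠ v → x ≠ u → ∀ e, x ∈ F e ↔ x ∈ e := by
    intro x hv hu e
    induction e with | _ a b => ?_
    have : ∀ a b, x = exchangeEnd v u (A ∪ B) a b ↔ x = a := by
      intro a b
      rcases exchangeEnd_cases v u (A ∪ B) a b with h' | ⟨rfl, h'⟩ | ⟨rfl, h'⟩ <;> simp [h', hv, hu]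
    rw [hF, Sym2.mem_iff, Sym2.mem_iff, this, this]
  refine (segmentMultiset_eq_of_equiv hT (h.isTree hT)
    ((Equiv.mk F F hFF hFF).subtypeEquiv hmem) fun e f => exists_congr fun x => ?_).symm
  by_cases h1 : x = v
  · subst h1
    simp [hv, hv']
  by_cases h2 : x = u
  · subst h2
    simp [hu, hu']
  rw [degN_exchange_of_ne h1 h2]
  refine and_congr_right fun _ => and_congr ?_ ?_
  · exact hx x h1 h2 e
  · exact hx x h1 h2 f

end IsExchange

end ExchangeSegments

end SimpleGraph

/-- Strict convexity of a function on the natural numbers. -/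
def StrictlyConvex (g : ℕ → ℕ) : Prop :=
  ∀ a t d, 0 < t → 0 < d → g (a + t) + g (a + d) < g a + g (a + t + d)

theorem StrictlyConvex.of_strictMono {g s : ℕ → ℕ} (hg : ∀ m, g (m + 1) = g m + s m)
    (hs : StrictMono s) : StrictlyConvex g := by
  intro a t d ht hd
  induction t, Nat.succ_le_of_lt ht using Nat.le_induction with
  | base =>
    have := hs (show a < a + d by omega)
    rw [show a + (0 + 1) = a + 1 by omega, show a + 1 + d = a + d + 1 by omega, hg, hg]
    omega
  | succ t ht ih =>
    have := hs (show a + t < a + t + d by omega)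
    have := ih (by omega)
    rw [show a + (t + 1) = a + t + 1 by omega, show a + t + 1 + d = a + t + d + 1 by omega, hg, hg]
    omega

theorem StrictlyConvex.lt {g : ℕ → ℕ} (hg : StrictlyConvex g) {n c c' : ℕ} (hc : c ≤ n)
    (h : n < c + c') (hlt : c' < c) : g c' + g (n - c') < g c + g (n - c) := by
  have := hg (n - c) (c' - (n - c)) (c - c') (by omega) (by omega)
  rw [show n - c + (c' - (n - c)) = c' by omega, show n - c + (c - c') = n - c' by omega,
    show c' + (c - c') = c by omega] at this
  omega

namespace SimpleGraph

section Minimizer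

open scoped Classical

theorem IsTree.exists_iso_fin {ℓ : Multiset ℕ} {W : Type*} [Fintype W] {H : SimpleGraph W}
    (hH : H.IsTree) (hℓ : segmentMultiset H = ℓ) :
    ∃ H' : SimpleGraph (Fin (ℓ.sum + 1)), Nonempty (H ≃g H') := by
  have := hH.sum_segmentMultiset
  have := hH.1.nonempty
  have := Fintype.card_pos (α := W)
  have hcard : Fintype.card W = ℓ.sum + 1 := by
    rw [← hℓ]
    omega
  exact ⟨_, ⟨SimpleGraph.Iso.map (Fintype.equivFinOfCardEq hcard) H⟩⟩

theorem exists_minimal_sideSum {ℓ : Multiset ℕ} {k : ℕ} (hk : 1 ≤ k) {V : Type*} [Fintype V]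
    {T₀ : SimpleGraph V} (hT₀ : T₀.IsTree) (hℓ : segmentMultiset T₀ = ℓ) :
    ∃ (T : SimpleGraph (Fin (ℓ.sum + 1))) (g : ℕ → ℕ), StrictlyConvex g ∧ T.IsTree ∧
      segmentMultiset T = ℓ ∧ ∀ H : SimpleGraph (Fin (ℓ.sum + 1)), H.IsTree →
        segmentMultiset H = ℓ → sideSum T g ≤ sideSum H g ∧
          sideSum T (fun n => n.choose k) ≤ sideSum H (fun n => n.choose k) := by
  obtain ⟨k, rfl⟩ := Nat.exists_eq_add_of_le' hk
  set M := 1 + ∑ H : SimpleGraph (Fin (ℓ.sum + 1)), sideSum H (fun n => n.choose 2) with hM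
  set g : ℕ → ℕ := fun n => M * n.choose (k + 1) + n.choose 2 with hg
  have hsum : ∀ H : SimpleGraph (Fin (ℓ.sum + 1)), sideSum H g =
      M * sideSum H (fun n => n.choose (k + 1)) + sideSum H (fun n => n.choose 2) := by
    intro H
    simp only [sideSum, hg, Finset.sum_add_distrib, Finset.mul_sum]
  obtain ⟨H₀, ⟨φ⟩⟩ := hT₀.exists_iso_fin hℓ
  obtain ⟨T, ⟨hT, hTℓ⟩, hmin⟩ := Set.exists_min_image
    {H : SimpleGraph (Fin (ℓ.sum + 1)) | H.IsTree ∧ segmentMultiset H = ℓ}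
    (fun H => sideSum H g) (Set.toFinite _)
    ⟨H₀, φ.isTree_iff.1 hT₀, by rw [← segmentMultiset_iso hT₀ φ, hℓ]⟩
  refine ⟨T, g, StrictlyConvex.of_strictMono (s := fun n => M * n.choose k + n) ?_ ?_, hT, hTℓ,
    fun H hH hHℓ => ⟨hmin H ⟨hH, hHℓ⟩, ?_⟩⟩
  · intro m
    simp only [hg, Nat.choose_succ_succ', Nat.choose_one_right]
    ring
  · intro a b hab
    exact add_lt_add_of_le_of_lt (Nat.mul_le_mul_left _ (Nat.choose_le_choose _ hab.le)) hab
  · have h1 := hmin H ⟨hH, hHℓ⟩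
    have h2 : sideSum H (fun n => n.choose 2) < M := by
      rw [hM]
      refine Nat.lt_one_add_iff.2 (Finset.single_le_sum (f := fun H : SimpleGraph (Fin (ℓ.sum + 1)) =>
        sideSum H (fun n => n.choose 2)) (fun _ _ => Nat.zero_le _) (Finset.mem_univ H))
    simp only [hsum] at h1
    by_contra! hlt
    have := Nat.mul_le_mul_left M (Nat.succ_le_of_lt hlt)
    rw [Nat.succ_eq_add_one, mul_add] at this
    omega

/-- Among the trees with the same segment sequence, `T` minimizes `sideSum · g`. -/
structure IsMinimizer {V : Type*} [Fintype V] (T : SimpleGraph V) (g : ℕ → ℕ) : Prop where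
  isTree : T.IsTree
  strictlyConvex : StrictlyConvex g
  le : ∀ H : SimpleGraph V, H.IsTree → segmentMultiset H = segmentMultiset T →
    sideSum T g ≤ sideSum H g

end Minimizer

end SimpleGraph

theorem exists_isMinimizer_steinerWiener_le {ℓ : Multiset ℕ} {k : ℕ} (hk : 1 ≤ k) {V : Type*}
    [Fintype V] {T₀ : SimpleGraph V} (hT₀ : T₀.IsTree) (hℓ : segmentMultiset T₀ = ℓ) :
    ∃ (T : SimpleGraph (Fin (ℓ.sum + 1))) (g : ℕ → ℕ), IsMinimizer T g ∧
      segmentMultiset T = ℓ ∧ ∀ (W : Type) [Fintype W] (H : SimpleGraph W), H.IsTree →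
        segmentMultiset H = ℓ → steinerWiener H k ≤ steinerWiener T k := by
  obtain ⟨T, g, hg, hT, hTℓ, hmin⟩ := exists_minimal_sideSum hk hT₀ hℓ
  refine ⟨T, g, ⟨hT, hg, fun H hH hHℓ => (hmin H hH (hHℓ.trans hTℓ)).1⟩, hTℓ, ?_⟩
  intro W _ H hH hHℓ
  obtain ⟨H', ⟨φ⟩⟩ := hH.exists_iso_fin hHℓ
  have h1 := (hmin H' (φ.isTree_iff.1 hH) (by rw [← segmentMultiset_iso hH φ, hHℓ])).2
  rw [← sideSum_iso hH φ] at h1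
  have h2 := hH.steinerWiener_add_sideSum hk
  have h3 := hT.steinerWiener_add_sideSum hk
  rw [Fintype.card_congr φ.toEquiv] at h2
  omega

namespace SimpleGraph

section Sides

variable {V : Type*} {T : SimpleGraph V} {v u a b c d x y : V} {C D : Set V}

theorem IsCut.subset_of_mem (hT : T.Connected) (hC : IsCut T a b C) (hD : IsCut T c d D)
    (hxC : x ∈ C) (hxD : x ∈ D) (hb : b ∉ D) : D ⊆ C := by
  have hc : c ∈ C := by
    by_contra hc
    refine hb (hT.mem_of_forall_adj (C := D ∩ C) ⟨hxD, hxC⟩ (fun y z hyz hy => ?_) b).1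
    have hz : z ∈ D := by
      by_contra hz
      exact hc ((hD.eq_of_adj y z hyz hy.1 hz).1 ▸ hy.2)
    refine ⟨hz, ?_⟩
    by_contra hz'
    exact hb ((hC.eq_of_adj y z hyz hy.2 hz').2 ▸ hz)
  intro x hxD
  by_contra hxC
  refine (hT.mem_of_forall_adj (C := D \ C) ⟨hxD, hxC⟩ (fun y z hyz hy => ⟨?_, fun hz => ?_⟩) c).2 hc
  · by_contra hz
    exact hy.2 ((hD.eq_of_adj y z hyz hy.1 hz).1 ▸ hc)
  · exact hb ((hC.eq_of_adj z y hyz.symm hz hy.2).2 ▸ hy.1)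

namespace IsTree

theorem side_subset_side (hT : T.IsTree) (hab : T.Adj a b) (hcd : T.Adj c d)
    (hx : x ∈ T.side a b) (hx' : x ∈ T.side c d) (hb : b ∉ T.side c d) :
    T.side c d ⊆ T.side a b :=
  (hT.isCut_side hab).subset_of_mem hT.1 (hT.isCut_side hcd) hx hx' hb

theorem mem_side_of_adj (hT : T.IsTree) (hva : T.Adj v a) (hvb : T.Adj v b) (hab : a ≠ b) :
    a ∈ T.side v b := by
  by_contra h
  exact hab ((hT.isCut_side hvb).eq_of_adj _ _ hva (hT.isCut_side hvb).left_mem h).2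

theorem disjoint_side (hT : T.IsTree) (hva : T.Adj v a) (hvb : T.Adj v b) (hab : a ≠ b) :
    Disjoint (T.side a v) (T.side b v) := by
  rw [← Set.subset_compl_iff_disjoint_right, ← hT.side_swap hvb.symm]
  refine hT.side_subset_side hvb hva.symm (hT.mem_side_of_adj hva hvb hab)
    (hT.isCut_side hva.symm).left_mem ?_
  rw [hT.side_swap hva, Set.mem_compl_iff, not_not]
  exact hT.mem_side_of_adj hvb hva hab.symm

theorem exists_adj_notMem_side (hT : T.IsTree) (hu : 2 ≤ degN T u) (v : V) :
    ∃ y, T.Adj u y ∧ v ∉ T.side y u := by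
  obtain ⟨a, ha, -⟩ := exists_ne_adj_of_two_le_degN hu u
  obtain ⟨b, hb, hba⟩ := exists_ne_adj_of_two_le_degN hu a
  by_contra! h
  exact (hT.disjoint_side hb ha hba).notMem_of_mem_left (h b hb) (h a ha)

theorem isExchange_side (hT : T.IsTree) (hva : T.Adj v a) (hvb : T.Adj v b) (hab : a ≠ b)
    (hu : u ∈ T.side b v) (huy : T.Adj u y) (hy : v ∉ T.side y u) :
    T.side y u ⊆ T.side b v ∧ IsExchange T v u (T.side a v) (T.side y u) := by
  have hA := hT.isCut_side hva.symm
  have hB := hT.isCut_side huy.symm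
  have hC := hT.isCut_side hvb.symm
  have hsub : T.side y u ⊆ T.side b v := by
    refine hT.side_subset_side hvb.symm huy.symm (x := y) ?_ hB.left_mem hy
    by_contra hyC
    exact hy ((hC.eq_of_adj u y huy hu hyC).2 ▸ hB.left_mem)
  have hdisj := hT.disjoint_side hva hvb hab
  refine ⟨hsub, ?_, hA.right_notMem, hy, hdisj.notMem_of_mem_right hu, hB.right_notMem,
    Set.disjoint_of_subset_right hsub hdisj, fun x y h hx hy => (hA.eq_of_adj x y h hx hy).2,
    fun x y h hx hy => (hB.eq_of_adj x y h hx hy).2⟩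
  rintro rfl
  exact hC.right_notMem hu

theorem neighborSet_inter_side (hT : T.IsTree) (hva : T.Adj v a) :
    T.neighborSet v ∩ T.side a v = {a} := by
  have hA := hT.isCut_side hva.symm
  ext x
  constructor
  · rintro ⟨hx, hx'⟩
    exact (hA.eq_of_adj x v (T.symm.symm _ _ hx) hx' hA.right_notMem).1
  · rintro rfl
    exact ⟨hva, hA.left_mem⟩

end IsTree

end Sides

section Branches

open scoped Classical

variable {V : Type*} [Fintype V] {T : SimpleGraph V} {g : ℕ → ℕ} {v u a b c : V} {A B : Set V}

theorem IsMinimizer.sum_dartsBetween_le (hT : IsMinimizer T g) (h : IsExchange T v u A B)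
    (hv : degN T v ≠ 2) (hu : degN T u ≠ 2) (hv' : degN (T.exchange v u (A ∪ B)) v ≠ 2)
    (hu' : degN (T.exchange v u (A ∪ B)) u ≠ 2) :
    ∑ p ∈ T.dartsBetween v u, (g (T.side p.1 p.2).ncard +
        g (Fintype.card V - (T.side p.1 p.2).ncard)) ≤ ∑ p ∈ T.dartsBetween v u,
        (g ((T.side p.1 p.2).ncard - A.ncard + B.ncard) +
        g (Fintype.card V - ((T.side p.1 p.2).ncard - A.ncard + B.ncard))) := by
  obtain ⟨R, h1, h2⟩ := h.exists_sideSum_eq hT.isTree g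
  have := hT.le _ (h.isTree hT.isTree) (h.segmentMultiset_exchange hT.isTree hv hu hv' hu')
  omega

theorem IsMinimizer.lt_ncard_side (hT : IsMinimizer T g) (ha : T.Adj v a) (hb : T.Adj v b)
    (hc : T.Adj v c) (hab : a ≠ b) (hac : a ≠ c) (hbc : b ≠ c)
    (hu : IsBranchV T u) (huc : u ∈ T.side c v) :
    (T.side a v).ncard < (T.side c v).ncard ∨ (T.side b v).ncard < (T.side c v).ncard := by
  by_contra! hcon
  obtain ⟨hca, hcb⟩ := hcon
  have hT' := hT.isTree
  obtain ⟨y, hy, hvy⟩ := hT'.exists_adj_notMem_side (u := u) (by unfold IsBranchV at hu; omega) v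
  obtain ⟨hsub, hex⟩ := hT'.isExchange_side ha hc hac huc hy hvy
  have hv3 : 3 ≤ degN T v := by
    have : ({a, b, c} : Set V) ⊆ T.neighborSet v := by
      rintro x (rfl | rfl | rfl)
      exacts [ha, hb, hc]
    have := Set.ncard_le_ncard this (Set.toFinite _)
    rwa [Set.ncard_eq_three.2 ⟨a, b, c, hab, hac, hbc, rfl⟩] at this
  have hdv := hex.degN_exchange_left
  have hdu := hex.symm.degN_exchange_left
  rw [hT'.neighborSet_inter_side ha, hT'.neighborSet_inter_side hy, Set.ncard_singleton,
    Set.ncard_singleton] at hdv hdu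
  rw [IsExchange.exchange_symm] at hdu
  unfold IsBranchV at hu
  refine absurd (hT.sum_dartsBetween_le hex (by omega) (by omega) (by omega) (by omega))
    (not_le.2 ?_)
  have hn : (T.side a v).ncard + (T.side b v).ncard + (T.side c v).ncard + 1 ≤ Fintype.card V := by
    have h1 := hT'.disjoint_side ha hb hab
    have h2 := hT'.disjoint_side ha hc hac
    have h3 := hT'.disjoint_side hb hc hbc
    rw [← Set.ncard_union_eq h1, ← Set.ncard_union_eq (Set.disjoint_union_left.2 ⟨h2, h3⟩),
      ← Nat.card_eq_fintype_card, ← Set.ncard_univ, Nat.add_one_le_iff]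
    refine Set.ncard_lt_ncard ⟨Set.subset_univ _, fun h => ?_⟩
    rcases h (Set.mem_univ v) with (h | h) | h
    exacts [(hT'.isCut_side ha.symm).right_notMem h, (hT'.isCut_side hb.symm).right_notMem h,
      (hT'.isCut_side hc.symm).right_notMem h]
  have hlt : (T.side y u).ncard < (T.side c v).ncard :=
    Set.ncard_lt_ncard ⟨hsub, fun h => (hT'.isCut_side hy.symm).right_notMem (h huc)⟩
  refine Finset.sum_lt_sum_of_nonempty ⟨(v, c), ?_⟩ fun p hp => ?_
  · rw [mem_dartsBetween]
    refine ⟨hc, (hT'.isCut_side hc).left_mem, ?_⟩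
    rw [hT'.side_swap hc.symm]
    exact fun h => h huc
  · obtain ⟨hp, hpv, hpu⟩ := mem_dartsBetween.1 hp
    have h1 : T.side p.2 p.1 ⊆ T.side c v := by
      refine hT'.side_subset_side hc.symm hp.symm huc ?_ ?_
      · rwa [hT'.side_swap hp]
      · rw [hT'.side_swap hp]
        exact fun h => h hpv
    have h2 := Set.ncard_le_ncard h1 (Set.toFinite _)
    rw [hT'.ncard_side_swap hp] at h2
    obtain ⟨h3, h4, -⟩ := hex.ncard_side_of_mem hT' hp hpv hpu
    exact hT.strictlyConvex.lt (by omega) (by omega) (by omega)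

theorem IsMinimizer.not_three_branches (hT : IsMinimizer T g) (ha : T.Adj v a) (hb : T.Adj v b)
    (hc : T.Adj v c) (hab : a ≠ b) (hac : a ≠ c) (hbc : b ≠ c) {x y z : V} (hx : IsBranchV T x)
    (hy : IsBranchV T y) (hz : IsBranchV T z) (hxa : x ∈ T.side a v) (hyb : y ∈ T.side b v)
    (hzc : z ∈ T.side c v) : False := by
  have h1 := hT.lt_ncard_side ha hb hc hab hac hbc hz hzc
  have h2 := hT.lt_ncard_side ha hc hb hac hab hbc.symm hy hyb
  have h3 := hT.lt_ncard_side hb hc ha hbc hab.symm hac.symm hx hxa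
  omega

end Branches

end SimpleGraph

namespace SimpleGraph

open scoped Classical

section TwoSegments

variable {V : Type*} [Fintype V] {T : SimpleGraph V} {g : ℕ → ℕ} {a b N j : ℕ} {z : ℕ → V}
  {x p q : V}

theorem IsTree.ncard_side_of_degN_eq_two (hT : T.IsTree) (hp : T.Adj p x) (hq : T.Adj x q)
    (hpq : p ≠ q) (hx : degN T x = 2) : (T.side x q).ncard = (T.side p x).ncard + 1 := by
  have hC := hT.isCut_side hp
  have : IsCut T x q (insert x (T.side p x)) := by
    refine ⟨Set.mem_insert _ _, ?_, ?_⟩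
    · rintro (h | h)
      · exact hq.ne h.symm
      · exact hpq (hC.eq_of_adj _ _ hq.symm h hC.right_notMem).1.symm
    · intro y y' hy h h'
      rw [Set.mem_insert_iff, not_or] at h'
      rcases h with rfl | h
      · rcases eq_or_eq_of_degN_eq_two hx hp.symm hq hpq hy with rfl | rfl
        · exact absurd hC.left_mem h'.2
        · exact ⟨rfl, rfl⟩
      · exact absurd (hC.eq_of_adj _ _ hy h h'.2).2 h'.1
  rw [← (hT.isCut_iff hq).1 this, Set.ncard_insert_of_notMem hC.right_notMem]

theorem IsTree.ncard_side_of_isBranchV (hT : T.IsTree) (hp : T.Adj p x) (hq : T.Adj x q)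
    (hpq : p ≠ q) (hx : IsBranchV T x) : (T.side p x).ncard + 2 ≤ (T.side x q).ncard := by
  have hC := hT.isCut_side hp
  obtain ⟨y, hy, hy'⟩ : ∃ y ∈ T.neighborSet x, y ∉ ({p, q} : Set V) := by
    refine Set.exists_mem_notMem_of_ncard_lt_ncard ?_
    rw [Set.ncard_pair hpq]
    exact hx
  rw [Set.mem_insert_iff, Set.mem_singleton_iff, not_or] at hy'
  have hyC : y ∉ T.side p x := fun h =>
    hy'.1 (hC.eq_of_adj y x (T.symm.symm _ _ hy) h hC.right_notMem).1
  have hsub : insert y (insert x (T.side p x)) ⊆ T.side x q := by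
    rw [Set.insert_subset_iff, Set.insert_subset_iff]
    refine ⟨hT.mem_side_of_adj hy hq hy'.2, (hT.isCut_side hq).left_mem, ?_⟩
    refine hT.side_subset_side hq hp (hT.mem_side_of_adj hp.symm hq hpq) hC.left_mem fun h => ?_
    exact hpq (hC.eq_of_adj q x hq.symm h hC.right_notMem).1.symm
  have := Set.ncard_le_ncard hsub (Set.toFinite _)
  rwa [Set.ncard_insert_of_notMem, Set.ncard_insert_of_notMem hC.right_notMem] at this
  rw [Set.mem_insert_iff, not_or]
  exact ⟨(T.ne_of_adj hy).symm, hyC⟩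

omit [Fintype V] in
theorem IsPathSeq.isExchange (hz : IsPathSeq T N z) (hT : T.IsTree) (hN : 2 ≤ N) :
    IsExchange T (z 0) (z N) (T.side (z 0) (z 1) \ {z 0}) (T.side (z N) (z (N - 1)) \ {z N}) := by
  have h0 := hz.adj 0 (by omega)
  have hN' := hz.adj (N - 1) (by omega)
  rw [Nat.sub_add_cancel (by omega)] at hN'
  have hA := hT.isCut_side h0
  have hB := hT.isCut_side hN'.symm
  have hsw : T.side (z N) (z (N - 1)) = (T.side (z (N - 1)) (z N))ᶜ := hT.side_swap hN'
  have m1 : ∀ i, 1 ≤ i → i ≤ N → z i ∉ T.side (z 0) (z 1) := fun i h1 h2 => hz.notMem_side hT h2 h1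
  have m2 : ∀ i, i ≤ N - 1 → z i ∉ T.side (z N) (z (N - 1)) := fun i h1 => by
    have := hz.mem_side hT (show N - 1 < N by omega) h1
    rw [Nat.sub_add_cancel (by omega)] at this
    rw [hsw]
    exact fun h => h this
  refine ⟨fun h => ?_, by simp, fun h => m2 0 (by omega) h.1, fun h => m1 N (by omega) le_rfl h.1,
    by simp, ?_, ?_, ?_⟩
  · have := hz.inj 0 (by omega) N le_rfl h
    omega
  · refine Set.disjoint_of_subset Set.sdiff_subset Set.sdiff_subset ?_
    rw [← Set.subset_compl_iff_disjoint_right, hsw, compl_compl]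
    have := hT.side_subset_side hN' h0 (x := z 0) ?_ hA.left_mem (m1 N (by omega) le_rfl)
    · exact this
    · have := hz.mem_side hT (show N - 1 < N by omega) (Nat.zero_le _)
      rwa [Nat.sub_add_cancel (by omega)] at this
  · rintro x y hxy ⟨hx, hx'⟩ hy
    by_contra hne
    exact hx' (hA.eq_of_adj x y hxy hx (fun h => hy ⟨h, hne⟩)).1
  · rintro x y hxy ⟨hx, hx'⟩ hy
    by_contra hne
    exact hx' (hB.eq_of_adj x y hxy hx (fun h => hy ⟨h, hne⟩)).1

theorem IsTree.ncard_neighborSet_inter (hT : T.IsTree) (h : T.Adj x q) :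
    (T.neighborSet x ∩ (T.side x q \ {x})).ncard + 1 = degN T x := by
  have hC := hT.isCut_side h
  have : T.neighborSet x ∩ (T.side x q \ {x}) = T.neighborSet x \ {q} := by
    ext y
    constructor
    · rintro ⟨hy, hy', -⟩
      refine ⟨hy, ?_⟩
      rintro rfl
      exact hC.right_notMem hy'
    · rintro ⟨hy, hy'⟩
      exact ⟨hy, hT.mem_side_of_adj hy h hy', (T.ne_of_adj hy).symm⟩
  rw [this]
  exact Set.ncard_sdiff_singleton_add_one h (Set.toFinite _)

theorem IsMinimizer.le_of_ncard_side_add_le (hT : IsMinimizer T g) (hz : IsPathSeq T (a + b) z)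
    (ha : 0 < a) (hb : 0 < b) (h0 : degN T (z 0) ≠ 2) (hN : degN T (z (a + b)) ≠ 2)
    (hmid : ∀ i, 0 < i → i < a + b → i ≠ a → degN T (z i) = 2) (hbr : IsBranchV T (z a))
    (hle : (T.side (z (a - 1)) (z a)).ncard + (T.side (z a) (z (a + 1))).ncard ≤ Fintype.card V) :
    a ≤ b := by
  by_contra! hba
  have hT' := hT.isTree
  have hex := hz.isExchange hT' (by omega)
  have hlast := hz.adj (a + b - 1) (by omega)
  rw [Nat.sub_add_cancel (by omega)] at hlast
  have hdv := hex.degN_exchange_left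
  have hdu := hex.symm.degN_exchange_left
  have hA := hT'.ncard_neighborSet_inter (hz.adj 0 (by omega))
  have hB := hT'.ncard_neighborSet_inter hlast.symm
  rw [zero_add] at hA
  rw [IsExchange.exchange_symm] at hdu
  have hsum := hT.sum_dartsBetween_le hex h0 hN (by omega) (by omega)
  refine absurd hsum (not_le.2 ?_)
  clear hsum hdv hdu hA hB
  set n := Fintype.card V with hn
  set s : ℕ → ℕ := fun j => (T.side (z j) (z (j + 1))).ncard with hs
  have hs0 : (T.side (z 0) (z 1)).ncard = s 0 := rfl
  have hsle : ∀ j, s j ≤ n := fun j => by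
    rw [hn, ← Nat.card_eq_fintype_card, ← Set.ncard_univ]
    exact Set.ncard_le_ncard (Set.subset_univ _) (Set.toFinite _)
  have hne : ∀ j, j + 2 ≤ a + b → z j ≠ z (j + 2) := fun j hj h => by
    have := hz.inj _ (by omega) _ hj h
    omega
  have hstep : ∀ j, j + 1 < a + b → j + 1 ≠ a → s (j + 1) = s j + 1 := fun j hj hja =>
    hT'.ncard_side_of_degN_eq_two (hz.adj j (by omega)) (hz.adj (j + 1) (by omega))
      (hne j (by omega)) (hmid _ (by omega) hj hja)
  have hbig : s (a - 1) + 2 ≤ s a := by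
    have h1 := hz.adj (a - 1) (by omega)
    have h2 := hne (a - 1) (by omega)
    have : s (a - 1) = (T.side (z (a - 1)) (z a)).ncard := by
      simp only [hs]
      rw [Nat.sub_add_cancel ha]
    rw [Nat.sub_add_cancel ha] at h1
    rw [show a - 1 + 2 = a + 1 by omega] at h2
    rw [this]
    exact hT'.ncard_side_of_isBranchV h1 (hz.adj a (by omega)) h2 hbr
  have hlow : ∀ j, j < a → s j = s 0 + j := by
    intro j hj
    induction j with
    | zero => rfl
    | succ j ih => rw [hstep j (by omega) (by omega), ih (by omega)]; omega
  have hhigh : ∀ j, j < b → s (a + j) = s a + j := by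
    intro j hj
    induction j with
    | zero => rfl
    | succ j ih => rw [← add_assoc, hstep _ (by omega) (by omega), ih (by omega)]; omega
  have hle' : s (a - 1) + s a ≤ n := by
    refine le_of_eq_of_le ?_ hle
    simp only [hs]
    rw [Nat.sub_add_cancel ha]
  have hX : (T.side (z 0) (z 1) \ {z 0}).ncard + 1 = s 0 :=
    Set.ncard_sdiff_singleton_add_one (hT'.isCut_side (hz.adj 0 (by omega))).left_mem
      (Set.toFinite _)
  have hY : (T.side (z (a + b)) (z (a + b - 1)) \ {z (a + b)}).ncard + 1 = n - s (a + b - 1) := by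
    rw [Set.ncard_sdiff_singleton_add_one (hT'.isCut_side hlast.symm).left_mem (Set.toFinite _),
      hT'.ncard_side_swap hlast]
    simp only [hs]
    rw [Nat.sub_add_cancel (by omega)]
  have hlastlt : s (a + b - 1) + 1 ≤ n := by
    have := hsle (a + b - 1)
    omega
  have hsl : s (a + b - 1) = s a + (b - 1) := by
    rw [← hhigh (b - 1) (by omega), show a + (b - 1) = a + b - 1 by omega]
  rw [hsl] at hY hlastlt
  have hlo1 := hlow (a - 1) (by omega)
  rw [hz.sum_dartsBetween hT', hz.sum_dartsBetween hT', ← Finset.sum_range_reflect]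
  set X := (T.side (z 0) (z 1) \ {z 0}).ncard
  set Y := (T.side (z (a + b)) (z (a + b - 1)) \ {z (a + b)}).ncard
  have heq : ∀ i, i < a + b → (i < b ∨ a ≤ i) → s (a + b - 1 - i) - X + Y = n - s i := by
    intro i hi h
    rcases h with h | h
    · rw [hlow i (by omega), show a + b - 1 - i = a + (b - 1 - i) by omega, hhigh _ (by omega)]
      omega
    · rw [show i = a + (i - a) by omega, hhigh _ (by omega), hlow _ (by omega)]
      omega
  have hlt : ∀ i, b ≤ i → i < a → g (s (a + b - 1 - i) - X + Y) +
      g (n - (s (a + b - 1 - i) - X + Y)) < g (s i) + g (n - s i) := by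
    intro i hi h
    have h1 := hlow i h
    have h2 := hlow (a + b - 1 - i) (by omega)
    have := hT.strictlyConvex.lt (n := n) (c := n - s i) (c' := s (a + b - 1 - i) - X + Y)
      (by omega) (by omega) (by omega)
    rwa [Nat.sub_sub_self (hsle i), add_comm (g (n - s i))] at this
  refine Finset.sum_lt_sum (fun i hi => ?_) ⟨b, Finset.mem_range.2 (by omega), hlt b le_rfl hba⟩
  rw [Finset.mem_range] at hi
  by_cases h : i < b ∨ a ≤ i
  · change g (s (a + b - 1 - i) - X + Y) + g (n - (s (a + b - 1 - i) - X + Y)) ≤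
      g (s i) + g (n - s i)
    rw [heq i hi h, Nat.sub_sub_self (hsle i), add_comm]
  · exact (hlt i (by omega) (by omega)).le

end TwoSegments

end SimpleGraph

namespace SimpleGraph

open scoped Classical

section Spine

variable {V : Type*} {T : SimpleGraph V} {N M i j : ℕ} {z y : ℕ → V} {x c : V}

theorem IsTree.exists_adj_mem_side (hT : T.IsTree) (h : x ≠ c) :
    ∃ y, T.Adj c y ∧ x ∈ T.side y c := by
  obtain ⟨N, z, hz, rfl, rfl⟩ := hT.exists_isPathSeq c x
  have hN : 0 < N := by
    rw [Nat.pos_iff_ne_zero]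
    rintro rfl
    exact h rfl
  refine ⟨z 1, hz.adj 0 hN, ?_⟩
  rw [hT.side_swap (hz.adj 0 hN)]
  exact hz.notMem_side hT le_rfl hN

namespace IsPathSeq

theorem side_subset_side (hz : IsPathSeq T N z) (hT : T.IsTree) (hij : i ≤ j) (hj : j < N) :
    T.side (z i) (z (i + 1)) ⊆ T.side (z j) (z (j + 1)) :=
  hT.side_subset_side (hz.adj j hj) (hz.adj i (by omega)) (hz.mem_side hT hj hij)
    (hT.isCut_side (hz.adj i (by omega))).left_mem (hz.notMem_side hT (by omega) (by omega))

theorem le_of_forall_notMem_side (hz : IsPathSeq T N z) (hy : IsPathSeq T M y) (hT : T.IsTree)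
    (h0 : y 0 = z 0) (h : ∀ j < N, y M ∉ T.side (z j) (z (j + 1))) : N ≤ M := by
  rw [← hz.ncard_separatingEdges hT, ← hy.ncard_separatingEdges hT]
  refine Set.ncard_le_ncard (fun e he => ?_) ?_
  · obtain ⟨j, hj, rfl⟩ := (hz.mem_separatingEdges_iff hT).1 he
    refine ⟨hz.adj j hj, fun a b hab hS => ?_⟩
    have h1 := hz.mem_side hT hj (Nat.zero_le _)
    rw [Finset.coe_pair, Set.pair_subset_iff, h0] at hS
    rcases Sym2.eq_iff.1 hab with ⟨rfl, rfl⟩ | ⟨rfl, rfl⟩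
    · exact h j hj hS.2
    · have := hS.1
      rw [hT.side_swap (hz.adj j hj)] at this
      exact this h1
  · by_cases hM : M = 0
    · subst hM
      refine Set.Finite.subset Set.finite_empty fun e he => ?_
      obtain ⟨j, hj, -⟩ := (hy.mem_separatingEdges_iff hT).1 he
      omega
    · exact Set.finite_of_ncard_ne_zero (by rwa [hy.ncard_separatingEdges hT])

theorem exists_eq_of_endpoints (hz : IsPathSeq T N z) (hy : IsPathSeq T M y) (hT : T.IsTree)
    {p q : ℕ} (hp : p ≤ N) (hq : q ≤ N) (h0 : y 0 = z p) (hM : y M = z q) (hj : j ≤ M) :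
    ∃ i ≤ N, y j = z i := by
  wlog hpq : p ≤ q generalizing p q y j
  · have := this hy.reverse hq hp (by simpa using hM) (by simpa using h0) (j := M - j)
      (by omega) (by omega)
    simpa [Nat.sub_sub_self hj] using this
  have hz' := hz.mono (i := p) (M := q - p) (by omega)
  have hz0 : z p = (fun j => z (p + j)) 0 := rfl
  have hzq : z q = (fun j => z (p + j)) (q - p) := by simp [show p + (q - p) = q by omega]
  have key : ∀ j < M, s(y j, y (j + 1)) ∈ T.separatingEdges {z p, z q} := by
    intro j hj
    rw [← h0, ← hM]
    exact (hy.mem_separatingEdges_iff hT).2 ⟨j, hj, rfl⟩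
  have hmem : ∀ j < M, ∀ x ∈ s(y j, y (j + 1)), ∃ i ≤ N, x = z i := by
    intro j hj x hx
    have := key j hj
    rw [hz0, hzq, hz'.mem_separatingEdges_iff hT] at this
    obtain ⟨i, hi, h⟩ := this
    rw [h, Sym2.mem_iff] at hx
    rcases hx with rfl | rfl
    · exact ⟨_, by omega, rfl⟩
    · exact ⟨_, by omega, rfl⟩
  rcases hj.lt_or_eq with hj | rfl
  · exact hmem j hj _ (by simp)
  · exact ⟨q, hq, hM⟩

end IsPathSeq

theorem IsSegSeq.side_eq (hy : IsSegSeq T M y) (hT : T.IsTree) (h0 : IsLeafV T (y 0))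
    (hj : j < M) : T.side (y j) (y (j + 1)) = {x | ∃ i ≤ j, y i = x} := by
  symm
  rw [← hT.isCut_iff (hy.adj j hj)]
  refine ⟨⟨j, le_rfl, rfl⟩, ?_, ?_⟩
  · rintro ⟨i, hi, h⟩
    have := hy.inj _ (by omega) _ (by omega) h
    omega
  · rintro _ x hx ⟨i, hi, rfl⟩ h
    rcases Nat.eq_zero_or_pos i with rfl | hi0
    · obtain rfl : x = y 1 := by
        have h2 := Set.ncard_eq_one.1 h0
        obtain ⟨a, ha⟩ := h2
        have h3 : x ∈ T.neighborSet (y 0) := hx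
        have h4 : y 1 ∈ T.neighborSet (y 0) := hy.adj 0 hy.pos
        rw [ha] at h3 h4
        rw [h3, h4]
      have : j = 0 := by
        by_contra hj0
        exact h ⟨1, by omega, rfl⟩
      subst this
      exact ⟨rfl, rfl⟩
    · rcases hy.eq_of_adj hi0 (by omega) rfl hx with rfl | rfl
      · exact absurd ⟨i - 1, by omega, rfl⟩ h
      · have : i = j := by
          by_contra hij
          exact h ⟨i + 1, by omega, rfl⟩
        subst this
        exact ⟨rfl, rfl⟩

theorem IsSegSeq.not_isBranchV_of_mem_side (hy : IsSegSeq T M y) (hT : T.IsTree)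
    (h0 : IsLeafV T (y 0)) (hj : j < M) (hx : x ∈ T.side (y j) (y (j + 1))) : ¬ IsBranchV T x := by
  rw [hy.side_eq hT h0 hj] at hx
  obtain ⟨i, hi, rfl⟩ := hx
  unfold IsBranchV IsLeafV at *
  rcases Nat.eq_zero_or_pos i with rfl | hi0
  · omega
  · have := hy.mid i hi0 (by omega)
    omega

variable [Fintype V] {g : ℕ → ℕ}

omit [Fintype V] in
theorem eq_of_isBranchV_of_forall_notMem_side (hT : T.IsTree) (hz : IsPathSeq T N z)
    (h0 : IsBranchV T (z 0)) (hmax : ∀ M y, IsPathSeq T M y → IsBranchV T (y 0) →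
      IsBranchV T (y M) → M ≤ N) (hx : IsBranchV T x)
    (h : ∀ j < N, x ∉ T.side (z j) (z (j + 1))) : x = z N := by
  by_contra hne
  obtain ⟨c, hc, hxc⟩ := hT.exists_adj_mem_side hne
  have hz' := hz.snoc hT hc fun hN => by
    rintro rfl
    have h1 := h (N - 1) (by omega)
    have h2 := hz.adj (N - 1) (by omega)
    rw [Nat.sub_add_cancel hN] at h1 h2
    exact h1 hxc
  obtain ⟨M, y, hy, hy0, rfl⟩ := hT.exists_isPathSeq (z 0) x
  have hle := hz'.le_of_forall_notMem_side hy hT (by rw [hy0, Function.update_of_ne (by omega)])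
    fun j hj => by
      rw [Function.update_of_ne (by omega)]
      rcases Nat.lt_succ_iff_lt_or_eq.1 hj with hj | rfl
      · rw [Function.update_of_ne (by omega)]
        exact h j hj
      · rw [Function.update_self, hT.side_swap hc.symm]
        exact fun h => h hxc
  have := hmax M y hy (hy0 ▸ h0) hx
  omega

theorem IsMinimizer.exists_spine (hT : IsMinimizer T g) (hbr : ∃ x, IsBranchV T x) :
    ∃ N z, IsPathSeq T N z ∧ IsBranchV T (z 0) ∧ IsBranchV T (z N) ∧
      ∀ x, IsBranchV T x → ∃ i ≤ N, z i = x := by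
  have hT' := hT.isTree
  set S := {N | ∃ z, IsPathSeq T N z ∧ IsBranchV T (z 0) ∧ IsBranchV T (z N)} with hS
  obtain ⟨x₀, hx₀⟩ := hbr
  have hne : S.Nonempty := ⟨0, fun _ => x₀, ⟨fun _ h => by omega, fun _ _ _ _ _ => by omega⟩, hx₀, hx₀⟩
  have hbdd : BddAbove S := ⟨Fintype.card V, fun N ⟨z, hz, _⟩ => hz.lt_card.le⟩
  obtain ⟨z, hz, h0, hN⟩ := Nat.sSup_mem hne hbdd
  have hmax : ∀ M y, IsPathSeq T M y → IsBranchV T (y 0) → IsBranchV T (y M) → M ≤ sSup S :=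
    fun M y h1 h2 h3 => le_csSup hbdd ⟨y, h1, h2, h3⟩
  generalize sSup S = N at hz hN hmax
  refine ⟨N, z, hz, h0, hN, fun x hx => ?_⟩
  by_contra! hcon
  have hex : ∃ j, j < N ∧ x ∈ T.side (z j) (z (j + 1)) := by
    by_contra! h
    exact hcon N le_rfl (eq_of_isBranchV_of_forall_notMem_side hT' hz h0 hmax hx h).symm
  obtain ⟨hi, hxi⟩ := Nat.find_spec hex
  have hmin := fun j => Nat.find_min hex (m := j)
  generalize Nat.find hex = i at hi hxi hmin
  have hi0 : 0 < i := by
    rw [Nat.pos_iff_ne_zero]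
    rintro rfl
    refine hcon 0 (Nat.zero_le _) ?_
    have := eq_of_isBranchV_of_forall_notMem_side hT' hz.reverse (by simpa using hN) hmax hx
      fun j hj => by
        have h1 := hz.adj (N - (j + 1)) (by omega)
        have h2 := hz.side_subset_side hT' (Nat.zero_le (N - (j + 1))) (by omega) hxi
        rw [show N - (j + 1) + 1 = N - j by omega] at h1 h2
        rw [hT'.side_swap h1]
        exact fun h => h h2
    simpa using this.symm
  obtain ⟨c, hc, hxc⟩ := hT'.exists_adj_mem_side (fun h => hcon i hi.le h.symm : x ≠ z i)
  have ha := hz.adj (i - 1) (by omega)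
  have hxa : x ∉ T.side (z (i - 1)) (z i) := by
    have h1 := hmin (i - 1) (by omega)
    rw [Nat.sub_add_cancel hi0] at h1
    exact fun h => h1 ⟨by omega, h⟩
  have h0a := hz.mem_side hT' (show i - 1 < N by omega) (Nat.zero_le _)
  rw [Nat.sub_add_cancel hi0] at ha h0a
  have hb := hz.adj i hi
  have hxb : x ∉ T.side (z (i + 1)) (z i) := by
    rw [hT'.side_swap hb]
    exact fun h => h hxi
  have hNb : z N ∈ T.side (z (i + 1)) (z i) := by
    rw [hT'.side_swap hb]
    exact hz.notMem_side hT' le_rfl hi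
  refine hT.not_three_branches ha.symm hb hc ?_ ?_ ?_ h0 hN hx h0a hNb hxc
  · intro h
    have := hz.inj _ (by omega) _ (by omega) h
    omega
  · rintro rfl
    exact hxa hxc
  · rintro rfl
    exact hxb hxc

end Spine

end SimpleGraph

namespace SimpleGraph

open scoped Classical

section QuasiCaterpillar

variable {V : Type*} [Fintype V] {T : SimpleGraph V} {N M i j : ℕ} {z y : ℕ → V} {x a b : V}

omit [Fintype V] in
theorem IsLeafV.eq_of_adj (hx : IsLeafV T x) (ha : T.Adj x a) (hb : T.Adj x b) : a = b := by
  obtain ⟨c, hc⟩ := Set.ncard_eq_one.1 hx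
  have h1 : a ∈ T.neighborSet x := ha
  have h2 : b ∈ T.neighborSet x := hb
  rw [hc] at h1 h2
  exact h1.trans h2.symm

theorem IsSegSeq.exists_eq_edge (hz : IsSegSeq T N z) (hbr : ∀ x, ¬ IsBranchV T x)
    (hi : i ≤ N) (ha : T.Adj (z i) a) : ∃ j < N, s(z i, a) = s(z j, z (j + 1)) := by
  have hpos := hz.pos
  have h1 : T.Adj (z N) (z (N - 1)) := by
    have := hz.adj (N - 1) (by omega)
    rw [Nat.sub_add_cancel hpos] at this
    exact this.symm
  obtain rfl | rfl | hi : i = 0 ∨ i = N ∨ (0 < i ∧ i < N) := by omega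
  · have h0 : IsLeafV T (z 0) :=
      ((isLeafV_or_isBranchV ha).2 hz.left).resolve_right (hbr _)
    exact ⟨0, hpos, by rw [h0.eq_of_adj ha (hz.adj 0 hpos)]⟩
  · have hN : IsLeafV T (z i) :=
      ((isLeafV_or_isBranchV ha).2 hz.right).resolve_right (hbr _)
    refine ⟨i - 1, by omega, ?_⟩
    rw [hN.eq_of_adj ha h1, Nat.sub_add_cancel hpos, Sym2.eq_swap]
  · rcases hz.eq_of_adj hi.1 hi.2 rfl ha with rfl | rfl
    · refine ⟨i - 1, by omega, ?_⟩
      rw [Nat.sub_add_cancel hi.1, Sym2.eq_swap]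
    · exact ⟨i, hi.2, rfl⟩

theorem IsTree.exists_isBranchV (hT : T.IsTree) (h : 2 ≤ Multiset.card (segmentMultiset T)) :
    ∃ x, IsBranchV T x := by
  by_contra! hbr
  rw [hT.segmentMultiset_eq, Multiset.card_map, Finset.card_val, Finset.card_univ] at h
  obtain ⟨c⟩ : Nonempty (segGraph T).ConnectedComponent := Fintype.card_pos_iff.1 (by omega)
  obtain ⟨⟨e, he⟩, -⟩ := c.exists_rep
  induction e with
  | _ a b =>
  obtain ⟨N, z, hz, j, hj, rfl, rfl⟩ := hT.exists_isSegSeq ((T.mem_edgeSet).1 he)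
  have hall : ∀ x, x ∈ {x | ∃ i ≤ N, z i = x} := by
    refine hT.1.mem_of_forall_adj (x := z 0) ⟨0, by omega, rfl⟩ ?_
    rintro _ w hw ⟨i, hi, rfl⟩
    obtain ⟨j, hj, hje⟩ := hz.exists_eq_edge hbr hi hw
    have : w ∈ s(z j, z (j + 1)) := hje ▸ Sym2.mem_mk_right _ _
    rcases Sym2.mem_iff.1 this with rfl | rfl
    · exact ⟨j, by omega, rfl⟩
    · exact ⟨j + 1, by omega, rfl⟩
  have hreach : ∀ f : T.edgeSet,
      (segGraph T).Reachable ⟨s(z 0, z (0 + 1)), hz.adj 0 hz.pos⟩ f := by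
    rintro ⟨f, hf⟩
    rw [hz.reachable_iff]
    induction f with
    | _ a b =>
    obtain ⟨i, hi, rfl⟩ := hall a
    exact hz.exists_eq_edge hbr hi hf
  have : Subsingleton (segGraph T).ConnectedComponent := by
    refine ⟨fun c d => ?_⟩
    induction c using ConnectedComponent.ind
    induction d using ConnectedComponent.ind
    exact ConnectedComponent.sound ((hreach _).symm.trans (hreach _))
  have := Fintype.card_le_one_iff_subsingleton.2 this
  omega

theorem IsTree.exists_isSegSeq_mem (hT : T.IsTree) (hab : T.Adj x a) :
    ∃ N z, IsSegSeq T N z ∧ ∃ j ≤ N, z j = x := by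
  obtain ⟨N, z, hz, j, hj, h, -⟩ := hT.exists_isSegSeq hab
  exact ⟨N, z, hz, j, hj.le, h⟩

theorem IsSegSeq.mem_pendantSegmentVertices (hz : IsSegSeq T N z) (h0 : IsLeafV T (z 0))
    (hi : i ≤ N) (hbr : ¬ IsBranchV T (z i)) : z i ∈ pendantSegmentVertices T := by
  obtain ⟨w, hw, -, hmem⟩ := hz.exists_walk
  refine ⟨_, _, w, hz.isSegment, h0, hw, ?_, (hmem _).2 ⟨i, hi, rfl⟩, hbr⟩
  intro y hy h1 h2
  obtain ⟨j, hj, rfl⟩ := (hmem y).1 hy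
  refine hz.mid j (Nat.pos_of_ne_zero ?_) (lt_of_le_of_ne hj ?_) <;> rintro rfl <;> contradiction

omit [Fintype V] in
theorem exists_isSegSeq_of_mem_pendantSegmentVertices (hx : x ∈ pendantSegmentVertices T) :
    ∃ N z, IsSegSeq T N z ∧ IsLeafV T (z 0) ∧ ∃ i ≤ N, z i = x := by
  obtain ⟨u, v, w, hs, hu, hw, hmid, hxw, -⟩ := hx
  have key := hw.isPathSeq
  have hlen : 0 < w.length := by
    rw [Nat.pos_iff_ne_zero]
    exact fun h => hs.1 (Walk.eq_of_length_eq_zero h)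
  refine ⟨w.length, w.getVert, ⟨key, hlen, ?_, ?_, ?_⟩, by simpa using hu, ?_⟩
  · have := hs.2.1
    rw [Walk.getVert_zero]
    unfold IsLeafV IsBranchV at this
    omega
  · have := hs.2.2.1
    rw [Walk.getVert_length]
    unfold IsLeafV IsBranchV at this
    omega
  · intro i h0 hi
    refine hmid _ (w.getVert_mem_support i) (fun h => ?_) fun h => ?_
    · have := key.inj i hi.le 0 (by omega) (by simpa using h)
      omega
    · have := key.inj i hi.le _ le_rfl (by simpa using h)
      omega
  · obtain ⟨n, hn, hnl⟩ := Walk.mem_support_iff_exists_getVert.1 hxw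
    exact ⟨n, hnl, hn⟩

theorem IsPathSeq.notMem_pendantSegmentVertices (hz : IsPathSeq T N z) (hT : T.IsTree)
    (h0 : IsBranchV T (z 0)) (hN : IsBranchV T (z N)) (hi : i ≤ N) :
    z i ∉ pendantSegmentVertices T := by
  intro hmem
  have hnb : ¬ IsBranchV T (z i) := by
    obtain ⟨_, _, _, _, _, _, _, _, h⟩ := hmem
    exact h
  have hi0 : 0 < i := Nat.pos_of_ne_zero fun h => hnb (h ▸ h0)
  have hiN : i < N := lt_of_le_of_ne hi fun h => hnb (h ▸ hN)
  obtain ⟨M, y, hy, hy0, j, hj, hji⟩ := exists_isSegSeq_of_mem_pendantSegmentVertices hmem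
  have hp := hz.adj (i - 1) (by omega)
  rw [Nat.sub_add_cancel hi0] at hp
  have hq := hz.adj i hiN
  have hpq : z (i - 1) ≠ z (i + 1) := fun h => by
    have := hz.inj _ (by omega) _ (by omega) h
    omega
  have hleaf : ¬ IsLeafV T (z i) := fun h => hpq (h.eq_of_adj hp.symm hq)
  have hj0 : 0 < j := Nat.pos_of_ne_zero fun h => hleaf (by rw [← hji, h]; exact hy0)
  have hjM : j < M := by
    refine lt_of_le_of_ne hj fun h => ?_
    rcases (isLeafV_or_isBranchV hq).2 (by rw [← hji, h]; exact hy.right) with h | h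
    · exact hleaf h
    · exact hnb h
  have hy1 := hy.adj (j - 1) (by omega)
  rw [Nat.sub_add_cancel hj0] at hy1
  have hno : ∀ x, x ∈ T.side (y (j - 1)) (y j) → ¬ IsBranchV T x := fun x hx =>
    hy.not_isBranchV_of_mem_side hT hy0 (j := j - 1) (by omega)
      (by rwa [Nat.sub_add_cancel hj0])
  rw [hji] at hno hy1
  rcases eq_or_eq_of_degN_eq_two (by rw [← hji]; exact hy.mid j hj0 hjM) hp.symm hq hpq hy1.symm
    with h | h
  · rw [h] at hno
    refine hno (z 0) ?_ h0
    have := hz.mem_side hT (i := 0) (j := i - 1) (by omega) (by omega)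
    rwa [Nat.sub_add_cancel hi0] at this
  · rw [h] at hno
    refine hno (z N) ?_ hN
    rw [hT.side_swap hq]
    exact hz.notMem_side hT le_rfl hiN

theorem IsPathSeq.exists_eq_of_notMem_pendantSegmentVertices (hz : IsPathSeq T N z)
    (hT : T.IsTree) (hbr : ∀ x, IsBranchV T x → ∃ i ≤ N, z i = x) (hxa : T.Adj x a)
    (hx : x ∉ pendantSegmentVertices T) : ∃ i ≤ N, z i = x := by
  by_cases hxb : IsBranchV T x
  · exact hbr x hxb
  obtain ⟨M, y, hy, j, hj, rfl⟩ := hT.exists_isSegSeq_mem hxa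
  have hy0 : ¬ IsLeafV T (y 0) := fun h => hx (hy.mem_pendantSegmentVertices h hj hxb)
  have hyM : ¬ IsLeafV T (y M) := fun h => hx <| by
    have := hy.reverse.mem_pendantSegmentVertices (i := M - j) (by simpa using h) (by omega)
    simp only [Nat.sub_sub_self hj] at this
    exact this hxb
  have hpos := hy.pos
  have hadj := hy.adj (M - 1) (by omega)
  rw [Nat.sub_add_cancel hpos] at hadj
  obtain ⟨p, hp, hp'⟩ := hbr _
    (((isLeafV_or_isBranchV (hy.adj 0 hpos)).2 hy.left).resolve_left hy0)
  obtain ⟨q, hq, hq'⟩ := hbr _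
    (((isLeafV_or_isBranchV hadj.symm).2 hy.right).resolve_left hyM)
  obtain ⟨i, hi, h⟩ := hz.exists_eq_of_endpoints hy.toIsPathSeq hT hp hq hp'.symm hq'.symm hj
  exact ⟨i, hi, h.symm⟩

omit [Fintype V] in
theorem IsPathSeq.isPathGraph_induce (hz : IsPathSeq T N z) {s : Set V}
    (hs : ∀ x, x ∈ s ↔ ∃ i ≤ N, z i = x) : IsPathGraph (T.induce s) := by
  obtain ⟨w, hw, -, hmem⟩ := hz.exists_walk
  have h : ∀ x ∈ w.support, x ∈ s := fun x hx => (hs x).2 ((hmem x).1 hx)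
  refine ⟨_, _, w.induce s h, ?_, ?_⟩
  · refine Walk.IsPath.of_map (f := (Embedding.induce s).toHom) ?_
    rwa [Walk.map_induce]
  · rintro ⟨x, hx⟩
    rw [Walk.support_induce, List.mem_attachWith]
    exact (hmem x).2 ((hs x).1 hx)

theorem IsMinimizer.isQuasiCaterpillar {g : ℕ → ℕ} (hT : IsMinimizer T g)
    (hbr : ∃ x, IsBranchV T x) : IsQuasiCaterpillar T := by
  refine ⟨hT.isTree, ?_⟩
  obtain ⟨N, z, hz, h0, hN, hall⟩ := hT.exists_spine hbr
  refine hz.isPathGraph_induce fun x => ⟨fun hx => ?_, ?_⟩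
  · by_cases hx0 : x = z 0
    · exact ⟨0, by omega, hx0.symm⟩
    · obtain ⟨a, ha, -⟩ := hT.isTree.exists_adj_mem_side (Ne.symm hx0)
      exact hz.exists_eq_of_notMem_pendantSegmentVertices hT.isTree hall ha hx
  · rintro ⟨i, hi, rfl⟩
    exact hz.notMem_pendantSegmentVertices hT.isTree h0 hN hi

end QuasiCaterpillar

end SimpleGraph

theorem exists_strictMono_enumeration (P : ℕ → Prop) {N : ℕ} (hN : 0 < N) (h0 : P 0)
    (hPN : P N) :
    ∃ (c : ℕ) (t : ℕ → ℕ), 0 < c ∧ t 0 = 0 ∧ t c = N ∧ StrictMono t ∧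
      (∀ i ≤ c, P (t i)) ∧ ∀ i < c, ∀ j, t i < j → j < t (i + 1) → ¬ P j := by
  classical
  let Q : ℕ → Prop := fun i => P i ∨ N < i
  have hinf : (Set.ofPred Q).Infinite := by
    refine Set.infinite_of_forall_exists_gt fun n => ⟨n + N + 1, Or.inr ?_, ?_⟩ <;> omega
  have hmono : StrictMono (Nat.nth Q) := Nat.nth_strictMono hinf
  have hcN : Nat.nth Q (Nat.count Q N) = N := Nat.nth_count (Or.inl hPN)
  have hc0 : Nat.nth Q 0 = 0 := by
    have := Nat.nth_count (p := Q) (n := 0) (Or.inl h0)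
    rwa [Nat.count_zero] at this
  refine ⟨Nat.count Q N, Nat.nth Q, ?_, hc0, hcN, hmono, ?_, ?_⟩
  · refine Nat.pos_of_ne_zero fun h => ?_
    rw [h] at hcN
    omega
  · intro i hi
    refine (Nat.nth_mem_of_infinite hinf i).resolve_right ?_
    have := hmono.monotone hi
    omega
  · intro i hi j hij hji hj
    have hj' : Nat.nth Q (Nat.count Q j) = j := Nat.nth_count (Or.inl hj)
    rw [← hj'] at hij hji
    have h1 := hmono.lt_iff_lt.1 hij
    have h2 := hmono.lt_iff_lt.1 hji
    omega

theorem exists_unimodal_index (r : ℕ → ℕ) (D : ℕ → Prop) {c : ℕ} (hc : 0 < c)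
    (hle : ∀ i, i + 1 < c → D i → r i ≤ r (i + 1))
    (hge : ∀ i, i + 1 < c → ¬ D i → r (i + 1) ≤ r i)
    (hD : ∀ i, i + 2 < c → D (i + 1) → D i) :
    ∃ j < c, (∀ i₁ i₂, i₁ ≤ i₂ → i₂ ≤ j → r i₁ ≤ r i₂) ∧
      ∀ i₁ i₂, j ≤ i₁ → i₁ ≤ i₂ → i₂ < c → r i₂ ≤ r i₁ := by
  classical
  have hex : ∃ j, c ≤ j + 1 ∨ ¬ D j := ⟨c, Or.inl (by omega)⟩
  have hspec := Nat.find_spec hex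
  have hmin : ∀ i < Nat.find hex, i + 1 < c ∧ D i := fun i hi => by
    have := Nat.find_min hex hi
    push Not at this
    exact this
  generalize Nat.find hex = j at hspec hmin
  have hjc : j < c := by
    by_contra! h
    have := (hmin (j - 1) (by omega)).1
    omega
  have hnot : ∀ i, j ≤ i → i + 1 < c → ¬ D i := by
    intro i hi
    induction i, hi using Nat.le_induction with
    | base => exact fun h => hspec.resolve_left (by omega)
    | succ i hi ih => exact fun h hDi => ih (by omega) (hD i h hDi)
  refine ⟨j, hjc, fun i₁ i₂ h12 => ?_, fun i₁ i₂ h1 h12 => ?_⟩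
  · induction i₂, h12 using Nat.le_induction with
    | base => exact fun _ => le_rfl
    | succ i hi ih =>
      intro h
      obtain ⟨h1, h2⟩ := hmin i (by omega)
      exact (ih (by omega)).trans (hle i h1 h2)
  · induction i₂, h12 using Nat.le_induction with
    | base => exact fun _ => le_rfl
    | succ i hi ih =>
      intro h
      exact (hge i h (hnot i (by omega) h)).trans (ih (by omega))

namespace SimpleGraph

section Backbone

variable {V : Type*} {T : SimpleGraph V} {N a b : ℕ} {z : ℕ → V} {u v x : V}

theorem IsPathSeq.isBranchV_of_pos_of_lt [Finite V] (hz : IsPathSeq T N z) {i : ℕ} (h0 : 0 < i)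
    (hi : i < N) (hd : degN T (z i) ≠ 2) : IsBranchV T (z i) := by
  have h1 := hz.adj (i - 1) (by omega)
  rw [Nat.sub_add_cancel h0] at h1
  have hsub : {z (i - 1), z (i + 1)} ⊆ T.neighborSet (z i) := by
    rintro y (rfl | rfl)
    · exact h1.symm
    · exact hz.adj i hi
  have hne : z (i - 1) ≠ z (i + 1) := fun h => by
    have := hz.inj _ (by omega) _ (by omega) h
    omega
  have := Set.ncard_le_ncard hsub (Set.toFinite _)
  rw [Set.ncard_pair hne] at this
  unfold IsBranchV degN at *
  omega

theorem IsBackbone.reverse {w : T.Walk u v} (hw : IsBackbone T w) : IsBackbone T w.reverse := by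
  refine ⟨hw.1.reverse, fun x hx => ?_, ?_⟩
  · simpa using hw.2.1 x hx
  · simpa using hw.2.2

theorem IsBackbone.degN_le_one {w : T.Walk u v} (hw : IsBackbone T w) (hT : T.IsTree) : degN T v ≤ 1 := by
  by_contra! h
  have hz := hw.1.isPathSeq
  obtain ⟨y, hy, hne⟩ := exists_ne_adj_of_two_le_degN h (w.getVert (w.length - 1))
  have hz' := hz.snoc hT (y := y) (by simpa using hy) fun _ => hne
  obtain ⟨w', hw', hlen, hmem⟩ := hz'.exists_walk
  have := hw.2.2 _ _ w' hw' fun x hx => (hmem x).2 <| by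
    obtain ⟨n, hn, hnl⟩ := Walk.mem_support_iff_exists_getVert.1 (hw.2.1 x hx)
    refine ⟨n, by omega, ?_⟩
    rwa [Function.update_of_ne (by omega)]
  omega

theorem IsBackbone.length_pos {w : T.Walk u v} (hw : IsBackbone T w) (hT : T.IsTree)
    (hbr : ∃ x, IsBranchV T x) : 0 < w.length := by
  obtain ⟨x, hx⟩ := hbr
  refine Nat.pos_of_ne_zero fun h => ?_
  obtain ⟨n, hn, hnl⟩ := Walk.mem_support_iff_exists_getVert.1 (hw.2.1 x hx)
  obtain rfl : n = w.length := by omega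
  rw [Walk.getVert_length] at hn
  subst hn
  have := hw.degN_le_one hT
  unfold IsBranchV at hx
  omega

variable [Fintype V] {g : ℕ → ℕ}

theorem IsMinimizer.le_of_le_ncard_side_add (hT : IsMinimizer T g) (hz : IsPathSeq T (a + b) z)
    (ha : 0 < a) (hb : 0 < b) (h0 : degN T (z 0) ≠ 2) (hN : degN T (z (a + b)) ≠ 2)
    (hmid : ∀ i, 0 < i → i < a + b → i ≠ a → degN T (z i) = 2) (hbr : IsBranchV T (z a))
    (hle : Fintype.card V ≤
      (T.side (z (a - 1)) (z a)).ncard + (T.side (z a) (z (a + 1))).ncard) : b ≤ a := by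
  have hz' : IsPathSeq T (b + a) (fun i => z (a + b - i)) := by
    rw [add_comm b a]
    exact hz.reverse
  refine hT.le_of_ncard_side_add_le hz' hb ha (by simpa using hN) ?_ ?_ ?_ ?_
  · simpa [add_comm b a] using h0
  · intro i h1 h2 h3
    exact hmid _ (by omega) (by omega) (by omega)
  · simpa using hbr
  · have h1 := hz.adj (a - 1) (by omega)
    rw [Nat.sub_add_cancel ha] at h1
    have h2 := hz.adj a (by omega)
    have e1 : a + b - (b - 1) = a + 1 := by omega
    have e2 : a + b - b = a := by omega
    have e3 : a + b - (b + 1) = a - 1 := by omega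
    simp only [e1, e2, e3]
    rw [hT.isTree.ncard_side_swap h1, hT.isTree.ncard_side_swap h2]
    omega

theorem IsMinimizer.exists_unimodal_of_isPathSeq (hT : IsMinimizer T g)
    (hz : IsPathSeq T N z) {c : ℕ} {t : ℕ → ℕ} (hc : 0 < c) (htc : t c = N) (ht : StrictMono t)
    (hd : ∀ i ≤ c, degN T (z (t i)) ≠ 2)
    (hmid : ∀ i < c, ∀ j, t i < j → j < t (i + 1) → degN T (z j) = 2) :
    ∃ j < c, (∀ i₁ i₂, i₁ ≤ i₂ → i₂ ≤ j → t (i₁ + 1) - t i₁ ≤ t (i₂ + 1) - t i₂) ∧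
      ∀ i₁ i₂, j ≤ i₁ → i₁ ≤ i₂ → i₂ < c → t (i₂ + 1) - t i₂ ≤ t (i₁ + 1) - t i₁ := by
  have htN : ∀ i ≤ c, t i ≤ N := fun i hi => htc ▸ ht.monotone hi
  have hstep : ∀ i, t i < t (i + 1) := fun i => ht (Nat.lt_succ_self i)
  have hlast : ∀ i, i + 1 < c → t (i + 1) < N := fun i hi => htc ▸ ht hi
  let D : ℕ → Prop := fun i =>
    (T.side (z (t (i + 1) - 1)) (z (t (i + 1)))).ncard +
      (T.side (z (t (i + 1))) (z (t (i + 1) + 1))).ncard ≤ Fintype.card V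
  have hseg : ∀ i, i + 1 < c →
      IsPathSeq T ((t (i + 1) - t i) + (t (i + 1 + 1) - t (i + 1))) (fun j => z (t i + j)) := by
    intro i hi
    have h1 := hstep i
    have h2 := hstep (i + 1)
    have h3 := htN (i + 1 + 1) (by omega)
    exact hz.mono (by omega)
  have hmid' : ∀ i, i + 1 < c → ∀ j, 0 < j → j < (t (i + 1) - t i) + (t (i + 1 + 1) - t (i + 1)) →
      j ≠ t (i + 1) - t i → degN T (z (t i + j)) = 2 := by
    intro i hi j h0 hj hne
    have h1 := hstep i
    have h2 := hstep (i + 1)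
    obtain h | h : j < t (i + 1) - t i ∨ t (i + 1) - t i < j := by omega
    · exact hmid i (by omega) _ (by omega) (by omega)
    · exact hmid (i + 1) hi _ (by omega) (by omega)
  have hbr : ∀ i, i + 1 < c → IsBranchV T (z (t (i + 1))) := fun i hi =>
    hz.isBranchV_of_pos_of_lt (by have := hstep i; omega) (hlast i hi) (hd _ (by omega))
  refine exists_unimodal_index (fun i => t (i + 1) - t i) D hc ?_ ?_ ?_
  · intro i hi hDi
    have h1 := hstep i
    have h2 := hstep (i + 1)
    have e1 : t i + (t (i + 1) - t i) = t (i + 1) := by omega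
    have e2 : t i + (t (i + 1) - t i + (t (i + 1 + 1) - t (i + 1))) = t (i + 1 + 1) := by omega
    have e3 : t i + (t (i + 1) - t i - 1) = t (i + 1) - 1 := by omega
    have e4 : t i + (t (i + 1) - t i + 1) = t (i + 1) + 1 := by omega
    refine hT.le_of_ncard_side_add_le (hseg i hi) (by omega) (by omega)
      (by simpa using hd i (by omega)) (by rw [e2]; exact hd _ (by omega)) (hmid' i hi)
      (by rw [e1]; exact hbr i hi) ?_
    rw [e1, e3, e4]
    exact hDi
  · intro i hi hDi
    have h1 := hstep i
    have h2 := hstep (i + 1)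
    have e1 : t i + (t (i + 1) - t i) = t (i + 1) := by omega
    have e2 : t i + (t (i + 1) - t i + (t (i + 1 + 1) - t (i + 1))) = t (i + 1 + 1) := by omega
    have e3 : t i + (t (i + 1) - t i - 1) = t (i + 1) - 1 := by omega
    have e4 : t i + (t (i + 1) - t i + 1) = t (i + 1) + 1 := by omega
    refine hT.le_of_le_ncard_side_add (hseg i hi) (by omega) (by omega)
      (by simpa using hd i (by omega)) (by rw [e2]; exact hd _ (by omega)) (hmid' i hi)
      (by rw [e1]; exact hbr i hi) ?_
    rw [e1, e3, e4]
    exact (not_le.1 hDi).le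
  · intro i hi hDi
    have h0 := hstep i
    have h1 := hstep (i + 1)
    have h2 := hlast (i + 1) hi
    have hL : T.side (z (t (i + 1) - 1)) (z (t (i + 1))) ⊆
        T.side (z (t (i + 1 + 1) - 1)) (z (t (i + 1 + 1))) := by
      have := hz.side_subset_side hT.isTree (i := t (i + 1) - 1) (j := t (i + 1 + 1) - 1)
        (by omega) (by omega)
      rwa [Nat.sub_add_cancel (by omega), Nat.sub_add_cancel (by omega)] at this
    have hR := hz.side_subset_side hT.isTree h1.le h2
    have := Set.ncard_le_ncard hL (Set.toFinite _)
    have := Set.ncard_le_ncard hR (Set.toFinite _)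
    simp only [D] at hDi ⊢
    omega

theorem IsMinimizer.exists_unimodal_of_isBackbone (hT : IsMinimizer T g)
    (hbr : ∃ x, IsBranchV T x) {w : T.Walk u v} (hw : IsBackbone T w) :
    ∃ (c : ℕ) (x : Fin (c + 1) → V),
      x 0 = u ∧ x (Fin.last c) = v ∧
      (∀ i : Fin c, IsSegment T (x i.castSucc) (x i.succ)) ∧
      (∀ i, x i ∈ w.support) ∧
      (∀ i j : Fin (c + 1), i < j → T.dist u (x i) < T.dist u (x j)) ∧
      ∃ j : Fin c,
        (∀ i₁ i₂ : Fin c, i₁ ≤ i₂ → i₂ ≤ j →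
          T.dist (x i₁.castSucc) (x i₁.succ) ≤ T.dist (x i₂.castSucc) (x i₂.succ)) ∧
        (∀ i₁ i₂ : Fin c, j ≤ i₁ → i₁ ≤ i₂ →
          T.dist (x i₂.castSucc) (x i₂.succ) ≤ T.dist (x i₁.castSucc) (x i₁.succ)) := by
  have hz := hw.1.isPathSeq
  have hu := hw.reverse.degN_le_one hT.isTree
  have hv := hw.degN_le_one hT.isTree
  obtain ⟨c, t, hc, ht0, htc, ht, hd, hmid⟩ :=
    exists_strictMono_enumeration (fun i => degN T (w.getVert i) ≠ 2) (hw.length_pos hT.isTree hbr)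
      (by rw [Walk.getVert_zero]; omega) (by rw [Walk.getVert_length]; omega)
  simp only [not_not] at hmid
  have htN : ∀ i ≤ c, t i ≤ w.length := fun i hi => htc ▸ ht.monotone hi
  have hdist : ∀ i j, i ≤ j → j ≤ c → T.dist (w.getVert (t i)) (w.getVert (t j)) = t j - t i :=
    fun i j hij hj => hz.dist_eq_sub hT.isTree (ht.monotone hij) (htN j hj)
  have hdist' : ∀ i : Fin c, T.dist (w.getVert (t i.castSucc)) (w.getVert (t i.succ)) =
      t (i + 1) - t i := fun i => hdist i (i + 1) (by omega) (by omega)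
  have hdist0 : ∀ i : Fin (c + 1), T.dist u (w.getVert (t i)) = t i := fun i => by
    have := hdist 0 i (Nat.zero_le _) (by omega)
    rwa [ht0, Walk.getVert_zero] at this
  refine ⟨c, fun i => w.getVert (t i), ?_, ?_, ?_, ?_, ?_, ?_⟩
  · simp [ht0]
  · simp [htc]
  · intro i
    have h1 : t i < t (i + 1) := ht (Nat.lt_succ_self i)
    have h2 := htN (i + 1) (by omega)
    have hs : IsSegSeq T (t (i + 1) - t i) (fun j => w.getVert (t i + j)) := by
      refine ⟨hz.mono (by omega), by omega, by simpa using hd i (by omega), ?_, ?_⟩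
      · rw [Nat.add_sub_cancel' h1.le]
        exact hd _ (by omega)
      · exact fun j h0 hj => hmid i i.2 _ (by omega) (by omega)
    have := hs.isSegment
    rw [Nat.add_sub_cancel' h1.le] at this
    exact this
  · exact fun i => w.getVert_mem_support _
  · intro i j hij
    rw [hdist0, hdist0]
    exact ht hij
  · obtain ⟨j, hj, h1, h2⟩ := hT.exists_unimodal_of_isPathSeq hz hc htc ht hd hmid
    refine ⟨⟨j, hj⟩, fun i₁ i₂ h12 hle => ?_, fun i₁ i₂ hle h12 => ?_⟩
    · rw [hdist', hdist']
      exact h1 i₁ i₂ h12 hle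
    · rw [hdist', hdist']
      exact h2 i₁ i₂ hle h12 i₂.2

end Backbone

end SimpleGraph

/-- For every `k ≥ 2` and every segment sequence `ℓ` (with `m ≥ 3` segments)
realized by some tree, there is a tree `T` with segment sequence `ℓ` maximizing the Steiner
`k`-Wiener index which is a quasi-caterpillar such that, for any backbone, the lengths of
the segments along the backbone (listed in order, from one end to the other, via the
successive segment endpoints `x 0 = u, x 1, …, x c = v`) form a unimodal sequence. -/
theorem exists_maximizer_quasiCaterpillar_unimodal_backbone (k m : ℕ)
    (hk : 2 ≤ k) (hm : 3 ≤ m) (ℓ : Multiset ℕ) (hcard : Multiset.card ℓ = m)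
    (hex : ∃ (V : Type) (_ : Fintype V) (T0 : SimpleGraph V),
      T0.IsTree ∧ segmentMultiset T0 = ℓ) :
    ∃ T : SimpleGraph (Fin (ℓ.sum + 1)), T.IsTree ∧ segmentMultiset T = ℓ ∧
      (∀ (W : Type) [Fintype W] (H : SimpleGraph W), H.IsTree → segmentMultiset H = ℓ →
        steinerWiener H k ≤ steinerWiener T k) ∧
      IsQuasiCaterpillar T ∧
      ∀ (u v : Fin (ℓ.sum + 1)) (w : T.Walk u v), IsBackbone T w →
        ∃ (c : ℕ) (x : Fin (c + 1) → Fin (ℓ.sum + 1)),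
          x 0 = u ∧ x (Fin.last c) = v ∧
          (∀ i : Fin c, IsSegment T (x i.castSucc) (x i.succ)) ∧
          (∀ i, x i ∈ w.support) ∧
          (∀ i j : Fin (c + 1), i < j → T.dist u (x i) < T.dist u (x j)) ∧
          ∃ j : Fin c,
            (∀ i₁ i₂ : Fin c, i₁ ≤ i₂ → i₂ ≤ j →
              T.dist (x i₁.castSucc) (x i₁.succ) ≤ T.dist (x i₂.castSucc) (x i₂.succ)) ∧
            (∀ i₁ i₂ : Fin c, j ≤ i₁ → i₁ ≤ i₂ →
              T.dist (x i₂.castSucc) (x i₂.succ) ≤ T.dist (x i₁.castSucc) (x i₁.succ)) := by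
  obtain ⟨V, _, T₀, hT₀, hℓ⟩ := hex
  obtain ⟨T, g, hT, hTℓ, hmax⟩ :=
    exists_isMinimizer_steinerWiener_le (k := k) (by omega) hT₀ hℓ
  have hbr : ∃ x, IsBranchV T x := hT.isTree.exists_isBranchV (by rw [hTℓ]; omega)
  exact ⟨T, hT.isTree, hTℓ, hmax, hT.isQuasiCaterpillar hbr,
    fun u v w hw => hT.exists_unimodal_of_isBackbone hbr hw⟩
end

section
/- Let T be a tree of order n in which some branch vertex v is the common endpoint of two pendant segments of lengths l_1 and l_2 with l_1 ≥ l_2 ≥ 2. Let T′ be the tree obtained from T by replacing these two pendant segments at v by two pendant segments at v of lengths l_1 + l_2 − 1 and 1 (leaving the rest of T unchanged). Then T′ has order n and the same number of segments as T, and for every integer k ≥ 2, SW_k(T′) ≥ SW_k(T); the inequality is strict whenever k ≤ n − l_2. -/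
open SimpleGraph Finset

/-- The tree obtained from `R` by attaching two pendant paths, of lengths `l₁` and `l₂`
(i.e. with `l₁`, resp. `l₂`, edges), at the vertex `v` of `R`. -/
def attachTwoPaths {V : Type*} (R : SimpleGraph V) (v : V) (l₁ l₂ : ℕ) :
    SimpleGraph (V ⊕ (Fin l₁ ⊕ Fin l₂)) :=
  SimpleGraph.fromRel (fun x y =>
    (∃ a b, R.Adj a b ∧ x = Sum.inl a ∧ y = Sum.inl b) ∨
    (∃ i : Fin l₁, i.val = 0 ∧ x = Sum.inl v ∧ y = Sum.inr (Sum.inl i)) ∨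
    (∃ i j : Fin l₁, j.val = i.val + 1 ∧ x = Sum.inr (Sum.inl i) ∧ y = Sum.inr (Sum.inl j)) ∨
    (∃ i : Fin l₂, i.val = 0 ∧ x = Sum.inl v ∧ y = Sum.inr (Sum.inr i)) ∨
    (∃ i j : Fin l₂, j.val = i.val + 1 ∧ x = Sum.inr (Sum.inr i) ∧ y = Sum.inr (Sum.inr j)))

/-- A system of cuts of a connected graph `G`: the edges of `G` are listed without repetition
by `ε`, and `ε i` is the only edge of `G` joining `C i` to its complement. -/
structure IsCutSystem {V ι : Type*} (G : SimpleGraph V) (ε : ι → Sym2 V)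
    (C : ι → Finset V) : Prop where
  connected : G.Connected
  injective : Function.Injective ε
  range_eq : Set.range ε = G.edgeSet
  crosses_iff : ∀ i x y, G.Adj x y → (s(x, y) = ε i ↔ ¬(x ∈ C i ↔ y ∈ C i))

/-- The set `C` separates `S` if `S` meets both `C` and its complement. -/
def Separates {V : Type*} (C S : Finset V) : Prop :=
  (∃ x ∈ S, x ∈ C) ∧ ∃ x ∈ S, x ∉ C

namespace IsCutSystem

variable {V ι : Type*} {G : SimpleGraph V} {ε : ι → Sym2 V} {C : ι → Finset V}

lemma mem_iff_of_notMem_edges (h : IsCutSystem G ε C) (i : ι) {x y : V} (w : G.Walk x y)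
    (hw : ε i ∉ w.edges) : x ∈ C i ↔ y ∈ C i := by
  induction w with
  | nil => rfl
  | cons hadj p ih =>
    simp only [Walk.edges_cons, List.mem_cons, not_or] at hw
    rw [← ih hw.2]
    by_contra hne
    exact hw.1 ((h.crosses_iff i _ _ hadj).2 hne).symm

lemma not_iff_of_mem_edges (h : IsCutSystem G ε C) (i : ι) {x y : V} (w : G.Walk x y)
    (ht : w.IsTrail) (hw : ε i ∈ w.edges) : ¬(x ∈ C i ↔ y ∈ C i) := by
  induction w with
  | nil => simp at hw
  | cons hadj p ih =>
    rw [Walk.isTrail_cons] at ht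
    simp only [Walk.edges_cons, List.mem_cons] at hw
    have hc := h.crosses_iff i _ _ hadj
    by_cases he : ε i ∈ p.edges
    · have hne : s(_, _) ≠ ε i := fun heq => ht.2 (heq ▸ he)
      have := ih ht.1 he
      tauto
    · have := h.mem_iff_of_notMem_edges i p he
      have := hc.1 (hw.resolve_right he).symm
      tauto

lemma mem_edgeSet_of_separates (h : IsCutSystem G ε C) {i : ι} {S : Finset V}
    (hS : Separates (C i) S) {H : G.Subgraph} (hH : H.Connected) (hSH : ↑S ⊆ H.verts) :
    ε i ∈ H.edgeSet := by
  obtain ⟨⟨x, hxS, hx⟩, y, hyS, hy⟩ := hS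
  obtain ⟨w⟩ := hH.coe.preconnected ⟨x, hSH hxS⟩ ⟨y, hSH hyS⟩
  obtain ⟨d, -, hd, hd'⟩ := w.exists_boundary_dart {z | (z : V) ∈ C i} hx hy
  have hadj : H.Adj d.fst d.snd := d.adj
  rw [← (h.crosses_iff i _ _ hadj.adj_sub).2 (by
    simp only [Set.mem_ofPred_eq] at hd hd'
    tauto)]
  exact hadj

lemma exists_subgraph (h : IsCutSystem G ε C) (s : V) (S : Finset V) :
    ∃ H : G.Subgraph, H.Connected ∧ s ∈ H.verts ∧ ↑S ⊆ H.verts ∧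
      ∀ i, ε i ∈ H.edgeSet → ∃ x ∈ S, ¬(s ∈ C i ↔ x ∈ C i) := by
  classical
  induction S using Finset.induction_on with
  | empty =>
    exact ⟨G.singletonSubgraph s, Subgraph.singletonSubgraph_connected, by simp, by simp,
      by simp⟩
  | insert x S _ ih =>
    obtain ⟨H, hH, hs, hS, hE⟩ := ih
    obtain ⟨w, hw⟩ := h.connected.exists_isPath s x
    have hHw := Subgraph.connected_sup hH.preconnected w.toSubgraph_connected.preconnected
      ⟨s, hs, by simp⟩
    refine ⟨H ⊔ w.toSubgraph, hHw, Or.inl hs, ?_, ?_⟩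
    · intro z hz
      rcases Finset.mem_insert.1 (Finset.mem_coe.1 hz) with rfl | hz
      · exact Or.inr (by simp)
      · exact Or.inl (hS hz)
    · intro i hi
      rw [Subgraph.edgeSet_sup] at hi
      rcases hi with hi | hi
      · obtain ⟨y, hy, hne⟩ := hE i hi
        exact ⟨y, Finset.mem_insert_of_mem hy, hne⟩
      · rw [Walk.mem_edges_toSubgraph] at hi
        exact ⟨x, Finset.mem_insert_self _ _, h.not_iff_of_mem_edges i w hw.isTrail hi⟩

lemma steinerDist_eq [Finite V] (h : IsCutSystem G ε C) {S : Finset V}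
    (hS : S.Nonempty) : steinerDist G S = {i | Separates (C i) S}.ncard := by
  obtain ⟨s, hs⟩ := hS
  obtain ⟨H, hH, -, hSH, hE⟩ := h.exists_subgraph s S
  rw [← Set.ncard_image_of_injective _ h.injective]
  apply le_antisymm
  · have hle : steinerDist G S ≤ H.edgeSet.ncard := Nat.sInf_le ⟨H, hH, hSH, rfl⟩
    refine hle.trans (Set.ncard_le_ncard ?_ (Set.toFinite _))
    intro e he
    obtain ⟨i, rfl⟩ : e ∈ Set.range ε := h.range_eq ▸ H.edgeSet_subset he
    obtain ⟨x, hx, hne⟩ := hE i he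
    refine ⟨i, ?_, rfl⟩
    by_cases hsC : s ∈ C i
    · exact ⟨⟨s, hs, hsC⟩, x, hx, by tauto⟩
    · exact ⟨⟨x, hx, by tauto⟩, s, hs, hsC⟩
  · refine le_csInf ⟨_, H, hH, hSH, rfl⟩ ?_
    rintro _ ⟨H', hH', hSH', rfl⟩
    refine Set.ncard_le_ncard ?_ (Set.toFinite _)
    rintro _ ⟨i, hi, rfl⟩
    exact h.mem_edgeSet_of_separates hi hH' hSH'

end IsCutSystem

/-- The number of `k`-subsets of an `n`-set that are separated by a given `a`-subset. -/
def cutWeight (n k a : ℕ) : ℕ := n.choose k - a.choose k - (n - a).choose k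

open Classical in
lemma card_filter_separates_add {V : Type*} [Fintype V] (C : Finset V) {k : ℕ} (hk : 1 ≤ k) :
    #{S ∈ powersetCard k (univ : Finset V) | Separates C S} + (#C).choose k +
      (Fintype.card V - #C).choose k = (Fintype.card V).choose k := by
  rw [← card_compl, ← card_powersetCard k C, ← card_powersetCard k Cᶜ,
    ← Finset.card_univ, ← card_powersetCard k (univ : Finset V)]
  rw [← card_union_of_disjoint, ← card_union_of_disjoint]
  · congr 1
    ext S
    simp only [mem_union, mem_filter, mem_powersetCard, subset_univ, true_and]
    have h1 : S ⊆ C ↔ ¬ ∃ x ∈ S, x ∉ C := by simp [Finset.subset_iff]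
    have h2 : S ⊆ Cᶜ ↔ ¬ ∃ x ∈ S, x ∈ C := by simp [Finset.subset_iff]
    rw [h1, h2, Separates]
    by_cases p : ∃ x ∈ S, x ∈ C <;> by_cases q : ∃ x ∈ S, x ∉ C <;> simp [p, q]
  · rw [Finset.disjoint_left]
    intro S hS hS'
    have hS' := mem_powersetCard.1 hS'
    obtain ⟨x, hx⟩ : S.Nonempty := card_pos.1 (by omega)
    have hxC := mem_compl.1 (hS'.1 hx)
    rcases mem_union.1 hS with hS | hS
    · obtain ⟨y, hy, hyC⟩ := (mem_filter.1 hS).2.1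
      exact mem_compl.1 (hS'.1 hy) hyC
    · exact hxC ((mem_powersetCard.1 hS).1 hx)
  · rw [Finset.disjoint_left]
    intro S hS hS'
    obtain ⟨y, hy, hyC⟩ := (mem_filter.1 hS).2.2
    exact hyC ((mem_powersetCard.1 hS').1 hy)

lemma IsCutSystem.steinerWiener_eq {V ι : Type*} [Fintype V] [Fintype ι] {G : SimpleGraph V}
    {ε : ι → Sym2 V} {C : ι → Finset V} (h : IsCutSystem G ε C) {k : ℕ} (hk : 1 ≤ k) :
    steinerWiener G k = ∑ i, cutWeight (Fintype.card V) k #(C i) := by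
  classical
  have hS : ∀ S ∈ powersetCard k (univ : Finset V),
      steinerDist G S = ∑ i, if Separates (C i) S then 1 else 0 := by
    intro S hS
    rw [h.steinerDist_eq (card_pos.1 (by rw [(mem_powersetCard.1 hS).2]; omega)),
      Set.ncard_eq_toFinset_card', Finset.sum_boole]
    simp
  rw [steinerWiener, Finset.sum_congr rfl hS, Finset.sum_comm]
  refine Finset.sum_congr rfl fun i _ => ?_
  have := card_filter_separates_add (C i) hk
  rw [Finset.sum_boole, cutWeight, Nat.cast_id]
  omega

lemma choose_add_choose_le (a d c k : ℕ) :
    (a + d).choose k + (a + c).choose k ≤ a.choose k + (a + d + c).choose k := by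
  cases k with
  | zero => simp
  | succ k =>
    induction c with
    | zero => simp [Nat.add_comm]
    | succ c ih =>
      have := Nat.choose_succ_succ (a + c) k
      have := Nat.choose_succ_succ (a + d + c) k
      have := Nat.choose_le_choose k (show a + c ≤ a + d + c by omega)
      simp only [← Nat.add_assoc, Nat.succ_eq_add_one] at *
      omega

lemma choose_add_choose_lt {a d c k : ℕ} (hd : 1 ≤ d) (hc : 1 ≤ c) (hk : 2 ≤ k)
    (hk' : k ≤ a + d + c) :
    (a + d).choose k + (a + c).choose k < a.choose k + (a + d + c).choose k := by
  obtain ⟨k, rfl⟩ := Nat.exists_eq_add_of_le' hk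
  obtain ⟨c, rfl⟩ := Nat.exists_eq_add_of_le' hc
  obtain ⟨d, rfl⟩ := Nat.exists_eq_add_of_le' hd
  have := choose_add_choose_le a (d + 1) c (k + 2)
  have := Nat.choose_succ_succ (a + c) (k + 1)
  have := Nat.choose_succ_succ (a + d + 1 + c) (k + 1)
  have h1 := Nat.choose_succ_succ (a + d + c) k
  have := Nat.choose_le_choose (k + 1) (show a + c ≤ a + d + c by omega)
  have := Nat.choose_pos (show k ≤ a + d + c by omega)
  simp only [← Nat.add_assoc, Nat.succ_eq_add_one] at *
  rw [show a + d + c + 1 = a + d + 1 + c by omega] at h1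
  simp only [Nat.add_assoc, Nat.reduceAdd] at *
  omega

lemma cutWeight_le {n k a b : ℕ} (hab : a ≤ b) (hn : a + b ≤ n) :
    cutWeight n k a ≤ cutWeight n k b := by
  obtain ⟨d, rfl⟩ := Nat.exists_eq_add_of_le hab
  obtain ⟨c, rfl⟩ := Nat.exists_eq_add_of_le hn
  have := choose_add_choose_le a d c k
  unfold cutWeight
  rw [show a + (a + d) + c - a = a + d + c by omega,
    show a + (a + d) + c - (a + d) = a + c by omega]
  omega

lemma choose_add_choose_le_choose_add (a b k : ℕ) (hk : 1 ≤ k) :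
    a.choose k + b.choose k ≤ (a + b).choose k := by
  have := choose_add_choose_le 0 a b k
  simpa [Nat.choose_eq_zero_of_lt (show 0 < k from hk)] using this

lemma cutWeight_lt {n k a b : ℕ} (hab : a < b) (hn : a + b < n) (hk : 2 ≤ k)
    (hk' : k ≤ n - a) : cutWeight n k a < cutWeight n k b := by
  obtain ⟨d, rfl⟩ := Nat.exists_eq_add_of_le hab.le
  obtain ⟨c, rfl⟩ := Nat.exists_eq_add_of_le hn.le
  have h := choose_add_choose_lt (a := a) (d := d) (c := c) (by omega) (by omega) hk (by omega)
  have h2 := choose_add_choose_le_choose_add a (a + d + c) k (by omega)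
  unfold cutWeight
  rw [show a + (a + d) + c - a = a + d + c by omega,
    show a + (a + d) + c - (a + d) = a + c by omega]
  rw [show a + (a + d + c) = a + (a + d) + c by omega] at h2
  omega

open Classical in
lemma SimpleGraph.IsTree.exists_isCutSystem {V : Type*} [Fintype V] {G : SimpleGraph V}
    (hG : G.IsTree) (v : V) : ∃ C : G.edgeSet → Finset V,
      IsCutSystem G (fun e : G.edgeSet => (e : Sym2 V)) C ∧ ∀ e, v ∉ C e := by
  refine ⟨fun e => {x | ¬(G.deleteEdges {(e : Sym2 V)}).Reachable v x},
    ⟨hG.connected, Subtype.val_injective, Subtype.range_coe, ?_⟩, by simp⟩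
  rintro ⟨e, he⟩ x y hxy
  simp only [mem_filter, mem_univ, true_and, not_iff_not]
  constructor
  · rintro rfl
    have hb := isAcyclic_iff_forall_adj_isBridge.1 hG.isAcyclic hxy
    rw [isBridge_iff] at hb
    have hor : (G.deleteEdges {s(x, y)}).Reachable v x ∨
        (G.deleteEdges {s(x, y)}).Reachable v y := by
      by_contra! hnot
      obtain ⟨w⟩ := hG.connected.preconnected v x
      obtain ⟨d, -, hd, hd'⟩ := w.exists_boundary_dart
        {z | (G.deleteEdges {s(x, y)}).Reachable v z} (Reachable.refl _) hnot.1
      simp only [Set.mem_ofPred_eq] at hd hd'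
      by_cases hdx : s(d.fst, d.snd) = s(x, y)
      · rcases Sym2.eq_iff.1 hdx with h | h
        · exact hnot.1 (h.1 ▸ hd)
        · exact hnot.2 (h.1 ▸ hd)
      · exact hd' (hd.trans (Adj.reachable (by simp [deleteEdges_adj, d.adj, hdx])))
    intro h
    by_cases hx : (G.deleteEdges {s(x, y)}).Reachable v x
    · exact hb (hx.symm.trans (h.1 hx))
    · exact hx (h.2 (hor.resolve_left hx))
  · intro h
    by_contra hne
    have hadj : (G.deleteEdges {e}).Adj x y := by simp [deleteEdges_adj, hxy, hne]
    exact h ⟨fun hx => hx.trans hadj.reachable, fun hy => hy.trans hadj.symm.reachable⟩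

namespace attachTwoPaths

variable {V : Type*} {R : SimpleGraph V} {v : V} {l₁ l₂ : ℕ}

@[simp] lemma adj_inl_inl {a b : V} :
    (attachTwoPaths R v l₁ l₂).Adj (Sum.inl a) (Sum.inl b) ↔ R.Adj a b := by
  simp only [attachTwoPaths, fromRel_adj]
  constructor
  · rintro ⟨-, h⟩
    simpa [R.adj_comm b a] using h
  · intro h
    simp [h, h.ne]

@[simp] lemma adj_inl_left {a : V} {i : Fin l₁} :
    (attachTwoPaths R v l₁ l₂).Adj (Sum.inl a) (Sum.inr (Sum.inl i)) ↔ a = v ∧ i.val = 0 := by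
  simp [attachTwoPaths, fromRel_adj, and_comm]

@[simp] lemma adj_inl_right {a : V} {i : Fin l₂} :
    (attachTwoPaths R v l₁ l₂).Adj (Sum.inl a) (Sum.inr (Sum.inr i)) ↔ a = v ∧ i.val = 0 := by
  simp [attachTwoPaths, fromRel_adj, and_comm]

@[simp] lemma adj_left_inl {a : V} {i : Fin l₁} :
    (attachTwoPaths R v l₁ l₂).Adj (Sum.inr (Sum.inl i)) (Sum.inl a) ↔ a = v ∧ i.val = 0 := by
  rw [adj_comm, adj_inl_left]

@[simp] lemma adj_right_inl {a : V} {i : Fin l₂} :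
    (attachTwoPaths R v l₁ l₂).Adj (Sum.inr (Sum.inr i)) (Sum.inl a) ↔ a = v ∧ i.val = 0 := by
  rw [adj_comm, adj_inl_right]

@[simp] lemma adj_left_left {i j : Fin l₁} :
    (attachTwoPaths R v l₁ l₂).Adj (Sum.inr (Sum.inl i)) (Sum.inr (Sum.inl j)) ↔
      j.val = i.val + 1 ∨ i.val = j.val + 1 := by
  simp only [attachTwoPaths, fromRel_adj]
  constructor
  · rintro ⟨-, h⟩
    simpa using h
  · intro h
    refine ⟨?_, by simpa using h⟩
    simp only [ne_eq, Sum.inr.injEq, Sum.inl.injEq, Fin.ext_iff]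
    omega

@[simp] lemma adj_right_right {i j : Fin l₂} :
    (attachTwoPaths R v l₁ l₂).Adj (Sum.inr (Sum.inr i)) (Sum.inr (Sum.inr j)) ↔
      j.val = i.val + 1 ∨ i.val = j.val + 1 := by
  simp only [attachTwoPaths, fromRel_adj]
  constructor
  · rintro ⟨-, h⟩
    simpa using h
  · intro h
    refine ⟨?_, by simpa using h⟩
    simp only [ne_eq, Sum.inr.injEq, Fin.ext_iff]
    omega

@[simp] lemma not_adj_left_right {i : Fin l₁} {j : Fin l₂} :
    ¬(attachTwoPaths R v l₁ l₂).Adj (Sum.inr (Sum.inl i)) (Sum.inr (Sum.inr j)) := by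
  simp [attachTwoPaths, fromRel_adj]

@[simp] lemma not_adj_right_left {i : Fin l₁} {j : Fin l₂} :
    ¬(attachTwoPaths R v l₁ l₂).Adj (Sum.inr (Sum.inr j)) (Sum.inr (Sum.inl i)) := by
  simp [attachTwoPaths, fromRel_adj]

/-- The neighbour of a vertex of the attached paths in the direction of `v`. -/
def parent (v : V) : Fin l₁ ⊕ Fin l₂ → V ⊕ (Fin l₁ ⊕ Fin l₂)
  | Sum.inl i => if i.val = 0 then Sum.inl v else Sum.inr (Sum.inl ⟨i.val - 1, by omega⟩)
  | Sum.inr i => if i.val = 0 then Sum.inl v else Sum.inr (Sum.inr ⟨i.val - 1, by omega⟩)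

lemma parent_left_eq_inl {i : Fin l₁} {a : V} :
    parent (l₂ := l₂) v (Sum.inl i) = Sum.inl a ↔ a = v ∧ i.val = 0 := by
  simp only [parent]
  split_ifs with h <;> simp [h, eq_comm]

lemma parent_left_eq_left {i j : Fin l₁} :
    parent (l₂ := l₂) v (Sum.inl i) = Sum.inr (Sum.inl j) ↔ i.val = j.val + 1 := by
  simp only [parent]
  split_ifs with h
  · simp [h]
  · simp [Fin.ext_iff]
    omega

lemma parent_left_ne_right {i : Fin l₁} {j : Fin l₂} :
    parent v (Sum.inl i) ≠ Sum.inr (Sum.inr j) := by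
  simp only [parent]
  split_ifs <;> simp

lemma parent_right_eq_inl {i : Fin l₂} {a : V} :
    parent (l₁ := l₁) v (Sum.inr i) = Sum.inl a ↔ a = v ∧ i.val = 0 := by
  simp only [parent]
  split_ifs with h <;> simp [h, eq_comm]

lemma parent_right_eq_right {i j : Fin l₂} :
    parent (l₁ := l₁) v (Sum.inr i) = Sum.inr (Sum.inr j) ↔ i.val = j.val + 1 := by
  simp only [parent]
  split_ifs with h
  · simp [h]
  · simp [Fin.ext_iff]
    omega

lemma parent_right_ne_left {i : Fin l₁} {j : Fin l₂} :
    parent v (Sum.inr j) ≠ Sum.inr (Sum.inl i) := by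
  simp only [parent]
  split_ifs <;> simp

lemma adj_parent (z : Fin l₁ ⊕ Fin l₂) :
    (attachTwoPaths R v l₁ l₂).Adj (Sum.inr z) (parent v z) := by
  rcases z with i | i <;> simp only [parent] <;> split_ifs with h <;> simp [h] <;> omega

/-- The vertices of the attached paths that lie beyond a given one, seen from `v`. -/
def beyond : Fin l₁ ⊕ Fin l₂ → Finset (Fin l₁ ⊕ Fin l₂)
  | Sum.inl i => (Finset.Ici i).map Function.Embedding.inl
  | Sum.inr i => (Finset.Ici i).map Function.Embedding.inr

lemma inl_mem_beyond {i j : Fin l₁} :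
    (Sum.inl j : Fin l₁ ⊕ Fin l₂) ∈ beyond (Sum.inl i) ↔ i.val ≤ j.val := by
  simp [beyond]

lemma inr_mem_beyond {i j : Fin l₂} :
    (Sum.inr j : Fin l₁ ⊕ Fin l₂) ∈ beyond (Sum.inr i) ↔ i.val ≤ j.val := by
  simp [beyond]

lemma inl_notMem_beyond {i : Fin l₂} {j : Fin l₁} :
    (Sum.inl j : Fin l₁ ⊕ Fin l₂) ∉ beyond (Sum.inr i) := by
  simp [beyond]

lemma inr_notMem_beyond {i : Fin l₁} {j : Fin l₂} :
    (Sum.inr j : Fin l₁ ⊕ Fin l₂) ∉ beyond (Sum.inl i) := by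
  simp [beyond]

lemma exists_walk_to_left (i : Fin l₁) : ∃ w : (attachTwoPaths R v l₁ l₂).Walk
    (Sum.inl v) (Sum.inr (Sum.inl i)), ∀ x ∈ w.support, x = Sum.inl v ∨
      ∃ j : Fin l₁, j.val ≤ i.val ∧ x = Sum.inr (Sum.inl j) := by
  obtain ⟨i, hi⟩ := i
  induction i with
  | zero =>
    refine ⟨(adj_inl_left.2 ⟨rfl, rfl⟩ : (attachTwoPaths R v l₁ l₂).Adj _ _).toWalk, ?_⟩
    simp
  | succ i ih =>
    obtain ⟨w, hw⟩ := ih (by omega)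
    refine ⟨w.concat (adj_left_left (j := ⟨i + 1, hi⟩).2 (Or.inl rfl)), fun x hx => ?_⟩
    rw [Walk.support_concat, List.mem_append, List.mem_singleton] at hx
    rcases hx with hx | rfl
    · rcases hw x hx with h | ⟨j, hj, h⟩
      · exact Or.inl h
      · exact Or.inr ⟨j, Nat.le_succ_of_le hj, h⟩
    · exact Or.inr ⟨⟨i + 1, hi⟩, le_rfl, rfl⟩

lemma exists_walk_to_right (i : Fin l₂) : ∃ w : (attachTwoPaths R v l₁ l₂).Walk
    (Sum.inl v) (Sum.inr (Sum.inr i)), ∀ x ∈ w.support, x = Sum.inl v ∨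
      ∃ j : Fin l₂, j.val ≤ i.val ∧ x = Sum.inr (Sum.inr j) := by
  obtain ⟨i, hi⟩ := i
  induction i with
  | zero =>
    refine ⟨(adj_inl_right.2 ⟨rfl, rfl⟩ : (attachTwoPaths R v l₁ l₂).Adj _ _).toWalk, ?_⟩
    simp
  | succ i ih =>
    obtain ⟨w, hw⟩ := ih (by omega)
    refine ⟨w.concat (adj_right_right (j := ⟨i + 1, hi⟩).2 (Or.inl rfl)), fun x hx => ?_⟩
    rw [Walk.support_concat, List.mem_append, List.mem_singleton] at hx
    rcases hx with hx | rfl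
    · rcases hw x hx with h | ⟨j, hj, h⟩
      · exact Or.inl h
      · exact Or.inr ⟨j, Nat.le_succ_of_le hj, h⟩
    · exact Or.inr ⟨⟨i + 1, hi⟩, le_rfl, rfl⟩

lemma connected (hR : R.Connected) : (attachTwoPaths R v l₁ l₂).Connected := by
  rw [connected_iff_exists_forall_reachable]
  refine ⟨Sum.inl v, ?_⟩
  rintro (x | i | i)
  · exact (hR.preconnected v x).map ⟨Sum.inl, adj_inl_inl.2⟩
  · exact ⟨(exists_walk_to_left i).choose⟩
  · exact ⟨(exists_walk_to_right i).choose⟩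

/-- The enumeration of the edges of `attachTwoPaths R v l₁ l₂`. -/
def edge (R : SimpleGraph V) (v : V) (l₁ l₂ : ℕ) :
    R.edgeSet ⊕ (Fin l₁ ⊕ Fin l₂) → Sym2 (V ⊕ (Fin l₁ ⊕ Fin l₂))
  | Sum.inl e => (e : Sym2 V).map Sum.inl
  | Sum.inr z => s(Sum.inr z, parent v z)

/-- The cuts of `attachTwoPaths R v l₁ l₂` obtained from cuts of `R` not containing `v`. -/
def cut (l₁ l₂ : ℕ) (C : R.edgeSet → Finset V) :
    R.edgeSet ⊕ (Fin l₁ ⊕ Fin l₂) → Finset (V ⊕ (Fin l₁ ⊕ Fin l₂))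
  | Sum.inl e => (C e).map Function.Embedding.inl
  | Sum.inr z => (beyond z).map Function.Embedding.inr

lemma mk_inr_ne_map_inl {α β : Type*} (e : Sym2 α) (x : α ⊕ β) (z : β) :
    s(Sum.inr z, x) ≠ e.map Sum.inl := by
  induction e with | h a b => simp

lemma edge_injective : Function.Injective (edge R v l₁ l₂) := by
  rintro (e | z) (e' | z') h
  · exact congrArg _ (Subtype.ext (Sym2.map.injective Sum.inl_injective h))
  · exact absurd h.symm (mk_inr_ne_map_inl _ _ _)
  · exact absurd h (mk_inr_ne_map_inl _ _ _)
  · rcases Sym2.eq_iff.1 h with ⟨h, -⟩ | ⟨h, h'⟩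
    · exact congrArg _ (Sum.inr_injective h)
    · have h := h.symm
      rcases z with i | i <;> rcases z' with j | j <;>
        simp only [parent_left_eq_left, parent_right_eq_right, parent_left_ne_right,
          parent_right_ne_left] at h h'
      · omega
      · omega

lemma range_edge : Set.range (edge R v l₁ l₂) = (attachTwoPaths R v l₁ l₂).edgeSet := by
  ext e
  constructor
  · rintro ⟨⟨e, he⟩ | z, rfl⟩
    · induction e with | h a b => simpa [edge] using he
    · exact adj_parent z
  · induction e with | h x y =>
    rcases x with a | i | i <;> rcases y with b | j | j <;> intro h <;>
      simp only [mem_edgeSet, adj_inl_inl, adj_inl_left, adj_inl_right, adj_left_inl,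
        adj_right_inl, adj_left_left, adj_right_right, not_adj_left_right,
        not_adj_right_left] at h
    · exact ⟨Sum.inl ⟨s(a, b), h⟩, rfl⟩
    · exact ⟨Sum.inr (Sum.inl j), Sym2.eq_iff.2 (Or.inr ⟨rfl, parent_left_eq_inl.2 h⟩)⟩
    · exact ⟨Sum.inr (Sum.inr j), Sym2.eq_iff.2 (Or.inr ⟨rfl, parent_right_eq_inl.2 h⟩)⟩
    · exact ⟨Sum.inr (Sum.inl i), Sym2.eq_iff.2 (Or.inl ⟨rfl, parent_left_eq_inl.2 h⟩)⟩
    · rcases h with h | h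
      · exact ⟨Sum.inr (Sum.inl j), Sym2.eq_iff.2 (Or.inr ⟨rfl, parent_left_eq_left.2 h⟩)⟩
      · exact ⟨Sum.inr (Sum.inl i), Sym2.eq_iff.2 (Or.inl ⟨rfl, parent_left_eq_left.2 h⟩)⟩
    · exact ⟨Sum.inr (Sum.inr i), Sym2.eq_iff.2 (Or.inl ⟨rfl, parent_right_eq_inl.2 h⟩)⟩
    · rcases h with h | h
      · exact ⟨Sum.inr (Sum.inr j), Sym2.eq_iff.2 (Or.inr ⟨rfl, parent_right_eq_right.2 h⟩)⟩
      · exact ⟨Sum.inr (Sum.inr i), Sym2.eq_iff.2 (Or.inl ⟨rfl, parent_right_eq_right.2 h⟩)⟩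

lemma isCutSystem {C : R.edgeSet → Finset V}
    (hC : IsCutSystem R (fun e : R.edgeSet => (e : Sym2 V)) C) (hv : ∀ e, v ∉ C e) :
    IsCutSystem (attachTwoPaths R v l₁ l₂) (edge R v l₁ l₂) (cut l₁ l₂ C) := by
  refine ⟨connected hC.connected, edge_injective, range_edge, ?_⟩
  rintro (e | z) x y h
  · rcases x with a | j <;> rcases y with b | k
    · rw [edge, ← Sym2.map_mk, (Sym2.map.injective Sum.inl_injective).eq_iff]
      simpa [cut] using hC.crosses_iff e a b (adj_inl_inl.1 h)
    · have hk : (Sum.inl a : V ⊕ (Fin l₁ ⊕ Fin l₂)) ∉ cut l₁ l₂ C (Sum.inl e) := by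
        rcases k with k | k <;> simp only [adj_inl_left, adj_inl_right] at h <;>
          simp [cut, h.1, hv]
      rw [Sym2.eq_swap]
      simpa [edge, cut, mk_inr_ne_map_inl] using hk
    · have hk : (Sum.inl b : V ⊕ (Fin l₁ ⊕ Fin l₂)) ∉ cut l₁ l₂ C (Sum.inl e) := by
        rcases j with j | j <;> simp only [adj_left_inl, adj_right_inl] at h <;>
          simp [cut, h.1, hv]
      simpa [edge, cut, mk_inr_ne_map_inl] using hk
    · simp [edge, cut, mk_inr_ne_map_inl]
  · rcases z with i | i <;> rcases x with a | j | j <;> rcases y with b | k | k <;>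
      simp [edge, cut, Fin.ext_iff, inl_mem_beyond, inr_mem_beyond, inl_notMem_beyond,
        inr_notMem_beyond, eq_comm (b := parent _ _), parent_left_eq_inl,
        parent_right_eq_inl, parent_left_eq_left, parent_right_eq_right,
        parent_left_ne_right, parent_right_ne_left] at h ⊢
    all_goals first | omega | (simp [h.1, h.2, Fin.le_def]; omega)

open Classical in
/-- The Steiner Wiener index of `attachTwoPaths R v l₁ l₂` as a sum over its edges. -/
lemma steinerWiener_eq [Fintype V] {C : R.edgeSet → Finset V}
    (hC : IsCutSystem R (fun e : R.edgeSet => (e : Sym2 V)) C) (hv : ∀ e, v ∉ C e)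
    (l₁ l₂ : ℕ) {k : ℕ} (hk : 1 ≤ k) :
    steinerWiener (attachTwoPaths R v l₁ l₂) k =
      ∑ e, cutWeight (Fintype.card V + (l₁ + l₂)) k #(C e) +
        (∑ i ∈ range l₁, cutWeight (Fintype.card V + (l₁ + l₂)) k (i + 1) +
          ∑ i ∈ range l₂, cutWeight (Fintype.card V + (l₁ + l₂)) k (i + 1)) := by
  rw [(isCutSystem hC hv).steinerWiener_eq hk, Fintype.sum_sum_type, Fintype.sum_sum_type]
  simp only [cut, beyond, Finset.card_map, Fin.card_Ici, Fintype.card_sum, Fintype.card_fin]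
  congr 1
  have hsum : ∀ (l : ℕ) (f : ℕ → ℕ), ∑ i : Fin l, f (l - i) = ∑ i ∈ range l, f (i + 1) := by
    intro l f
    rw [Fin.sum_univ_eq_sum_range (fun i => f (l - i)), ← Finset.sum_range_reflect]
    refine Finset.sum_congr rfl fun i hi => ?_
    have := Finset.mem_range.1 hi
    congr 1
    omega
  rw [hsum, hsum]

end attachTwoPaths

namespace attachTwoPaths

variable {V : Type*} {R : SimpleGraph V} {v : V} {l₁ l₂ : ℕ}

lemma degN_inl [Finite V] (hl₁ : 0 < l₁) (hl₂ : 0 < l₂) (x : V) [Decidable (x = v)] :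
    degN (attachTwoPaths R v l₁ l₂) (Sum.inl x) = degN R x + if x = v then 2 else 0 := by
  have hS : (attachTwoPaths R v l₁ l₂).neighborSet (Sum.inl x) =
      Set.image Sum.inl (R.neighborSet x) ∪ if x = v then
        {Sum.inr (Sum.inl ⟨0, hl₁⟩), Sum.inr (Sum.inr ⟨0, hl₂⟩)} else ∅ := by
    ext (y | j | j) <;> split_ifs with h <;> simp [h, Fin.ext_iff]
  rw [degN, hS, Set.ncard_union_eq ?_ (Set.toFinite _) (Set.toFinite _),
    Set.ncard_image_of_injective _ Sum.inl_injective, degN]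
  · split_ifs
    · rw [Set.ncard_pair (by simp)]
    · simp
  · split_ifs <;> simp

lemma degN_left (i : Fin l₁) : degN (attachTwoPaths R v l₁ l₂) (Sum.inr (Sum.inl i)) =
    if i.val + 1 = l₁ then 1 else 2 := by
  split_ifs with h
  · rw [degN, Set.ncard_eq_one]
    refine ⟨parent v (Sum.inl i), ?_⟩
    ext (y | j | j) <;> simp [eq_comm (b := parent _ _), parent_left_eq_inl,
      parent_left_eq_left, parent_left_ne_right]
    omega
  · rw [degN, Set.ncard_eq_two]
    refine ⟨parent v (Sum.inl i), Sum.inr (Sum.inl ⟨i.val + 1, by omega⟩), ?_, ?_⟩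
    · rw [Ne, parent_left_eq_left]
      simp
      omega
    · ext (y | j | j) <;> simp [eq_comm (b := parent _ _), parent_left_eq_inl,
        parent_left_eq_left, parent_left_ne_right, Fin.ext_iff]
      omega

lemma degN_right (i : Fin l₂) : degN (attachTwoPaths R v l₁ l₂) (Sum.inr (Sum.inr i)) =
    if i.val + 1 = l₂ then 1 else 2 := by
  split_ifs with h
  · rw [degN, Set.ncard_eq_one]
    refine ⟨parent v (Sum.inr i), ?_⟩
    ext (y | j | j) <;> simp [eq_comm (b := parent _ _), parent_right_eq_inl,
      parent_right_eq_right, parent_right_ne_left]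
    omega
  · rw [degN, Set.ncard_eq_two]
    refine ⟨parent v (Sum.inr i), Sum.inr (Sum.inr ⟨i.val + 1, by omega⟩), ?_, ?_⟩
    · rw [Ne, parent_right_eq_right]
      simp
      omega
    · ext (y | j | j) <;> simp [eq_comm (b := parent _ _), parent_right_eq_inl,
        parent_right_eq_right, parent_right_ne_left, Fin.ext_iff]
      omega

lemma mem_support_of_left {x : V ⊕ (Fin l₁ ⊕ Fin l₂)} {i : Fin l₁}
    (hx : ∀ j : Fin l₁, x ≠ Sum.inr (Sum.inl j))
    (w : (attachTwoPaths R v l₁ l₂).Walk x (Sum.inr (Sum.inl i))) : Sum.inl v ∈ w.support := by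
  obtain ⟨⟨⟨p, q⟩, hpq⟩, hd, hp, hq⟩ := w.exists_boundary_dart
    {z | ∀ j : Fin l₁, z ≠ Sum.inr (Sum.inl j)} hx (by simp)
  have hmem : p ∈ w.support := w.dart_fst_mem_support_of_mem_darts hd
  rcases p with a | j | j <;> rcases q with b | k | k <;> simp at hp hq hpq
  exact hpq.1 ▸ hmem

lemma mem_support_of_right {x : V ⊕ (Fin l₁ ⊕ Fin l₂)} {i : Fin l₂}
    (hx : ∀ j : Fin l₂, x ≠ Sum.inr (Sum.inr j))
    (w : (attachTwoPaths R v l₁ l₂).Walk x (Sum.inr (Sum.inr i))) : Sum.inl v ∈ w.support := by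
  obtain ⟨⟨⟨p, q⟩, hpq⟩, hd, hp, hq⟩ := w.exists_boundary_dart
    {z | ∀ j : Fin l₂, z ≠ Sum.inr (Sum.inr j)} hx (by simp)
  have hmem : p ∈ w.support := w.dart_fst_mem_support_of_mem_darts hd
  rcases p with a | j | j <;> rcases q with b | k | k <;> simp at hp hq hpq
  exact hpq.1 ▸ hmem

end attachTwoPaths

lemma IsSegment.symm {V : Type*} {G : SimpleGraph V} {u v : V} (h : IsSegment G u v) :
    IsSegment G v u := by
  obtain ⟨hne, hu, hv, w, hw, hdeg⟩ := h
  exact ⟨hne.symm, hv, hu, w.reverse, hw.reverse, fun x hx hxv hxu =>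
    hdeg x (by simpa using hx) hxu hxv⟩

lemma IsSegment.of_walk {V : Type*} {G : SimpleGraph V} {u v : V} (hne : u ≠ v)
    (hu : IsLeafV G u ∨ IsBranchV G u) (hv : IsLeafV G v ∨ IsBranchV G v) (w : G.Walk u v)
    (hw : ∀ x ∈ w.support, x ≠ u → x ≠ v → degN G x = 2) : IsSegment G u v := by
  classical
  exact ⟨hne, hu, hv, w.bypass, w.bypass_isPath, fun x hx =>
    hw x (w.support_bypass_subset_support hx)⟩

lemma SimpleGraph.Walk.exists_walk_of_forall_adj {V W : Type*} {G : SimpleGraph V}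
    {H : SimpleGraph W} {f : V → W} (hf : ∀ x y, G.Adj x y → f x = f y ∨ H.Adj (f x) (f y))
    {x y : V} (w : G.Walk x y) :
    ∃ w' : H.Walk (f x) (f y), ∀ z ∈ w'.support, ∃ z' ∈ w.support, f z' = z := by
  induction w with
  | nil => exact ⟨Walk.nil, by simp⟩
  | @cons a b c hadj p ih =>
    obtain ⟨w', hw'⟩ := ih
    have hmem : ∀ z ∈ w'.support, ∃ z' ∈ (Walk.cons hadj p).support, f z' = z := by
      intro z hz
      obtain ⟨z', hz', rfl⟩ := hw' z hz
      exact ⟨z', by simp [hz'], rfl⟩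
    rcases hf _ _ hadj with h | h
    · exact ⟨w'.copy h.symm rfl, by simpa using hmem⟩
    · refine ⟨Walk.cons h w', fun z hz => ?_⟩
      rw [Walk.support_cons, List.mem_cons] at hz
      rcases hz with rfl | hz
      · exact ⟨a, by simp, rfl⟩
      · exact hmem z hz

namespace attachTwoPaths

variable {V : Type*} {R : SimpleGraph V} {v : V} {l₁ l₂ m₁ m₂ : ℕ}

/-- The vertices of `attachTwoPaths R v l₁ l₂` that can be endpoints of segments: those of `R`
and the far ends of the two attached paths. -/
def segmentEnd (hl₁ : 0 < l₁) (hl₂ : 0 < l₂) : V ⊕ Bool → V ⊕ (Fin l₁ ⊕ Fin l₂)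
  | Sum.inl x => Sum.inl x
  | Sum.inr true => Sum.inr (Sum.inl ⟨l₁ - 1, by omega⟩)
  | Sum.inr false => Sum.inr (Sum.inr ⟨l₂ - 1, by omega⟩)

lemma segmentEnd_injective (hl₁ : 0 < l₁) (hl₂ : 0 < l₂) :
    Function.Injective (segmentEnd (V := V) hl₁ hl₂) := by
  rintro (x | _ | _) (y | _ | _) <;> simp [segmentEnd]

lemma degN_segmentEnd [Finite V] (hl₁ : 0 < l₁) (hl₂ : 0 < l₂) (hm₁ : 0 < m₁) (hm₂ : 0 < m₂)
    (a : V ⊕ Bool) : degN (attachTwoPaths R v l₁ l₂) (segmentEnd hl₁ hl₂ a) =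
      degN (attachTwoPaths R v m₁ m₂) (segmentEnd hm₁ hm₂ a) := by
  classical
  rcases a with x | _ | _
  · simp only [segmentEnd, degN_inl hl₁ hl₂, degN_inl hm₁ hm₂]
  · simp only [segmentEnd, degN_right]
    rw [if_pos (by omega), if_pos (by omega)]
  · simp only [segmentEnd, degN_left]
    rw [if_pos (by omega), if_pos (by omega)]

lemma mem_range_segmentEnd (hl₁ : 0 < l₁) (hl₂ : 0 < l₂) {x : V ⊕ (Fin l₁ ⊕ Fin l₂)}
    (hx : IsLeafV (attachTwoPaths R v l₁ l₂) x ∨ IsBranchV (attachTwoPaths R v l₁ l₂) x) :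
    x ∈ Set.range (segmentEnd (V := V) hl₁ hl₂) := by
  rcases x with x | i | i
  · exact ⟨Sum.inl x, rfl⟩
  · refine ⟨Sum.inr true, ?_⟩
    simp only [IsLeafV, IsBranchV, degN_left] at hx
    simp only [segmentEnd, Sum.inr.injEq, Sum.inl.injEq, Fin.ext_iff]
    split_ifs at hx <;> omega
  · refine ⟨Sum.inr false, ?_⟩
    simp only [IsLeafV, IsBranchV, degN_right] at hx
    simp only [segmentEnd, Sum.inr.injEq, Fin.ext_iff]
    split_ifs at hx <;> omega

lemma three_le_degN [Finite V] (hl₁ : 0 < l₁) (hl₂ : 0 < l₂) (hv : 0 < degN R v) :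
    3 ≤ degN (attachTwoPaths R v l₁ l₂) (Sum.inl v) := by
  classical
  rw [degN_inl hl₁ hl₂, if_pos rfl]
  omega

lemma isSegment_left [Finite V] (hl₁ : 0 < l₁) (hl₂ : 0 < l₂) (hv : 0 < degN R v) :
    IsSegment (attachTwoPaths R v l₁ l₂) (Sum.inl v)
      (segmentEnd hl₁ hl₂ (Sum.inr true)) := by
  obtain ⟨w, hw⟩ := exists_walk_to_left (R := R) (v := v) (l₂ := l₂) (⟨l₁ - 1, by omega⟩ : Fin l₁)
  refine IsSegment.of_walk (by simp [segmentEnd]) (Or.inr (three_le_degN hl₁ hl₂ hv))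
    (Or.inl ?_) w ?_
  · rw [IsLeafV, segmentEnd, degN_left, if_pos (by simp; omega)]
  · intro x hx hxv hxe
    rcases hw x hx with rfl | ⟨j, -, rfl⟩
    · exact absurd rfl hxv
    · rw [degN_left, if_neg]
      simp only [ne_eq, segmentEnd, Sum.inr.injEq, Sum.inl.injEq, Fin.ext_iff] at hxe
      omega

lemma isSegment_right [Finite V] (hl₁ : 0 < l₁) (hl₂ : 0 < l₂) (hv : 0 < degN R v) :
    IsSegment (attachTwoPaths R v l₁ l₂) (Sum.inl v)
      (segmentEnd hl₁ hl₂ (Sum.inr false)) := by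
  obtain ⟨w, hw⟩ := exists_walk_to_right (R := R) (v := v) (l₁ := l₁) (⟨l₂ - 1, by omega⟩ : Fin l₂)
  refine IsSegment.of_walk (by simp [segmentEnd]) (Or.inr (three_le_degN hl₁ hl₂ hv))
    (Or.inl ?_) w ?_
  · rw [IsLeafV, segmentEnd, degN_right, if_pos (by simp; omega)]
  · intro x hx hxv hxe
    rcases hw x hx with rfl | ⟨j, -, rfl⟩
    · exact absurd rfl hxv
    · rw [degN_right, if_neg]
      simp only [ne_eq, segmentEnd, Sum.inr.injEq, Fin.ext_iff] at hxe
      omega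

lemma mem_support_of_inr {x : V} {z : Fin l₁ ⊕ Fin l₂}
    (w : (attachTwoPaths R v l₁ l₂).Walk (Sum.inl x) (Sum.inr z)) : Sum.inl v ∈ w.support := by
  rcases z with i | i
  · exact mem_support_of_left (by simp) w
  · exact mem_support_of_right (by simp) w

lemma isSegment_inl_inl [Finite V] (hl₁ : 0 < l₁) (hl₂ : 0 < l₂) (hm₁ : 0 < m₁)
    (hm₂ : 0 < m₂) {x y : V}
    (h : IsSegment (attachTwoPaths R v l₁ l₂) (Sum.inl x) (Sum.inl y)) :
    IsSegment (attachTwoPaths R v m₁ m₂) (Sum.inl x) (Sum.inl y) := by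
  classical
  have hdeg : ∀ a : V, degN (attachTwoPaths R v l₁ l₂) (Sum.inl a) =
      degN (attachTwoPaths R v m₁ m₂) (Sum.inl a) :=
    fun a => degN_segmentEnd hl₁ hl₂ hm₁ hm₂ (Sum.inl a)
  obtain ⟨hne, hx, hy, w, -, hw⟩ := h
  simp only [IsLeafV, IsBranchV, hdeg] at hx hy
  let f : V ⊕ (Fin l₁ ⊕ Fin l₂) → V ⊕ (Fin m₁ ⊕ Fin m₂) :=
    Sum.elim Sum.inl fun _ => Sum.inl v
  have hf : ∀ a b, (attachTwoPaths R v l₁ l₂).Adj a b →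
      f a = f b ∨ (attachTwoPaths R v m₁ m₂).Adj (f a) (f b) := by
    rintro (a | i | i) (b | j | j) hab <;> simp at hab <;> simp [f, hab]
  obtain ⟨w', hw'⟩ := w.exists_walk_of_forall_adj hf
  refine IsSegment.of_walk (by simpa using hne) hx hy w' fun z hz hzx hzy => ?_
  obtain ⟨a, ha, rfl⟩ : ∃ a : V, Sum.inl a ∈ w.support ∧ Sum.inl a = z := by
    obtain ⟨a | c, ha, rfl⟩ := hw' z hz
    · exact ⟨a, ha, rfl⟩
    · exact ⟨v, w.support_takeUntil_subset_support ha (mem_support_of_inr (w.takeUntil _ ha)), rfl⟩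
  rw [← hdeg]
  refine hw _ ha ?_ ?_
  · rintro h
    exact hzx (by simpa [f] using h)
  · rintro h
    exact hzy (by simpa [f] using h)

lemma not_isSegment_inr_inr [Finite V] (hl₁ : 0 < l₁) (hl₂ : 0 < l₂) (hv : 0 < degN R v)
    (b c : Bool) : ¬IsSegment (attachTwoPaths R v l₁ l₂)
      (segmentEnd hl₁ hl₂ (Sum.inr b)) (segmentEnd hl₁ hl₂ (Sum.inr c)) := by
  rintro ⟨hne, -, -, w, -, hw⟩
  have h3 := three_le_degN hl₁ hl₂ hv
  have hmem : Sum.inl v ∈ w.support := by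
    cases b <;> cases c
    · exact absurd rfl hne
    · exact mem_support_of_left (by simp [segmentEnd]) w
    · exact mem_support_of_right (by simp [segmentEnd]) w
    · exact absurd rfl hne
  have := hw _ hmem (by cases b <;> simp [segmentEnd]) (by cases c <;> simp [segmentEnd])
  omega

lemma eq_of_isSegment_inl_inr [Finite V] (hl₁ : 0 < l₁) (hl₂ : 0 < l₂) (hv : 0 < degN R v)
    {x : V} {b : Bool} (h : IsSegment (attachTwoPaths R v l₁ l₂)
      (Sum.inl x) (segmentEnd hl₁ hl₂ (Sum.inr b))) : x = v := by
  obtain ⟨-, -, -, w, -, hw⟩ := h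
  have h3 := three_le_degN hl₁ hl₂ hv
  have hmem : Sum.inl v ∈ w.support := by
    cases b <;> exact mem_support_of_inr w
  by_contra hne
  have := hw _ hmem (by simpa using Ne.symm hne) (by cases b <;> simp [segmentEnd])
  omega

lemma isSegment_segmentEnd [Finite V] (hl₁ : 0 < l₁) (hl₂ : 0 < l₂) (hm₁ : 0 < m₁)
    (hm₂ : 0 < m₂) (hv : 0 < degN R v) {a b : V ⊕ Bool}
    (h : IsSegment (attachTwoPaths R v l₁ l₂)
      (segmentEnd hl₁ hl₂ a) (segmentEnd hl₁ hl₂ b)) :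
    IsSegment (attachTwoPaths R v m₁ m₂) (segmentEnd hm₁ hm₂ a) (segmentEnd hm₁ hm₂ b) := by
  have key : ∀ (x : V) (c : Bool), IsSegment (attachTwoPaths R v l₁ l₂)
      (Sum.inl x) (segmentEnd hl₁ hl₂ (Sum.inr c)) →
      IsSegment (attachTwoPaths R v m₁ m₂) (Sum.inl x) (segmentEnd hm₁ hm₂ (Sum.inr c)) := by
    intro x c h
    obtain rfl := eq_of_isSegment_inl_inr hl₁ hl₂ hv h
    cases c
    · exact isSegment_right hm₁ hm₂ hv
    · exact isSegment_left hm₁ hm₂ hv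
  rcases a with x | c <;> rcases b with y | d
  · exact isSegment_inl_inl hl₁ hl₂ hm₁ hm₂ h
  · exact key x d h
  · exact (key y c h.symm).symm
  · exact absurd h (not_isSegment_inr_inr hl₁ hl₂ hv c d)

lemma card_segmentMultiset_eq_ncard {W : Type*} [Fintype W] (G : SimpleGraph W) :
    Multiset.card (segmentMultiset G) =
      {e : Sym2 W | ∃ u v, e = s(u, v) ∧ IsSegment G u v}.ncard := by
  rw [segmentMultiset, Multiset.card_map, Set.ncard_eq_toFinset_card _ (Set.toFinite _)]
  rfl

lemma card_segmentMultiset [Fintype V] (hl₁ : 0 < l₁) (hl₂ : 0 < l₂) :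
    Multiset.card (segmentMultiset (attachTwoPaths R v l₁ l₂)) =
      {e : Sym2 (V ⊕ Bool) | ∃ a b, e = s(a, b) ∧ IsSegment (attachTwoPaths R v l₁ l₂)
        (segmentEnd hl₁ hl₂ a) (segmentEnd hl₁ hl₂ b)}.ncard := by
  rw [card_segmentMultiset_eq_ncard, ← Set.ncard_image_of_injective _
    (Sym2.map.injective (segmentEnd_injective hl₁ hl₂))]
  congr 1
  ext e
  constructor
  · rintro ⟨x, y, rfl, h⟩
    obtain ⟨a, rfl⟩ := mem_range_segmentEnd hl₁ hl₂ h.2.1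
    obtain ⟨b, rfl⟩ := mem_range_segmentEnd hl₁ hl₂ h.2.2.1
    exact ⟨s(a, b), ⟨a, b, rfl, h⟩, rfl⟩
  · rintro ⟨_, ⟨a, b, rfl, h⟩, rfl⟩
    exact ⟨_, _, rfl, h⟩

lemma card_segmentMultiset_congr [Fintype V] (hl₁ : 0 < l₁) (hl₂ : 0 < l₂) (hm₁ : 0 < m₁)
    (hm₂ : 0 < m₂) (hv : 0 < degN R v) :
    Multiset.card (segmentMultiset (attachTwoPaths R v l₁ l₂)) =
      Multiset.card (segmentMultiset (attachTwoPaths R v m₁ m₂)) := by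
  rw [card_segmentMultiset hl₁ hl₂, card_segmentMultiset hm₁ hm₂]
  congr 1
  ext e
  constructor
  · rintro ⟨a, b, rfl, h⟩
    exact ⟨a, b, rfl, isSegment_segmentEnd hl₁ hl₂ hm₁ hm₂ hv h⟩
  · rintro ⟨a, b, rfl, h⟩
    exact ⟨a, b, rfl, isSegment_segmentEnd hm₁ hm₂ hl₁ hl₂ hv h⟩

end attachTwoPaths

/-- The contribution of two attached paths with `l₁ + m` and `1` edges, with the terms of the
last `m` edges of the longer path in reverse order. -/
lemma sum_cutWeight_add {n k l₁ m : ℕ} :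
    ∑ i ∈ range (l₁ + m), cutWeight n k (i + 1) + ∑ i ∈ range 1, cutWeight n k (i + 1) =
      ∑ i ∈ range l₁, cutWeight n k (i + 1) + cutWeight n k 1 +
        ∑ j ∈ range m, cutWeight n k (l₁ + (m - 1 - j) + 1) := by
  rw [Finset.sum_range_add, Finset.sum_range_one,
    ← Finset.sum_range_reflect (fun j => cutWeight n k (l₁ + j + 1)) m]
  ring

/-- Let `T` be the tree obtained from a tree `R` by attaching two pendant
paths of lengths `l₁ ≥ l₂ ≥ 2` at a vertex `v`, which is a branch vertex of `T` (so the two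
attached paths are pendant segments of `T`), and let `T'` be obtained by replacing them by
pendant segments of lengths `l₁ + l₂ - 1` and `1`.  Then `T'` has the same order and the same
number of segments as `T`, and `SW_k(T') ≥ SW_k(T)` for every `k ≥ 2`, the inequality being
strict whenever `k ≤ n - l₂`, where `n` is the order of `T`. -/
theorem steinerWiener_unbalance_pendant_paths {V : Type} [Fintype V]
    (R : SimpleGraph V) (hR : R.IsTree) (v : V) (l₁ l₂ : ℕ)
    (hl₂ : 2 ≤ l₂) (hl₁ : l₂ ≤ l₁)
    (hbranch : IsBranchV (attachTwoPaths R v l₁ l₂) (Sum.inl v))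
    (k : ℕ) (hk : 2 ≤ k) :
    Fintype.card (V ⊕ (Fin (l₁ + l₂ - 1) ⊕ Fin 1)) = Fintype.card (V ⊕ (Fin l₁ ⊕ Fin l₂)) ∧
    Multiset.card (segmentMultiset (attachTwoPaths R v (l₁ + l₂ - 1) 1)) =
      Multiset.card (segmentMultiset (attachTwoPaths R v l₁ l₂)) ∧
    steinerWiener (attachTwoPaths R v l₁ l₂) k ≤
      steinerWiener (attachTwoPaths R v (l₁ + l₂ - 1) 1) k ∧
    (k ≤ Fintype.card (V ⊕ (Fin l₁ ⊕ Fin l₂)) - l₂ →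
      steinerWiener (attachTwoPaths R v l₁ l₂) k <
        steinerWiener (attachTwoPaths R v (l₁ + l₂ - 1) 1) k) := by
  have hdeg : 0 < degN R v := by
    classical
    rw [IsBranchV, attachTwoPaths.degN_inl (by omega) (by omega), if_pos rfl] at hbranch
    omega
  have hcard : 2 ≤ Fintype.card V := by
    obtain ⟨u, hu⟩ := Set.nonempty_of_ncard_ne_zero hdeg.ne'
    exact Fintype.one_lt_card_iff.2 ⟨v, u, Adj.ne hu⟩
  obtain ⟨C, hC, hv⟩ := hR.exists_isCutSystem v
  obtain ⟨m, rfl⟩ := Nat.exists_eq_add_of_le' (show 1 ≤ l₂ by omega)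
  rw [attachTwoPaths.steinerWiener_eq hC hv _ _ (by omega),
    attachTwoPaths.steinerWiener_eq hC hv _ _ (by omega)]
  simp only [Fintype.card_sum, Fintype.card_fin]
  rw [show l₁ + (m + 1) - 1 + 1 = l₁ + (m + 1) by omega, show l₁ + (m + 1) - 1 = l₁ + m by omega]
  generalize hn : Fintype.card V + (l₁ + (m + 1)) = n
  rw [sum_cutWeight_add, Finset.sum_range_succ', Nat.zero_add]
  refine ⟨rfl, attachTwoPaths.card_segmentMultiset_congr (by omega) (by omega) (by omega)
    (by omega) hdeg, ?_, fun hkn => ?_⟩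
  · have := Finset.sum_le_sum fun j (hj : j ∈ range m) =>
      cutWeight_le (n := n) (k := k) (a := j + 1 + 1) (b := l₁ + (m - 1 - j) + 1)
        (by have := Finset.mem_range.1 hj; omega) (by have := Finset.mem_range.1 hj; omega)
    omega
  · have := Finset.sum_lt_sum_of_nonempty (s := range m) (by simp; omega) fun j hj =>
      cutWeight_lt (n := n) (k := k) (a := j + 1 + 1) (b := l₁ + (m - 1 - j) + 1)
        (by have := Finset.mem_range.1 hj; omega) (by have := Finset.mem_range.1 hj; omega)
        hk (by have := Finset.mem_range.1 hj; omega)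
    omega
end
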